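/- arXiv:2409.02595 — 3 statements merged into one kernel-verified Lean document; each statement's English description precedes it below -/
import Mathlib

section
/- Soundness and completeness of Kleene algebra (Kozen): for all regular expressions e and f over a finite alphabet Σ, e ≡ f is derivable from the Kleene algebra axioms if and only if ⟦e⟧ = ⟦f⟧, i.e., e and f denote the same language. -/
open RegularExpression

/-- The equational theory of Kleene algebra on regular expressions: the smallest
congruence containing the Kleene algebra axioms (Kozen). -/
inductive KAEq {α : Type} [Fintype α] : RegularExpression α → RegularExpression α → Prop
  | refl (e : RegularExpression α) : KAEq e e
  | symm {e f} : KAEq e f → KAEq f e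
  | trans {e f g} : KAEq e f → KAEq f g → KAEq e g
  | add_congr {e e' f f'} : KAEq e e' → KAEq f f' → KAEq (e + f) (e' + f')
  | mul_congr {e e' f f'} : KAEq e e' → KAEq f f' → KAEq (e * f) (e' * f')
  | star_congr {e e'} : KAEq e e' → KAEq e.star e'.star
  | add_assoc (e f g) : KAEq (e + f + g) (e + (f + g))
  | add_comm (e f) : KAEq (e + f) (f + e)
  | add_idem (e) : KAEq (e + e) e
  | add_zero (e) : KAEq (e + 0) e
  | mul_assoc (e f g) : KAEq (e * f * g) (e * (f * g))
  | one_mul (e) : KAEq (1 * e) e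
  | mul_one (e) : KAEq (e * 1) e
  | zero_mul (e) : KAEq (0 * e) 0
  | mul_zero (e) : KAEq (e * 0) 0
  | left_distrib (e f g) : KAEq (e * (f + g)) (e * f + e * g)
  | right_distrib (e f g) : KAEq ((e + f) * g) (e * g + f * g)
  | star_unfold_left (e) : KAEq (1 + e * e.star) e.star
  | star_unfold_right (e) : KAEq (1 + e.star * e) e.star
  | star_ind_left {e f g} : KAEq (f + e * g + g) g → KAEq (e.star * f + g) g
  | star_ind_right {e f g} : KAEq (f + g * e + g) g → KAEq (f * e.star + g) g

open scoped Computability Matrix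

namespace KleeneCompleteness

section MatrixStar

variable {K ι κ : Type*} [KleeneAlgebra K] [Fintype ι]

theorem dotProduct_mono {u v x y : ι → K} (huv : u ≤ v) (hxy : x ≤ y) : u ⬝ᵥ x ≤ v ⬝ᵥ y :=
  Finset.sum_le_sum fun i _ => mul_le_mul' (huv i) (hxy i)

theorem mulVec_mono (A : Matrix κ ι K) {x y : ι → K} (h : x ≤ y) : A *ᵥ x ≤ A *ᵥ y :=
  fun _ => dotProduct_mono le_rfl h

theorem vecMul_mono {x y : ι → K} (h : x ≤ y) (A : Matrix ι κ K) : x ᵥ* A ≤ y ᵥ* A :=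
  fun _ => dotProduct_mono h le_rfl

theorem dotProduct_mul_right (u x : ι → K) (d : K) : u ⬝ᵥ x * d = u ⬝ᵥ fun i => x i * d := by
  simp only [dotProduct, Finset.sum_mul, mul_assoc]

variable [DecidableEq ι]

/-- `S` satisfies the Kleene star laws for the matrix `A`, with induction over vectors. -/
structure IsMatrixStar (A S : Matrix ι ι K) : Prop where
  one_add_mul : 1 + A * S = S
  one_add_star_mul : 1 + S * A = S
  mulVec_le : ∀ x : ι → K, A *ᵥ x ≤ x → S *ᵥ x ≤ x
  vecMul_le : ∀ x : ι → K, x ᵥ* A ≤ x → x ᵥ* S ≤ x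

theorem IsMatrixStar.add {B C S T : Matrix ι ι K} (hS : IsMatrixStar B S)
    (hT : IsMatrixStar (C * S) T) : IsMatrixStar (B + C) (S * T) where
  one_add_mul := by
    calc 1 + (B + C) * (S * T) = B * S * T + (1 + C * S * T) := by noncomm_ring
      _ = (1 + B * S) * T := by rw [hT.one_add_mul]; noncomm_ring
      _ = S * T := by rw [hS.one_add_mul]
  one_add_star_mul := by
    calc 1 + S * T * (B + C) = 1 + S * T * B + S * T * C := by noncomm_ring
      _ = 1 + S * (1 + T * (C * S)) * B + S * T * C := by rw [hT.one_add_star_mul]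
      _ = (1 + S * B) + S * T * C * (1 + S * B) := by noncomm_ring
      _ = S * (1 + T * (C * S)) := by rw [hS.one_add_star_mul]; noncomm_ring
      _ = S * T := by rw [hT.one_add_star_mul]
  mulVec_le x hx := by
    rw [Matrix.add_mulVec] at hx
    have hB := hS.mulVec_le x fun i => (add_le_iff.1 (hx i)).1
    have hC := hT.mulVec_le x <| by
      rw [← Matrix.mulVec_mulVec]
      exact (mulVec_mono C hB).trans fun i => (add_le_iff.1 (hx i)).2
    rw [← Matrix.mulVec_mulVec]
    exact (mulVec_mono S hC).trans hB
  vecMul_le x hx := by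
    rw [Matrix.vecMul_add] at hx
    have hB := hS.vecMul_le x fun i => (add_le_iff.1 (hx i)).1
    have hC := hT.vecMul_le x <| by
      rw [← Matrix.vecMul_vecMul]
      exact (vecMul_mono (fun i => (add_le_iff.1 (hx i)).2) S).trans hB
    rw [← Matrix.vecMul_vecMul]
    exact (vecMul_mono hB T).trans hC

theorem isMatrixStar_zero : IsMatrixStar (0 : Matrix ι ι K) 1 where
  one_add_mul := by simp
  one_add_star_mul := by simp
  mulVec_le x _ := by simp
  vecMul_le x _ := by simp

theorem isMatrixStar_vecMulVec (u v : ι → K) :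
    IsMatrixStar (Matrix.vecMulVec u v)
      (1 + Matrix.vecMulVec u fun j => (v ⬝ᵥ u)∗ * v j) where
  one_add_mul := by
    ext i j
    have := congrArg (fun t => u i * (t * v j)) (one_add_mul_kstar (a := v ⬝ᵥ u))
    simp only [mul_add, mul_one, Matrix.vecMulVec_mul_vecMulVec, Matrix.add_apply,
      Matrix.vecMulVec_apply, Pi.smul_apply, smul_eq_mul] at this ⊢
    rw [← this]
    simp only [add_mul, mul_add, one_mul, mul_assoc]
  one_add_star_mul := by
    have h : (fun j => (v ⬝ᵥ u)∗ * v j) ⬝ᵥ u = (v ⬝ᵥ u)∗ * (v ⬝ᵥ u) := by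
      simp only [dotProduct, Finset.mul_sum, mul_assoc]
    ext i j
    have := congrArg (fun t => u i * (t * v j)) (one_add_kstar_mul (a := v ⬝ᵥ u))
    simp only [add_mul, one_mul, Matrix.vecMulVec_mul_vecMulVec, Matrix.add_apply,
      Matrix.vecMulVec_apply, Pi.smul_apply, smul_eq_mul, h] at this ⊢
    rw [← this]
    simp only [mul_add, mul_assoc]
  mulVec_le x hx := by
    have hx' : ∀ i, u i * (v ⬝ᵥ x) ≤ x i := fun i => by
      simpa [Matrix.vecMulVec_mulVec] using hx i
    have hd : (v ⬝ᵥ u)∗ * (v ⬝ᵥ x) ≤ v ⬝ᵥ x := kstar_mul_le_self <| by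
      rw [dotProduct_mul_right]
      exact dotProduct_mono le_rfl hx'
    have h : (fun j => (v ⬝ᵥ u)∗ * v j) ⬝ᵥ x = (v ⬝ᵥ u)∗ * (v ⬝ᵥ x) := by
      simp only [dotProduct, Finset.mul_sum, mul_assoc]
    intro i
    rw [Matrix.add_mulVec, Matrix.one_mulVec, Matrix.vecMulVec_mulVec, h]
    exact add_le le_rfl ((mul_le_mul' le_rfl hd).trans (hx' i))
  vecMul_le x hx := by
    have hx' : ∀ i, (x ⬝ᵥ u) * v i ≤ x i := fun i => by
      simpa [Matrix.vecMul_vecMulVec] using hx i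
    have hd : (x ⬝ᵥ u) * (v ⬝ᵥ u)∗ ≤ x ⬝ᵥ u := mul_kstar_le_self <| by
      have : (x ⬝ᵥ u) * (v ⬝ᵥ u) = (fun i => (x ⬝ᵥ u) * v i) ⬝ᵥ u := by
        simp only [dotProduct, Finset.mul_sum, mul_assoc]
      rw [this]
      exact dotProduct_mono hx' le_rfl
    intro i
    rw [Matrix.vecMul_add, Matrix.vecMul_one, Matrix.vecMul_vecMulVec]
    refine add_le le_rfl ?_
    simp only [Pi.smul_apply, smul_eq_mul, ← mul_assoc]
    exact (mul_le_mul' hd le_rfl).trans (hx' i)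

theorem exists_isMatrixStar (A : Matrix ι ι K) : ∃ S, IsMatrixStar A S := by
  have key : ∀ s : Finset ι, ∃ S,
      IsMatrixStar (∑ i ∈ s, Matrix.vecMulVec (Pi.single i 1) (A i)) S := by
    intro s
    induction s using Finset.induction_on with
    | empty => exact ⟨1, by simpa using isMatrixStar_zero⟩
    | insert k s hk ih =>
      obtain ⟨S, hS⟩ := ih
      rw [Finset.sum_insert hk, add_comm]
      have hT := isMatrixStar_vecMulVec (Pi.single k 1) (A k ᵥ* S)
      rw [← Matrix.vecMulVec_mul] at hT
      exact ⟨_, hS.add hT⟩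
  convert key Finset.univ
  ext i j
  simp [Matrix.sum_apply, Matrix.vecMulVec_apply, Pi.single_apply]

end MatrixStar

section LinearSystem

variable {K α ι κ : Type*} [KleeneAlgebra K]

variable (K) in
/-- The subsemiring `{0, 1}` of an idempotent semiring. -/
def zeroOne : Subsemiring K where
  carrier := {0, 1}
  zero_mem' := .inl rfl
  one_mem' := .inr rfl
  add_mem' := by
    rintro a b (rfl | rfl) (rfl | rfl)
    · exact .inl (add_zero 0)
    · exact .inr (zero_add 1)
    · exact .inr (add_zero 1)
    · exact .inr (add_idem 1)
  mul_mem' := by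
    rintro a b (rfl | rfl) (rfl | rfl) <;> simp

theorem mem_zeroOne {x : K} : x ∈ zeroOne K ↔ x = 0 ∨ x = 1 := Iff.rfl

theorem le_one_of_mem_zeroOne {x : K} (h : x ∈ zeroOne K) : x ≤ 1 := by
  obtain rfl | rfl := h
  · exact zero_le
  · exact le_rfl

theorem commute_of_mem_zeroOne {x : K} (h : x ∈ zeroOne K) (y : K) : x * y = y * x := by
  obtain rfl | rfl := h <;> simp

theorem kstar_add_of_le_one {p x : K} (hp : p ≤ 1) : (p + x)∗ = x∗ := by
  refine le_antisymm ?_ (kstar_mono (add_le_iff.1 le_rfl).2)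
  refine kstar_le_of_mul_le_left one_le_kstar ?_
  rw [mul_add]
  exact add_le ((mul_le_mul' le_rfl hp).trans (mul_one _).le) kstar_mul_le_kstar

theorem dotProduct_mem_zeroOne [Fintype ι] {u v : ι → K} (hu : ∀ i, u i ∈ zeroOne K)
    (hv : ∀ i, v i ∈ zeroOne K) : u ⬝ᵥ v ∈ zeroOne K :=
  sum_mem fun i _ => mul_mem (hu i) (hv i)

variable [Fintype α] (c : α → K)

/-- The linear map `∑ a, c a • T a` applied to the vector `y`. -/
def step [Fintype κ] (T : α → Matrix ι κ K) (y : κ → K) (i : ι) : K :=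
  ∑ a, c a * (T a *ᵥ y) i

theorem step_mono [Fintype κ] (T : α → Matrix ι κ K) {x y : κ → K} (h : x ≤ y) :
    step c T x ≤ step c T y :=
  fun i => Finset.sum_le_sum fun a _ => mul_le_mul' le_rfl (mulVec_mono (T a) h i)

theorem step_mul_right [Fintype κ] (T : α → Matrix ι κ K) (y : κ → K) (d : K) (i : ι) :
    step c T y i * d = step c T (fun j => y j * d) i := by
  simp only [step, Finset.sum_mul, mul_assoc]
  exact Finset.sum_congr rfl fun a _ => congrArg _ (dotProduct_mul_right ..)

theorem step_fromBlocks [Fintype ι] [Fintype κ] (T : α → Matrix ι ι K) (C : α → Matrix ι κ K)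
    (T' : α → Matrix κ κ K) (y : ι ⊕ κ → K) :
    step c (fun a => Matrix.fromBlocks (T a) (C a) 0 (T' a)) y =
      Sum.elim (step c T (y ∘ Sum.inl) + step c C (y ∘ Sum.inr)) (step c T' (y ∘ Sum.inr)) := by
  ext (i | i) <;>
    simp [step, Matrix.fromBlocks_mulVec, mul_add, Finset.sum_add_distrib, -add_eq_sup]

theorem dotProduct_step [Fintype ι] [Fintype κ] {u : ι → K} (hu : ∀ i, u i ∈ zeroOne K)
    (T : α → Matrix ι κ K) (y : κ → K) :
    u ⬝ᵥ step c T y = ∑ a, c a * ((u ᵥ* T a) ⬝ᵥ y) := by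
  simp only [← Matrix.dotProduct_mulVec]
  simp only [dotProduct, step, Finset.mul_sum]
  rw [Finset.sum_comm]
  refine Finset.sum_congr rfl fun a _ => Finset.sum_congr rfl fun i _ => ?_
  rw [← mul_assoc, commute_of_mem_zeroOne (hu i), mul_assoc]

/-- `q` is the least solution of the linear system with zero-one transition matrices `T` and
zero-one output vector `o`, and remains so after scaling the system on the right. -/
structure IsLeastSolution [Fintype ι] (T : α → Matrix ι ι K) (o q : ι → K) : Prop where
  trans_mem : ∀ a i j, T a i j ∈ zeroOne K
  out_mem : ∀ i, o i ∈ zeroOne K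
  eq_add : ∀ i, q i = o i + step c T q i
  mul_le : ∀ (y : ι → K) (d : K), (∀ i, o i * d + step c T y i ≤ y i) → ∀ i, q i * d ≤ y i

variable {c}

theorem IsLeastSolution.dotProduct_eq [Fintype ι] {T : α → Matrix ι ι K} {o q : ι → K}
    (h : IsLeastSolution c T o q) {u : ι → K} (hu : ∀ i, u i ∈ zeroOne K) :
    u ⬝ᵥ q = u ⬝ᵥ o + ∑ a, c a * ((u ᵥ* T a) ⬝ᵥ q) := by
  rw [← dotProduct_step c hu, ← dotProduct_add]
  exact congrArg _ (funext h.eq_add)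

theorem IsLeastSolution.vecMul_mem [Fintype ι] {T : α → Matrix ι ι K} {o q : ι → K}
    (h : IsLeastSolution c T o q) {u : ι → K} (hu : ∀ i, u i ∈ zeroOne K) (a : α) (j : ι) :
    (u ᵥ* T a) j ∈ zeroOne K :=
  dotProduct_mem_zeroOne hu fun i => h.trans_mem a i j

theorem IsLeastSolution.couple [Fintype ι] [Fintype κ] {T : α → Matrix ι ι K} {o q : ι → K}
    {T' : α → Matrix κ κ K} {o' q' : κ → K} (h : IsLeastSolution c T o q)
    (h' : IsLeastSolution c T' o' q') {p : ι → K} {C : α → Matrix ι κ K} {g : K}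
    (hp : ∀ i, p i ∈ zeroOne K) (hC : ∀ a i j, C a i j ∈ zeroOne K)
    (hg : ∀ i, p i + step c C q' i = o i * g) :
    IsLeastSolution c (fun a => Matrix.fromBlocks (T a) (C a) 0 (T' a)) (Sum.elim p o')
      (Sum.elim (fun i => q i * g) q') where
  trans_mem a := by
    rintro (i | i) (j | j)
    exacts [h.trans_mem a i j, hC a i j, zero_mem _, h'.trans_mem a i j]
  out_mem := by
    rintro (i | i)
    exacts [hp i, h'.out_mem i]
  eq_add := by
    rw [step_fromBlocks]
    rintro (i | i)
    · simp only [Sum.elim_inl, Sum.elim_comp_inl, Sum.elim_comp_inr, Pi.add_apply]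
      rw [add_left_comm, hg, ← step_mul_right, ← add_mul, add_comm, ← h.eq_add]
    · exact h'.eq_add i
  mul_le y d hy := by
    rw [step_fromBlocks] at hy
    have hr : ∀ j, q' j * d ≤ y (Sum.inr j) := h'.mul_le (y ∘ Sum.inr) d fun j => hy (Sum.inr j)
    rintro (i | i)
    · rw [Sum.elim_inl, mul_assoc]
      refine h.mul_le (y ∘ Sum.inl) (g * d) (fun i => ?_) i
      refine le_trans ?_ (hy (Sum.inl i))
      rw [← mul_assoc, ← hg, add_mul, step_mul_right, Sum.elim_inl, Sum.elim_inl, Pi.add_apply,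
        add_assoc, add_comm (step c T _ i)]
      exact add_le_add le_rfl (add_le_add (step_mono c C hr i) le_rfl)
    · exact hr i

theorem IsLeastSolution.kstar [Fintype ι] {T : α → Matrix ι ι K} {o q : ι → K}
    (h : IsLeastSolution c T o q) {u : ι → K} (hu : ∀ i, u i ∈ zeroOne K) :
    IsLeastSolution c (fun a => T a + Matrix.vecMulVec o (u ᵥ* T a)) o
      (fun i => q i * (u ⬝ᵥ q)∗) := by
  have hstep : ∀ y i, step c (fun a => T a + Matrix.vecMulVec o (u ᵥ* T a)) y i =
      step c T y i + o i * ∑ a, c a * ((u ᵥ* T a) ⬝ᵥ y) := fun y i => by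
    simp only [step, Matrix.add_mulVec, Matrix.vecMulVec_mulVec, Pi.add_apply, Pi.smul_apply,
      MulOpposite.smul_eq_mul_unop, MulOpposite.unop_op, mul_add, Finset.sum_add_distrib,
      Finset.mul_sum]
    refine congrArg _ (Finset.sum_congr rfl fun a _ => ?_)
    rw [← mul_assoc, ← mul_assoc, commute_of_mem_zeroOne (h.out_mem i)]
  have hmul : ∀ d, (∑ a, c a * ((u ᵥ* T a) ⬝ᵥ q)) * d =
      ∑ a, c a * ((u ᵥ* T a) ⬝ᵥ fun i => q i * d) := fun d => by
    simp only [Finset.sum_mul, mul_assoc, dotProduct_mul_right]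
  have hstar : (u ⬝ᵥ q)∗ = (∑ a, c a * ((u ᵥ* T a) ⬝ᵥ q))∗ := by
    rw [h.dotProduct_eq hu,
      kstar_add_of_le_one (le_one_of_mem_zeroOne (dotProduct_mem_zeroOne hu h.out_mem))]
  refine ⟨fun a i j => add_mem (h.trans_mem a i j)
    (mul_mem (h.out_mem i) (h.vecMul_mem hu a j)), h.out_mem, fun i => ?_, fun y d hy i => ?_⟩
  · rw [hstep, ← hmul, add_left_comm, ← mul_one_add, hstar, one_add_mul_kstar, add_comm,
      ← step_mul_right, ← add_mul, ← h.eq_add]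
  · set g := d + ∑ a, c a * ((u ᵥ* T a) ⬝ᵥ y) with hg
    have hq : ∀ i, q i * g ≤ y i := h.mul_le y g fun i => by
      refine le_trans (le_of_eq ?_) (hy i)
      rw [hstep, hg, mul_add, add_assoc, add_comm (step c T y i)]
    have hd : (u ⬝ᵥ q)∗ * d ≤ g := by
      rw [hstar]
      refine kstar_mul_le (add_le_iff.1 le_rfl).1 ?_
      rw [hmul]
      refine le_trans ?_ (add_le_iff.1 hg.ge).2
      exact Finset.sum_le_sum fun a _ => mul_le_mul' le_rfl (dotProduct_mono le_rfl hq)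
    rw [mul_assoc]
    exact (mul_le_mul' le_rfl hd).trans (hq i)

variable (c) in
/-- `x` is a zero-one combination of the least solution of a finite linear system. -/
def IsRational (x : K) : Prop :=
  ∃ (ι : Type) (_ : Fintype ι) (T : α → Matrix ι ι K) (o q : ι → K),
    IsLeastSolution c T o q ∧ ∃ u : ι → K, (∀ i, u i ∈ zeroOne K) ∧ u ⬝ᵥ q = x

variable (c) in
theorem isLeastSolution_one : IsLeastSolution c (0 : α → Matrix Unit Unit K) 1 1 where
  trans_mem _ _ _ := zero_mem _
  out_mem _ := one_mem _
  eq_add _ := by simp [step]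
  mul_le y d hy i := by simpa [step] using hy i

theorem IsRational.exists_common {x y : K} (hx : IsRational c x) (hy : IsRational c y) :
    ∃ (ι : Type) (_ : Fintype ι) (T : α → Matrix ι ι K) (o q : ι → K),
      IsLeastSolution c T o q ∧ ∃ u v : ι → K, (∀ i, u i ∈ zeroOne K) ∧ (∀ i, v i ∈ zeroOne K) ∧
        u ⬝ᵥ q = x ∧ v ⬝ᵥ q = y := by
  obtain ⟨ι, _, T, o, q, h, u, hu, rfl⟩ := hx
  obtain ⟨κ, _, T', o', q', h', v, hv, rfl⟩ := hy
  refine ⟨ι ⊕ κ, inferInstance, _, _, _, h.couple h' (p := o) (C := 0) (g := 1) h.out_mem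
    (fun _ _ _ => zero_mem _) (fun i => by simp [step]), Sum.elim u 0, Sum.elim 0 v, ?_, ?_, ?_, ?_⟩
  · rintro (i | i)
    exacts [hu i, zero_mem _]
  · rintro (i | i)
    exacts [zero_mem _, hv i]
  · simp
  · simp

theorem IsRational.zero : IsRational c 0 :=
  ⟨_, _, _, _, _, isLeastSolution_one c, 0, fun _ => zero_mem _, zero_dotProduct _⟩

theorem IsRational.one : IsRational c 1 :=
  ⟨_, _, _, _, _, isLeastSolution_one c, 1, fun _ => one_mem _, by simp⟩

open Classical in
theorem IsRational.letter (a : α) : IsRational c (c a) := by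
  refine ⟨_, _, _, _, _, (isLeastSolution_one c).couple (isLeastSolution_one c) (p := 0)
    (C := fun b _ _ => if b = a then 1 else 0) (g := c a) (fun _ => zero_mem _) (fun b _ _ => ?_)
    (fun i => ?_), Sum.elim 1 0, ?_, ?_⟩
  · split_ifs
    exacts [one_mem _, zero_mem _]
  · simp [step, Matrix.mulVec, dotProduct]
  · rintro (i | i)
    exacts [one_mem _, zero_mem _]
  · simp

theorem IsRational.add {x y : K} (hx : IsRational c x) (hy : IsRational c y) :
    IsRational c (x + y) := by
  obtain ⟨ι, _, T, o, q, h, u, v, hu, hv, rfl, rfl⟩ := hx.exists_common hy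
  exact ⟨ι, _, T, o, q, h, u + v, fun i => add_mem (hu i) (hv i), add_dotProduct ..⟩

theorem IsRational.mul {x y : K} (hx : IsRational c x) (hy : IsRational c y) :
    IsRational c (x * y) := by
  obtain ⟨ι, _, T, o, q, h, u, hu, rfl⟩ := hx
  obtain ⟨κ, _, T', o', q', h', v, hv, rfl⟩ := hy
  refine ⟨ι ⊕ κ, inferInstance, _, _, _, h.couple h' (p := fun i => o i * (v ⬝ᵥ o'))
    (C := fun a => Matrix.vecMulVec o (v ᵥ* T' a)) (g := v ⬝ᵥ q')
    (fun i => mul_mem (h.out_mem i) (dotProduct_mem_zeroOne hv h'.out_mem))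
    (fun a i j => mul_mem (h.out_mem i) (h'.vecMul_mem hv a j)) (fun i => ?_),
    Sum.elim u 0, ?_, ?_⟩
  · rw [h'.dotProduct_eq hv, mul_add, Finset.mul_sum]
    refine congrArg _ (Finset.sum_congr rfl fun a _ => ?_)
    rw [Matrix.vecMulVec_mulVec, Pi.smul_apply, MulOpposite.smul_eq_mul_unop, MulOpposite.unop_op,
      ← mul_assoc, ← mul_assoc, commute_of_mem_zeroOne (h.out_mem i)]
  · rintro (i | i)
    exacts [hu i, zero_mem _]
  · simp [dotProduct_mul_right]

theorem IsRational.kstar {x : K} (hx : IsRational c x) : IsRational c x∗ := by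
  obtain ⟨ι, _, T, o, q, h, u, hu, rfl⟩ := hx
  have : IsRational c (u ⬝ᵥ q * (u ⬝ᵥ q)∗) :=
    ⟨ι, _, _, _, _, h.kstar hu, u, hu, (dotProduct_mul_right ..).symm⟩
  simpa only [one_add_mul_kstar] using IsRational.one.add this

end LinearSystem

section Bisimulation

variable {K α ι R : Type*} [KleeneAlgebra K] [Fintype α] {c : α → K} [Fintype ι] [Finite R]

/-- Two zero-one row families `X`, `Y` over a deterministic system `next` that simulate a linear
system and agree on its output give the same combinations of its least solution. -/
theorem IsLeastSolution.dotProduct_le_of_simulation {T : α → Matrix ι ι K} {o q : ι → K}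
    (h : IsLeastSolution c T o q) {X Y : R → ι → K} (next : R → α → R)
    (hX : ∀ r i, X r i ∈ zeroOne K) (hY : ∀ r i, Y r i ∈ zeroOne K)
    (hXn : ∀ r a, X (next r a) = X r ᵥ* T a) (hYn : ∀ r a, Y (next r a) = Y r ᵥ* T a)
    (hXY : ∀ r, X r ⬝ᵥ o = Y r ⬝ᵥ o) (r : R) : X r ⬝ᵥ q ≤ Y r ⬝ᵥ q := by
  classical
  have := Fintype.ofFinite R
  let A : Matrix ι ι K := .of fun i j => ∑ a, c a * T a i j
  let N : Matrix R R K := .of fun r s => ∑ a, c a * if s = next r a then 1 else 0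
  have hA : ∀ y i, (A *ᵥ y) i = step c T y i := fun y i => by
    simp only [A, step, Matrix.mulVec, dotProduct, Matrix.of_apply, Finset.sum_mul, Finset.mul_sum,
      mul_assoc]
    exact Finset.sum_comm
  have hN : ∀ y r, (N *ᵥ y) r = ∑ a, c a * y (next r a) := fun y r => by
    simp only [N, Matrix.mulVec, dotProduct, Matrix.of_apply, Finset.sum_mul, mul_assoc]
    rw [Finset.sum_comm]
    simp
  obtain ⟨S, hS⟩ := exists_isMatrixStar A
  obtain ⟨P, hP⟩ := exists_isMatrixStar N
  have hXA : Matrix.of X * A = N * Matrix.of X := by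
    ext r j
    have h₁ : (Matrix.of X * A) r j = X r ⬝ᵥ step c T (Pi.single j 1) := by
      refine congrArg (X r ⬝ᵥ ·) (funext fun i => ?_)
      rw [← hA]
      simp [Matrix.col_apply]
    have h₂ : (N * Matrix.of X) r j = (N *ᵥ fun r => X r j) r := rfl
    rw [h₁, h₂, hN, dotProduct_step c (hX r)]
    simp [hXn]
  have hq : q ≤ S *ᵥ o := fun i => by
    have := h.mul_le (S *ᵥ o) 1 (fun i => ?_) i
    · simpa using this
    · rw [mul_one, ← hA]
      conv_rhs => rw [← hS.one_add_mul]
      rw [Matrix.add_mulVec, Matrix.one_mulVec, Matrix.mulVec_mulVec, Pi.add_apply]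
  have hW : P * Matrix.of X * A + Matrix.of X = P * Matrix.of X := by
    conv_rhs => rw [← hP.one_add_star_mul]
    rw [Matrix.mul_assoc, hXA, ← Matrix.mul_assoc, Matrix.add_mul, Matrix.one_mul, add_comm]
  have hWA : (P * Matrix.of X) r ᵥ* A ≤ (P * Matrix.of X) r := fun j =>
    (add_le_iff.1 (congrFun (congrFun hW r) j).le).1
  have hXW : X r ≤ (P * Matrix.of X) r := fun j =>
    (add_le_iff.1 (congrFun (congrFun hW r) j).le).2
  have hY_step : ∀ r, Y r ⬝ᵥ q = Y r ⬝ᵥ o + (N *ᵥ fun r => Y r ⬝ᵥ q) r := fun r => by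
    rw [hN, h.dotProduct_eq (hY r)]
    simp only [hYn]
  calc X r ⬝ᵥ q ≤ X r ⬝ᵥ S *ᵥ o := dotProduct_mono le_rfl hq
    _ = (X r ᵥ* S) ⬝ᵥ o := Matrix.dotProduct_mulVec ..
    _ ≤ (P * Matrix.of X) r ⬝ᵥ o :=
      dotProduct_mono ((vecMul_mono hXW S).trans (hS.vecMul_le _ hWA)) le_rfl
    _ = (P *ᵥ fun r => X r ⬝ᵥ o) r := (congrFun (Matrix.mulVec_mulVec o P (Matrix.of X)) r).symm
    _ ≤ (P *ᵥ fun r => Y r ⬝ᵥ q) r :=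
      mulVec_mono P (fun r => (hXY r).trans_le (add_le_iff.1 (hY_step r).ge).1) r
    _ ≤ Y r ⬝ᵥ q := hP.mulVec_le _ (fun r => (add_le_iff.1 (hY_step r).ge).2) r

end Bisimulation

section LanguageHom

variable {K α : Type*} [KleeneAlgebra K]

theorem mem_sum {ι : Type*} (s : Finset ι) (L : ι → Language α) (w : List α) :
    w ∈ ∑ i ∈ s, L i ↔ ∃ i ∈ s, w ∈ L i := by
  classical
  induction s using Finset.induction_on with
  | empty => simp
  | insert i s hi ih => rw [Finset.sum_insert hi, Language.mem_add, ih]; simp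

theorem nil_mem_map_iff (φ : K →+* Language α) {x : K} (hx : x ∈ zeroOne K) :
    [] ∈ φ x ↔ x = 1 := by
  obtain rfl | rfl := hx
  · rw [map_zero]
    refine iff_of_false id fun h => ?_
    have : [] ∈ φ 1 := map_one φ ▸ Language.nil_mem_one
    rw [← h, map_zero] at this
    exact this
  · simp

variable [Fintype α] {c : α → K}

theorem nil_mem_add_sum {b : Language α} (L : α → Language α) :
    [] ∈ b + ∑ a, {[a]} * L a ↔ [] ∈ b := by
  have : [] ∉ ∑ a, ({[a]} : Language α) * L a := by
    refine Finset.sum_induction _ (fun M : Language α => [] ∉ M)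
      (fun M N hM hN h => ((Language.mem_add M N []).1 h).elim hM hN) id fun a _ h => ?_
    obtain ⟨_, rfl, _, _, h⟩ := Language.mem_mul.1 h
    simp at h
  rw [Language.mem_add]
  simp [this]

theorem cons_mem_add_sum {b : Language α} (hb : b ≤ 1) (L : α → Language α) (a : α) (w : List α) :
    a :: w ∈ b + ∑ a, {[a]} * L a ↔ w ∈ L a := by
  rw [Language.mem_add, mem_sum]
  constructor
  · rintro (h | ⟨a', _, h⟩)
    · cases hb h
    · obtain ⟨_, rfl, v, hv, h⟩ := Language.mem_mul.1 h
      obtain ⟨rfl, rfl⟩ := List.cons.inj h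
      exact hv
  · exact fun h => .inr ⟨a, Finset.mem_univ a, Language.mem_mul.2 ⟨[a], rfl, w, h, rfl⟩⟩

/-- A homomorphism to languages that sends letters to letters separates rational elements. -/
theorem IsRational.eq_of_map_eq (φ : K →+* Language α) (hφ : ∀ a, φ (c a) = {[a]}) {x y : K}
    (hx : IsRational c x) (hy : IsRational c y) (hxy : φ x = φ y) : x = y := by
  obtain ⟨ι, _, T, o, q, h, u, v, hu, hv, rfl, rfl⟩ := hx.exists_common hy
  have hmap : ∀ u : ι → K, (∀ i, u i ∈ zeroOne K) →
      φ (u ⬝ᵥ q) = φ (u ⬝ᵥ o) + ∑ a, {[a]} * φ ((u ᵥ* T a) ⬝ᵥ q) := fun u hu => by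
    rw [h.dotProduct_eq hu, map_add, map_sum]
    simp only [map_mul, hφ]
  let B : Set (ι → K) := {u | ∀ i, u i ∈ zeroOne K}
  have hB : B.Finite := Set.Finite.subset
    (Set.Finite.pi fun _ : ι => (Set.toFinite ({0, 1} : Set K))) fun u hu i _ => hu i
  have := hB.to_subtype
  let R := {p : B × B // φ (p.1.1 ⬝ᵥ q) = φ (p.2.1 ⬝ᵥ q)}
  let next (r : R) (a : α) : R :=
    ⟨(⟨r.1.1.1 ᵥ* T a, h.vecMul_mem r.1.1.2 a⟩, ⟨r.1.2.1 ᵥ* T a, h.vecMul_mem r.1.2.2 a⟩), by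
      have hr := r.2
      have hle : ∀ u ∈ B, φ (u ⬝ᵥ o) ≤ 1 := fun u hu => by
        obtain h | h := mem_zeroOne.1 (dotProduct_mem_zeroOne hu h.out_mem) <;> simp [h]
      rw [hmap _ r.1.1.2, hmap _ r.1.2.2] at hr
      ext w
      rw [← cons_mem_add_sum (hle _ r.1.1.2) (fun a => φ ((r.1.1.1 ᵥ* T a) ⬝ᵥ q)), hr,
        cons_mem_add_sum (hle _ r.1.2.2)]⟩
  have hout : ∀ r : R, r.1.1.1 ⬝ᵥ o = r.1.2.1 ⬝ᵥ o := fun r => by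
    have h₁ := dotProduct_mem_zeroOne r.1.1.2 h.out_mem
    have h₂ := dotProduct_mem_zeroOne r.1.2.2 h.out_mem
    have hr := r.2
    rw [hmap _ r.1.1.2, hmap _ r.1.2.2] at hr
    have key : r.1.1.1 ⬝ᵥ o = 1 ↔ r.1.2.1 ⬝ᵥ o = 1 := by
      rw [← nil_mem_map_iff φ h₁, ← nil_mem_map_iff φ h₂,
        ← nil_mem_add_sum fun a => φ ((r.1.1.1 ᵥ* T a) ⬝ᵥ q), hr, nil_mem_add_sum]
    rcases mem_zeroOne.1 h₁ with h₁ | h₁ <;> rcases mem_zeroOne.1 h₂ with h₂ | h₂ <;> simp_all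
  refine le_antisymm
    (h.dotProduct_le_of_simulation (X := fun r : R => r.1.1.1) (Y := fun r => r.1.2.1) next
      (fun r => r.1.1.2) (fun r => r.1.2.2) (fun _ _ => rfl) (fun _ _ => rfl) hout
      ⟨(⟨u, hu⟩, ⟨v, hv⟩), hxy⟩)
    (h.dotProduct_le_of_simulation (X := fun r : R => r.1.2.1) (Y := fun r => r.1.1.1) next
      (fun r => r.1.2.2) (fun r => r.1.1.2) (fun _ _ => rfl) (fun _ _ => rfl)
      (fun r => (hout r).symm) ⟨(⟨u, hu⟩, ⟨v, hv⟩), hxy⟩)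

end LanguageHom

section Quotient

variable {α : Type} [Fintype α]

theorem matches'_eq_of_kaEq {e f : RegularExpression α} (h : KAEq e f) :
    e.matches' = f.matches' := by
  induction h with
  | refl => rfl
  | symm _ ih => exact ih.symm
  | trans _ _ ih₁ ih₂ => exact ih₁.trans ih₂
  | add_congr _ _ ih₁ ih₂ => rw [matches'_add, matches'_add, ih₁, ih₂]
  | mul_congr _ _ ih₁ ih₂ => rw [matches'_mul, matches'_mul, ih₁, ih₂]
  | star_congr _ ih => rw [matches'_star, matches'_star, ih]
  | add_assoc => exact add_assoc ..
  | add_comm => exact add_comm ..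
  | add_idem => exact add_idem _
  | add_zero => exact add_zero _
  | mul_assoc => exact mul_assoc ..
  | one_mul => exact one_mul _
  | mul_one => exact mul_one _
  | zero_mul => exact zero_mul _
  | mul_zero => exact mul_zero _
  | left_distrib => exact mul_add ..
  | right_distrib => exact add_mul ..
  | star_unfold_left => exact one_add_mul_kstar
  | star_unfold_right => exact one_add_kstar_mul
  | star_ind_left _ ih =>
    have := add_le_iff.1 (add_eq_right_iff_le.1 ih)
    exact add_eq_right_iff_le.2 (kstar_mul_le this.1 this.2)
  | star_ind_right _ ih =>
    have := add_le_iff.1 (add_eq_right_iff_le.1 ih)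
    exact add_eq_right_iff_le.2 (mul_kstar_le this.1 this.2)

variable (α) in
/-- Provable equality as a setoid on regular expressions. -/
def kaSetoid : Setoid (RegularExpression α) where
  r := KAEq
  iseqv := ⟨.refl, .symm, .trans⟩

variable (α) in
/-- The free Kleene algebra: regular expressions modulo provable equality. -/
def FreeKA : Type := Quotient (kaSetoid α)

namespace FreeKA

/-- The class of a regular expression. -/
def mk (e : RegularExpression α) : FreeKA α := Quotient.mk (kaSetoid α) e

theorem mk_eq_iff {e f : RegularExpression α} : mk e = mk f ↔ KAEq e f :=
  Quotient.eq (r := kaSetoid α)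

theorem ind {p : FreeKA α → Prop} (h : ∀ e, p (mk e)) (x : FreeKA α) : p x :=
  Quotient.ind h x

instance : Zero (FreeKA α) := ⟨mk 0⟩

instance : One (FreeKA α) := ⟨mk 1⟩

instance : Add (FreeKA α) :=
  ⟨Quotient.map₂ (· + ·) fun _ _ h _ _ h' => KAEq.add_congr h h'⟩

instance : Mul (FreeKA α) :=
  ⟨Quotient.map₂ (· * ·) fun _ _ h _ _ h' => KAEq.mul_congr h h'⟩

instance : Semiring (FreeKA α) where
  nsmul := nsmulRec
  add_assoc := ind fun e => ind fun f => ind fun g => mk_eq_iff.2 (.add_assoc e f g)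
  zero_add := ind fun e => mk_eq_iff.2 ((KAEq.add_comm 0 e).trans (.add_zero e))
  add_zero := ind fun e => mk_eq_iff.2 (.add_zero e)
  add_comm := ind fun e => ind fun f => mk_eq_iff.2 (.add_comm e f)
  mul_assoc := ind fun e => ind fun f => ind fun g => mk_eq_iff.2 (.mul_assoc e f g)
  one_mul := ind fun e => mk_eq_iff.2 (.one_mul e)
  mul_one := ind fun e => mk_eq_iff.2 (.mul_one e)
  zero_mul := ind fun e => mk_eq_iff.2 (.zero_mul e)
  mul_zero := ind fun e => mk_eq_iff.2 (.mul_zero e)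
  left_distrib := ind fun e => ind fun f => ind fun g => mk_eq_iff.2 (.left_distrib e f g)
  right_distrib := ind fun e => ind fun f => ind fun g => mk_eq_iff.2 (.right_distrib e f g)

instance : IdemSemiring (FreeKA α) :=
  .ofSemiring (ind fun e => mk_eq_iff.2 (.add_idem e))

instance : KStar (FreeKA α) :=
  ⟨Quotient.map RegularExpression.star fun _ _ h => KAEq.star_congr h⟩

theorem one_add_mk_mul_kstar (e : RegularExpression α) : (1 : FreeKA α) + mk e * (mk e)∗ = (mk e)∗ :=
  mk_eq_iff.2 (.star_unfold_left e)

theorem one_add_kstar_mul_mk (e : RegularExpression α) : (1 : FreeKA α) + (mk e)∗ * mk e = (mk e)∗ :=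
  mk_eq_iff.2 (.star_unfold_right e)

instance : KleeneAlgebra (FreeKA α) where
  one_le_kstar := ind fun e => (add_le_iff.1 (one_add_mk_mul_kstar e).le).1
  mul_kstar_le_kstar := ind fun e => (add_le_iff.1 (one_add_mk_mul_kstar e).le).2
  kstar_mul_le_kstar := ind fun e => (add_le_iff.1 (one_add_kstar_mul_mk e).le).2
  mul_kstar_le_self := ind fun e => ind fun f h => by
    have h' : mk f + mk f * mk e + mk f = mk f := add_eq_right_iff_le.2 (add_le le_rfl h)
    exact add_eq_right_iff_le.1 (mk_eq_iff.2 (.star_ind_right (mk_eq_iff.1 h')))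
  kstar_mul_le_self := ind fun e => ind fun f h => by
    have h' : mk f + mk e * mk f + mk f = mk f := add_eq_right_iff_le.2 (add_le le_rfl h)
    exact add_eq_right_iff_le.1 (mk_eq_iff.2 (.star_ind_left (mk_eq_iff.1 h')))

variable (α) in
/-- The language semantics as a semiring homomorphism. -/
def language : FreeKA α →+* Language α where
  toFun := Quotient.lift matches' fun _ _ => matches'_eq_of_kaEq
  map_zero' := rfl
  map_one' := rfl
  map_add' := ind fun _ => ind fun _ => rfl
  map_mul' := ind fun _ => ind fun _ => rfl

theorem isRational_mk (e : RegularExpression α) :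
    IsRational (fun a : α => mk (RegularExpression.char a)) (mk e) := by
  induction e with
  | zero => exact .zero
  | epsilon => exact .one
  | char a => exact .letter (c := fun a : α => mk (RegularExpression.char a)) a
  | plus e f he hf => exact he.add hf
  | comp e f he hf => exact he.mul hf
  | star e he => exact he.kstar

end FreeKA

end Quotient

end KleeneCompleteness

/-- **Statement 6** (Soundness and completeness of Kleene algebra, Kozen).
Two regular expressions over a finite alphabet are provably equal in Kleene algebra
iff they denote the same language. -/
theorem kleeneAlgebra_sound_complete (α : Type) [Fintype α]
    (e f : RegularExpression α) :
    KAEq e f ↔ e.matches' = f.matches' := by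
  refine ⟨KleeneCompleteness.matches'_eq_of_kaEq, fun h => ?_⟩
  exact KleeneCompleteness.FreeKA.mk_eq_iff.1 <|
    (KleeneCompleteness.FreeKA.isRational_mk e).eq_of_map_eq
      (KleeneCompleteness.FreeKA.language α) (fun _ => rfl)
      (KleeneCompleteness.FreeKA.isRational_mk f) h
end

section
/- Soundness and completeness of Milner's proof system Mil: for all regular expressions e and f over a finite alphabet Σ, e = f is derivable in Mil if and only if e and f are bisimilar with respect to the process (operational) semantics of regular expressions. -/
open RegularExpression

/-- The successful-termination predicate of the operational semantics of
regular expressions. -/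
inductive Term {α : Type} : RegularExpression α → Prop
  | one : Term 1
  | add_left {e f : RegularExpression α} : Term e → Term (e + f)
  | add_right {e f : RegularExpression α} : Term f → Term (e + f)
  | mul {e f : RegularExpression α} : Term e → Term f → Term (e * f)
  | star (e : RegularExpression α) : Term e.star

/-- The labelled transition relation of the operational semantics of regular
expressions. -/
inductive Step {α : Type} : RegularExpression α → α → RegularExpression α → Prop
  | char (a : α) : Step (char a) a 1
  | add_left {e f e' : RegularExpression α} {a} : Step e a e' → Step (e + f) a e'
  | add_right {e f f' : RegularExpression α} {a} : Step f a f' → Step (e + f) a f'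
  | mul_left {e f e' : RegularExpression α} {a} : Step e a e' → Step (e * f) a (e' * f)
  | mul_right {e f f' : RegularExpression α} {a} : Term e → Step f a f' → Step (e * f) a f'
  | star {e e' : RegularExpression α} {a} : Step e a e' → Step e.star a (e' * e.star)

/-- `R` is a bisimulation for the operational semantics. -/
def IsBisimulation {α : Type} (R : RegularExpression α → RegularExpression α → Prop) : Prop :=
  ∀ e f, R e f →
    (∀ a e', Step e a e' → ∃ f', Step f a f' ∧ R e' f') ∧
    (∀ a f', Step f a f' → ∃ e', Step e a e' ∧ R e' f') ∧
    (Term e ↔ Term f)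

/-- Bisimilarity of regular expressions w.r.t. the operational semantics. -/
def Bisimilar {α : Type} (e f : RegularExpression α) : Prop :=
  ∃ R, IsBisimulation R ∧ R e f

/-- Milner's proof system `Mil`: the smallest congruence containing its axioms,
including the unique-fixpoint rule. -/
inductive Mil {α : Type} [Fintype α] : RegularExpression α → RegularExpression α → Prop
  | refl (e : RegularExpression α) : Mil e e
  | symm {e f} : Mil e f → Mil f e
  | trans {e f g} : Mil e f → Mil f g → Mil e g
  | add_congr {e e' f f'} : Mil e e' → Mil f f' → Mil (e + f) (e' + f')
  | mul_congr {e e' f f'} : Mil e e' → Mil f f' → Mil (e * f) (e' * f')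
  | star_congr {e e'} : Mil e e' → Mil e.star e'.star
  | add_assoc (e f g) : Mil (e + f + g) (e + (f + g))
  | add_comm (e f) : Mil (e + f) (f + e)
  | add_idem (e) : Mil (e + e) e
  | add_zero (e) : Mil (e + 0) e
  | mul_assoc (e f g) : Mil (e * f * g) (e * (f * g))
  | one_mul (e) : Mil (1 * e) e
  | mul_one (e) : Mil (e * 1) e
  | right_distrib (e f g) : Mil ((e + f) * g) (e * g + f * g)
  | zero_mul (e) : Mil (0 * e) 0
  | star_unfold (e) : Mil (1 + e * e.star) e.star
  | star_one (e : RegularExpression α) : Mil (1 + e).star e.star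
  | fixpoint {e f g} : Mil e (f * e + g) → ¬ Term f → Mil e (f.star * g)

namespace Milner

variable {α : Type}

section Semantics

theorem not_step_zero {a : α} {e : RegularExpression α} : ¬ Step 0 a e := by
  intro h; cases h

theorem not_step_one {a : α} {e : RegularExpression α} : ¬ Step 1 a e := by
  intro h; cases h

theorem step_char {a b : α} {e : RegularExpression α} : Step (char b) a e ↔ a = b ∧ e = 1 := by
  constructor
  · intro h; cases h; exact ⟨rfl, rfl⟩
  · rintro ⟨rfl, rfl⟩; exact Step.char _

theorem step_add {e f g : RegularExpression α} {a : α} :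
    Step (e + f) a g ↔ Step e a g ∨ Step f a g := by
  constructor
  · intro h
    cases h with
    | add_left h => exact Or.inl h
    | add_right h => exact Or.inr h
  · rintro (h | h)
    · exact h.add_left
    · exact h.add_right

theorem step_mul {e f g : RegularExpression α} {a : α} :
    Step (e * f) a g ↔ (∃ e', Step e a e' ∧ g = e' * f) ∨ (Term e ∧ Step f a g) := by
  constructor
  · intro h
    cases h with
    | mul_left h => exact Or.inl ⟨_, h, rfl⟩
    | mul_right h h' => exact Or.inr ⟨h, h'⟩
  · rintro (⟨e', h, rfl⟩ | ⟨h, h'⟩)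
    · exact h.mul_left
    · exact Step.mul_right h h'

theorem step_star {e g : RegularExpression α} {a : α} :
    Step e.star a g ↔ ∃ e', Step e a e' ∧ g = e' * e.star := by
  constructor
  · intro h
    cases h with
    | star h => exact ⟨_, h, rfl⟩
  · rintro ⟨e', h, rfl⟩; exact h.star

theorem not_term_zero : ¬ Term (0 : RegularExpression α) := by
  intro h; cases h

theorem not_term_char {a : α} : ¬ Term (char a) := by
  intro h; cases h

theorem term_add {e f : RegularExpression α} : Term (e + f) ↔ Term e ∨ Term f := by
  constructor
  · intro h
    cases h with
    | add_left h => exact Or.inl h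
    | add_right h => exact Or.inr h
  · rintro (h | h)
    · exact h.add_left
    · exact h.add_right

theorem term_mul {e f : RegularExpression α} : Term (e * f) ↔ Term e ∧ Term f := by
  constructor
  · intro h
    cases h with
    | mul h h' => exact ⟨h, h'⟩
  · rintro ⟨h, h'⟩; exact Term.mul h h'

theorem finite_step (e : RegularExpression α) :
    {p : α × RegularExpression α | Step e p.1 p.2}.Finite := by
  induction e with
  | zero => exact Set.finite_empty.subset fun p h => (not_step_zero h).elim
  | epsilon => exact Set.finite_empty.subset fun p h => (not_step_one h).elim
  | char b =>
    refine (Set.finite_singleton (b, 1)).subset ?_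
    rintro ⟨a, e⟩ h
    obtain ⟨rfl, rfl⟩ := step_char.1 h
    rfl
  | plus e f he hf => exact (he.union hf).subset fun p h => step_add.1 h
  | comp e f he hf =>
    refine ((he.image fun p => (p.1, p.2 * f)).union hf).subset ?_
    rintro ⟨a, g⟩ h
    rcases step_mul.1 h with ⟨e', h, rfl⟩ | ⟨-, h⟩
    · exact Or.inl ⟨(a, e'), h, rfl⟩
    · exact Or.inr h
  | star e he =>
    refine (he.image fun p => (p.1, p.2 * e.star)).subset ?_
    rintro ⟨a, g⟩ h
    obtain ⟨e', h, rfl⟩ := step_star.1 h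
    exact ⟨(a, e'), h, rfl⟩

theorem Bisimilar.refl (e : RegularExpression α) : Bisimilar e e :=
  ⟨Eq, by rintro e _ rfl; exact ⟨fun a e' h => ⟨e', h, rfl⟩, fun a e' h => ⟨e', h, rfl⟩, Iff.rfl⟩,
    rfl⟩

theorem isBisimulation_bisimilar : IsBisimulation (Bisimilar (α := α)) := by
  rintro e f ⟨R, hR, h⟩
  obtain ⟨h₁, h₂, h₃⟩ := hR e f h
  refine ⟨fun a e' he => ?_, fun a f' hf => ?_, h₃⟩
  · obtain ⟨f', hf, h⟩ := h₁ a e' he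
    exact ⟨f', hf, R, hR, h⟩
  · obtain ⟨e', he, h⟩ := h₂ a f' hf
    exact ⟨e', he, R, hR, h⟩

theorem Bisimilar.symm {e f : RegularExpression α} (h : Bisimilar e f) : Bisimilar f e := by
  refine ⟨fun x y => Bisimilar y x, fun x y hxy => ?_, h⟩
  obtain ⟨h₁, h₂, h₃⟩ := isBisimulation_bisimilar y x hxy
  exact ⟨h₂, h₁, h₃.symm⟩

theorem Bisimilar.trans {e f g : RegularExpression α} (h : Bisimilar e f) (h' : Bisimilar f g) :
    Bisimilar e g := by
  refine ⟨fun x z => ∃ y, Bisimilar x y ∧ Bisimilar y z, ?_, f, h, h'⟩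
  rintro x z ⟨y, hxy, hyz⟩
  obtain ⟨h₁, h₂, h₃⟩ := isBisimulation_bisimilar x y hxy
  obtain ⟨k₁, k₂, k₃⟩ := isBisimulation_bisimilar y z hyz
  refine ⟨fun a x' hx => ?_, fun a z' hz => ?_, h₃.trans k₃⟩
  · obtain ⟨y', hy, r⟩ := h₁ a x' hx
    obtain ⟨z', hz, r'⟩ := k₁ a y' hy
    exact ⟨z', hz, y', r, r'⟩
  · obtain ⟨y', hy, r⟩ := k₂ a z' hz
    obtain ⟨x', hx, r'⟩ := h₂ a y' hy
    exact ⟨x', hx, y', r', r⟩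

/-- The setoid of bisimilarity. -/
def bisimSetoid (α : Type) : Setoid (RegularExpression α) where
  r := Bisimilar
  iseqv := ⟨Bisimilar.refl, Bisimilar.symm, Bisimilar.trans⟩

/-- Processes: regular expressions modulo bisimilarity. -/
def Proc (α : Type) : Type := Quotient (bisimSetoid α)

namespace Proc

/-- The process denoted by an expression. -/
def mk (e : RegularExpression α) : Proc α := Quotient.mk (bisimSetoid α) e

theorem mk_eq {e f : RegularExpression α} : mk e = mk f ↔ Bisimilar e f :=
  Quotient.eq (r := bisimSetoid α)

theorem exists_rep (c : Proc α) : ∃ e, mk e = c := Quotient.exists_rep c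

/-- An expression denoting a given process. -/
noncomputable def rep (c : Proc α) : RegularExpression α := c.exists_rep.choose

@[simp] theorem mk_rep (c : Proc α) : mk c.rep = c := c.exists_rep.choose_spec

/-- Termination of processes. -/
def Tm (c : Proc α) : Prop := ∃ e, mk e = c ∧ Term e

/-- Transitions of processes. -/
def Tr (c : Proc α) (a : α) (d : Proc α) : Prop := ∃ e e', mk e = c ∧ Step e a e' ∧ mk e' = d

theorem tm_mk {e : RegularExpression α} : Tm (mk e) ↔ Term e := by
  constructor
  · rintro ⟨f, h, hf⟩
    exact (isBisimulation_bisimilar _ _ (mk_eq.1 h)).2.2.1 hf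
  · exact fun h => ⟨e, rfl, h⟩

theorem tr_mk {e : RegularExpression α} {a : α} {d : Proc α} :
    Tr (mk e) a d ↔ ∃ e', Step e a e' ∧ mk e' = d := by
  constructor
  · rintro ⟨f, f', h, hf, rfl⟩
    obtain ⟨e', he, h⟩ := (isBisimulation_bisimilar _ _ (mk_eq.1 h)).1 a f' hf
    exact ⟨e', he, (mk_eq.2 h).symm⟩
  · rintro ⟨e', h, h'⟩
    exact ⟨e, e', rfl, h, h'⟩

theorem finite_tr (c : Proc α) : {p : α × Proc α | Tr c p.1 p.2}.Finite := by
  obtain ⟨e, rfl⟩ := c.exists_rep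
  refine ((finite_step e).image fun p => (p.1, mk p.2)).subset ?_
  rintro ⟨a, d⟩ h
  obtain ⟨e', h, rfl⟩ := tr_mk.1 h
  exact ⟨(a, e'), h, rfl⟩

/-- Coinduction up to equality: bisimilar processes are equal. -/
theorem coind (R : Proc α → Proc α → Prop)
    (hR : ∀ c d, R c d → (Tm c ↔ Tm d) ∧
      (∀ a c', Tr c a c' → ∃ d', Tr d a d' ∧ (c' = d' ∨ R c' d')) ∧
      (∀ a d', Tr d a d' → ∃ c', Tr c a c' ∧ (c' = d' ∨ R c' d')))
    {c d : Proc α} (h : R c d) : c = d := by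
  obtain ⟨e, rfl⟩ := c.exists_rep
  obtain ⟨f, rfl⟩ := d.exists_rep
  refine mk_eq.2 ⟨fun x y => mk x = mk y ∨ R (mk x) (mk y), ?_, Or.inr h⟩
  rintro x y (h | h)
  · obtain ⟨h₁, h₂, h₃⟩ := isBisimulation_bisimilar _ _ (mk_eq.1 h)
    refine ⟨fun a x' hx => ?_, fun a y' hy => ?_, h₃⟩
    · obtain ⟨y', hy, h⟩ := h₁ a x' hx
      exact ⟨y', hy, Or.inl (mk_eq.2 h)⟩
    · obtain ⟨x', hx, h⟩ := h₂ a y' hy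
      exact ⟨x', hx, Or.inl (mk_eq.2 h)⟩
  · obtain ⟨h₁, h₂, h₃⟩ := hR _ _ h
    refine ⟨fun a x' hx => ?_, fun a y' hy => ?_, by simpa only [tm_mk] using h₁⟩
    · obtain ⟨d', hd, h⟩ := h₂ a (mk x') (tr_mk.2 ⟨x', hx, rfl⟩)
      obtain ⟨y', hy, rfl⟩ := tr_mk.1 hd
      exact ⟨y', hy, h⟩
    · obtain ⟨d', hd, h⟩ := h₃ a (mk y') (tr_mk.2 ⟨y', hy, rfl⟩)
      obtain ⟨x', hx, rfl⟩ := tr_mk.1 hd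
      exact ⟨x', hx, h⟩

theorem ext' {c d : Proc α} (h : Tm c ↔ Tm d) (h' : ∀ a b, Tr c a b ↔ Tr d a b) : c = d := by
  refine coind (fun x y => x = c ∧ y = d) ?_ ⟨rfl, rfl⟩
  rintro _ _ ⟨rfl, rfl⟩
  exact ⟨h, fun a c' hc => ⟨c', (h' a c').1 hc, Or.inl rfl⟩,
    fun a d' hd => ⟨d', (h' a d').2 hd, Or.inl rfl⟩⟩

theorem bisimilar_mul {e e' f f' : RegularExpression α} (h : Bisimilar e e')
    (h' : Bisimilar f f') : Bisimilar (e * f) (e' * f') := by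
  refine ⟨fun x y => Bisimilar x y ∨ ∃ u u', Bisimilar u u' ∧ x = u * f ∧ y = u' * f', ?_,
    Or.inr ⟨e, e', h, rfl, rfl⟩⟩
  obtain ⟨k₁, k₂, k₃⟩ := isBisimulation_bisimilar _ _ h'
  rintro x y (h | ⟨u, u', h, rfl, rfl⟩)
  · obtain ⟨h₁, h₂, h₃⟩ := isBisimulation_bisimilar _ _ h
    refine ⟨fun a x' hx => ?_, fun a y' hy => ?_, h₃⟩
    · obtain ⟨y', hy, h⟩ := h₁ a x' hx
      exact ⟨y', hy, Or.inl h⟩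
    · obtain ⟨x', hx, h⟩ := h₂ a y' hy
      exact ⟨x', hx, Or.inl h⟩
  · obtain ⟨h₁, h₂, h₃⟩ := isBisimulation_bisimilar _ _ h
    refine ⟨fun a x' hx => ?_, fun a y' hy => ?_, by simp only [term_mul, h₃, k₃]⟩
    · rcases step_mul.1 hx with ⟨v, hv, rfl⟩ | ⟨ht, hx⟩
      · obtain ⟨v', hv', r⟩ := h₁ a v hv
        exact ⟨_, hv'.mul_left, Or.inr ⟨v, v', r, rfl, rfl⟩⟩
      · obtain ⟨y', hy, r⟩ := k₁ a x' hx
        exact ⟨y', Step.mul_right (h₃.1 ht) hy, Or.inl r⟩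
    · rcases step_mul.1 hy with ⟨v, hv, rfl⟩ | ⟨ht, hy⟩
      · obtain ⟨v', hv', r⟩ := h₂ a v hv
        exact ⟨_, hv'.mul_left, Or.inr ⟨v', v, r, rfl, rfl⟩⟩
      · obtain ⟨x', hx, r⟩ := k₂ a y' hy
        exact ⟨x', Step.mul_right (h₃.2 ht) hx, Or.inl r⟩

/-- Sequential composition of processes. -/
instance : Mul (Proc α) :=
  ⟨Quotient.map₂ (sa := bisimSetoid α) (sb := bisimSetoid α) (sc := bisimSetoid α)
    (fun e f => e * f) fun _ _ h _ _ h' => bisimilar_mul h h'⟩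

theorem mk_mul (e f : RegularExpression α) : mk (e * f) = mk e * mk f := rfl

theorem tm_mul {c d : Proc α} : Tm (c * d) ↔ Tm c ∧ Tm d := by
  obtain ⟨e, rfl⟩ := c.exists_rep
  obtain ⟨f, rfl⟩ := d.exists_rep
  rw [← mk_mul]; simp only [tm_mk, term_mul]

theorem tr_mul {c d b : Proc α} {a : α} :
    Tr (c * d) a b ↔ (∃ c', Tr c a c' ∧ b = c' * d) ∨ (Tm c ∧ Tr d a b) := by
  obtain ⟨e, rfl⟩ := c.exists_rep
  obtain ⟨f, rfl⟩ := d.exists_rep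
  rw [← mk_mul]; simp only [tm_mk, tr_mk, step_mul]
  constructor
  · rintro ⟨g, ⟨e', h, rfl⟩ | ⟨h, h'⟩, rfl⟩
    · exact Or.inl ⟨mk e', ⟨e', h, rfl⟩, rfl⟩
    · exact Or.inr ⟨h, g, h', rfl⟩
  · rintro (⟨_, ⟨e', h, rfl⟩, rfl⟩ | ⟨h, g, h', rfl⟩)
    · exact ⟨_, Or.inl ⟨e', h, rfl⟩, rfl⟩
    · exact ⟨g, Or.inr ⟨h, h'⟩, rfl⟩

theorem tm_one : Tm (mk (1 : RegularExpression α)) := tm_mk.2 Term.one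

theorem not_tr_one {a : α} {d : Proc α} : ¬ Tr (mk 1) a d := by
  rw [tr_mk]; rintro ⟨e', h, -⟩; exact not_step_one h

theorem not_tm_zero : ¬ Tm (mk (0 : RegularExpression α)) := fun h => not_term_zero (tm_mk.1 h)

theorem not_tr_zero {a : α} {d : Proc α} : ¬ Tr (mk 0) a d := by
  rw [tr_mk]; rintro ⟨e', h, -⟩; exact not_step_zero h

theorem tm_add {e f : RegularExpression α} : Tm (mk (e + f)) ↔ Tm (mk e) ∨ Tm (mk f) := by
  simp only [tm_mk, term_add]

theorem tr_add {e f : RegularExpression α} {a : α} {d : Proc α} :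
    Tr (mk (e + f)) a d ↔ Tr (mk e) a d ∨ Tr (mk f) a d := by
  simp only [tr_mk, step_add, or_and_right, exists_or]

theorem tm_star {e : RegularExpression α} : Tm (mk e.star) := tm_mk.2 (Term.star e)

theorem tr_star {e : RegularExpression α} {a : α} {d : Proc α} :
    Tr (mk e.star) a d ↔ ∃ b, Tr (mk e) a b ∧ d = b * mk e.star := by
  simp only [tr_mk, step_star]
  constructor
  · rintro ⟨_, ⟨e', h, rfl⟩, rfl⟩
    exact ⟨mk e', ⟨e', h, rfl⟩, rfl⟩
  · rintro ⟨_, ⟨e', h, rfl⟩, rfl⟩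
    exact ⟨_, ⟨e', h, rfl⟩, rfl⟩

theorem tr_char {b a : α} {d : Proc α} : Tr (mk (char b)) a d ↔ a = b ∧ d = mk 1 := by
  simp only [tr_mk, step_char]
  constructor
  · rintro ⟨_, ⟨rfl, rfl⟩, rfl⟩; exact ⟨rfl, rfl⟩
  · rintro ⟨rfl, rfl⟩; exact ⟨_, ⟨rfl, rfl⟩, rfl⟩

instance : Monoid (Proc α) where
  one := mk 1
  mul_assoc x y z := by
    refine coind (fun c d => ∃ x, c = x * y * z ∧ d = x * (y * z)) ?_ ⟨x, rfl, rfl⟩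
    rintro _ _ ⟨x, rfl, rfl⟩
    refine ⟨by simp only [tm_mul, and_assoc], fun a c' h => ?_, fun a c' h => ?_⟩
    · rcases tr_mul.1 h with ⟨_, h₁, rfl⟩ | ⟨h₁, h₂⟩
      · rcases tr_mul.1 h₁ with ⟨x', h₂, rfl⟩ | ⟨h₂, h₃⟩
        · exact ⟨_, tr_mul.2 (Or.inl ⟨x', h₂, rfl⟩), Or.inr ⟨x', rfl, rfl⟩⟩
        · exact ⟨_, tr_mul.2 (Or.inr ⟨h₂, tr_mul.2 (Or.inl ⟨_, h₃, rfl⟩)⟩), Or.inl rfl⟩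
      · rw [tm_mul] at h₁
        exact ⟨_, tr_mul.2 (Or.inr ⟨h₁.1, tr_mul.2 (Or.inr ⟨h₁.2, h₂⟩)⟩), Or.inl rfl⟩
    · rcases tr_mul.1 h with ⟨x', h₁, rfl⟩ | ⟨h₁, h₂⟩
      · exact ⟨_, tr_mul.2 (Or.inl ⟨_, tr_mul.2 (Or.inl ⟨x', h₁, rfl⟩), rfl⟩),
          Or.inr ⟨x', rfl, rfl⟩⟩
      · rcases tr_mul.1 h₂ with ⟨y', h₃, rfl⟩ | ⟨h₃, h₄⟩
        · exact ⟨_, tr_mul.2 (Or.inl ⟨_, tr_mul.2 (Or.inr ⟨h₁, h₃⟩), rfl⟩), Or.inl rfl⟩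
        · exact ⟨_, tr_mul.2 (Or.inr ⟨tm_mul.2 ⟨h₁, h₃⟩, h₄⟩), Or.inl rfl⟩
  one_mul x := by
    refine ext' ?_ fun a b => ?_
    · exact tm_mul.trans (and_iff_right tm_one)
    · refine tr_mul.trans ⟨?_, fun h => Or.inr ⟨tm_one, h⟩⟩
      rintro (⟨_, h, -⟩ | ⟨-, h⟩)
      · exact (not_tr_one h).elim
      · exact h
  mul_one x := by
    refine coind (fun c d => c = d * mk 1) ?_ rfl
    rintro _ d rfl
    refine ⟨tm_mul.trans (and_iff_left tm_one), fun a c' h => ?_, fun a c' h => ?_⟩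
    · rcases tr_mul.1 h with ⟨d', h₁, rfl⟩ | ⟨-, h₁⟩
      · exact ⟨d', h₁, Or.inr rfl⟩
      · exact (not_tr_one h₁).elim
    · exact ⟨_, tr_mul.2 (Or.inl ⟨c', h, rfl⟩), Or.inr rfl⟩

theorem mk_one : mk (1 : RegularExpression α) = 1 := rfl

theorem zero_mul (c : Proc α) : mk 0 * c = mk 0 := by
  refine ext' (by simp [tm_mul, not_tm_zero]) fun a b => ?_
  simp [tr_mul, not_tm_zero, not_tr_zero]

theorem fixpoint {c d : Proc α} {f : RegularExpression α} (hf : ¬ Term f)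
    (htm : Tm c ↔ Tm d)
    (htr : ∀ a b, Tr c a b ↔ Tr (mk f * c) a b ∨ Tr d a b) : c = mk f.star * d := by
  have hf' : ¬ Tm (mk f) := fun h => hf (tm_mk.1 h)
  refine coind (fun x y => ∃ k, x = k * c ∧ y = k * (mk f.star * d)) ?_ ⟨1, by simp, by simp⟩
  rintro _ _ ⟨k, rfl, rfl⟩
  refine ⟨by simp only [tm_mul, tm_star, true_and, htm], fun a b h => ?_, fun a b h => ?_⟩
  · rcases tr_mul.1 h with ⟨k', h₁, rfl⟩ | ⟨hk, h₁⟩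
    · exact ⟨_, tr_mul.2 (Or.inl ⟨k', h₁, rfl⟩), Or.inr ⟨k', rfl, rfl⟩⟩
    · rcases (htr a b).1 h₁ with h₂ | h₂
      · rcases tr_mul.1 h₂ with ⟨f', h₃, rfl⟩ | ⟨h₃, -⟩
        · exact ⟨f' * (mk f.star * d), tr_mul.2 (Or.inr ⟨hk, tr_mul.2 (Or.inl
            ⟨_, tr_star.2 ⟨f', h₃, rfl⟩, (mul_assoc _ _ _).symm⟩)⟩), Or.inr ⟨f', rfl, rfl⟩⟩
        · exact (hf' h₃).elim
      · exact ⟨_, tr_mul.2 (Or.inr ⟨hk, tr_mul.2 (Or.inr ⟨tm_star, h₂⟩)⟩), Or.inl rfl⟩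
  · rcases tr_mul.1 h with ⟨k', h₁, rfl⟩ | ⟨hk, h₁⟩
    · exact ⟨_, tr_mul.2 (Or.inl ⟨k', h₁, rfl⟩), Or.inr ⟨k', rfl, rfl⟩⟩
    · rcases tr_mul.1 h₁ with ⟨_, h₂, rfl⟩ | ⟨-, h₂⟩
      · obtain ⟨f', h₃, rfl⟩ := tr_star.1 h₂
        exact ⟨f' * c, tr_mul.2 (Or.inr ⟨hk, (htr _ _).2 (Or.inl (tr_mul.2
          (Or.inl ⟨f', h₃, rfl⟩)))⟩), Or.inr ⟨f', rfl, mul_assoc _ _ _⟩⟩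
      · exact ⟨_, tr_mul.2 (Or.inr ⟨hk, (htr _ _).2 (Or.inr h₂)⟩), Or.inl rfl⟩

theorem star_congr {e f : RegularExpression α}
    (h : ∀ a b, Tr (mk e) a b ↔ Tr (mk f) a b) : mk e.star = mk f.star := by
  refine coind (fun x y => ∃ k, x = k * mk e.star ∧ y = k * mk f.star) ?_ ⟨1, by simp, by simp⟩
  rintro _ _ ⟨k, rfl, rfl⟩
  refine ⟨by simp only [tm_mul, tm_star], fun a b hb => ?_, fun a b hb => ?_⟩
  · rcases tr_mul.1 hb with ⟨k', h₁, rfl⟩ | ⟨hk, h₁⟩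
    · exact ⟨_, tr_mul.2 (Or.inl ⟨k', h₁, rfl⟩), Or.inr ⟨k', rfl, rfl⟩⟩
    · obtain ⟨k', h₂, rfl⟩ := tr_star.1 h₁
      exact ⟨_, tr_mul.2 (Or.inr ⟨hk, tr_star.2 ⟨k', (h _ _).1 h₂, rfl⟩⟩), Or.inr ⟨k', rfl, rfl⟩⟩
  · rcases tr_mul.1 hb with ⟨k', h₁, rfl⟩ | ⟨hk, h₁⟩
    · exact ⟨_, tr_mul.2 (Or.inl ⟨k', h₁, rfl⟩), Or.inr ⟨k', rfl, rfl⟩⟩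
    · obtain ⟨k', h₂, rfl⟩ := tr_star.1 h₁
      exact ⟨_, tr_mul.2 (Or.inr ⟨hk, tr_star.2 ⟨k', (h _ _).2 h₂, rfl⟩⟩), Or.inr ⟨k', rfl, rfl⟩⟩

end Proc

open Proc

theorem sound [Fintype α] {e f : RegularExpression α} (h : Mil e f) : mk e = mk f := by
  induction h with
  | refl => rfl
  | symm _ h => exact h.symm
  | trans _ _ h h' => exact h.trans h'
  | add_congr _ _ h h' =>
    exact ext' (by rw [tm_add, tm_add, h, h']) fun a b => by
        rw [tr_add, tr_add, h, h']
  | mul_congr _ _ h h' => rw [mk_mul, mk_mul, h, h']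
  | star_congr _ h => exact star_congr fun a b => (by rw [h])
  | add_assoc =>
    exact ext' (by simp only [tm_add, or_assoc]) fun a b => by
        simp only [tr_add, or_assoc]
  | add_comm =>
    exact ext' (by simp only [tm_add, or_comm]) fun a b => by
        simp only [tr_add, or_comm]
  | add_idem =>
    exact ext' (by simp only [tm_add, or_self]) fun a b => by
        simp only [tr_add, or_self]
  | add_zero =>
    exact ext' (by simp only [tm_add, not_tm_zero, or_false]) fun a b => by
        simp only [tr_add, not_tr_zero, or_false]
  | mul_assoc => simp only [mk_mul, mul_assoc]
  | one_mul => simp only [mk_mul, mk_one, one_mul]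
  | mul_one => simp only [mk_mul, mk_one, mul_one]
  | right_distrib =>
    refine ext' ?_ fun a b => ?_
    · simp only [mk_mul, tm_add, tm_mul, or_and_right]
    · simp only [mk_mul, tr_add, tr_mul, tm_add, or_and_right, exists_or]
      exact or_or_or_comm
  | zero_mul => simp only [mk_mul, Proc.zero_mul]
  | star_unfold e =>
    refine ext' (by simp [tm_add, tm_star, tm_one]) fun a b => ?_
    simp only [tr_add, not_tr_one, false_or, mk_mul, tr_mul, tr_star]
    constructor
    · rintro (h | ⟨-, h⟩) <;> exact h
    · exact Or.inl
  | star_one e => exact star_congr fun a b => (by simp only [tr_add, not_tr_one, false_or])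
  | @fixpoint e f g _ hf h =>
    rw [mk_mul]
    refine Proc.fixpoint hf ?_ fun a b => ?_
    · rw [h, tm_add, mk_mul, tm_mul, tm_mk (e := f)]; simp [hf]
    · conv_lhs => rw [h]
      rw [tr_add, mk_mul]

end Semantics

open Proc

/-- Star height. -/
def sh : RegularExpression α → ℕ
  | .zero => 0
  | .epsilon => 0
  | .char _ => 0
  | .plus e f => max (sh e) (sh f)
  | .comp e f => max (sh e) (sh f)
  | .star e => sh e + 1

theorem sh_zero : sh (0 : RegularExpression α) = 0 := rfl
theorem sh_one : sh (1 : RegularExpression α) = 0 := rfl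
theorem sh_char (a : α) : sh (char a) = 0 := rfl
theorem sh_add (e f : RegularExpression α) : sh (e + f) = max (sh e) (sh f) := rfl
theorem sh_mul (e f : RegularExpression α) : sh (e * f) = max (sh e) (sh f) := rfl
theorem sh_star (e : RegularExpression α) : sh e.star = sh e + 1 := rfl

section Provable

variable [Fintype α]

/-- The setoid of provable equality. -/
def milSetoid (α : Type) [Fintype α] : Setoid (RegularExpression α) where
  r := Mil
  iseqv := ⟨Mil.refl, Mil.symm, Mil.trans⟩

/-- Regular expressions modulo provable equality. -/
def Cls (α : Type) [Fintype α] : Type := Quotient (milSetoid α)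

/-- The class of an expression modulo provable equality. -/
def cls (e : RegularExpression α) : Cls α := Quotient.mk (milSetoid α) e

theorem cls_eq {e f : RegularExpression α} : cls e = cls f ↔ Mil e f :=
  Quotient.eq (r := milSetoid α)

theorem exists_cls (x : Cls α) : ∃ e, cls e = x := Quotient.exists_rep x

/-- The sum of classes. -/
def Cls.join : Cls α → Cls α → Cls α :=
  Quotient.map₂ (sa := milSetoid α) (sb := milSetoid α) (sc := milSetoid α)
    (fun e f => e + f) fun _ _ h _ _ h' => Mil.add_congr h h'

instance : SemilatticeSup (Cls α) :=
  letI : Max (Cls α) := ⟨Cls.join⟩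
  SemilatticeSup.mk'
    (fun x y => by
      obtain ⟨e, rfl⟩ := exists_cls x
      obtain ⟨f, rfl⟩ := exists_cls y
      exact cls_eq.2 (Mil.add_comm e f))
    (fun x y z => by
      obtain ⟨e, rfl⟩ := exists_cls x
      obtain ⟨f, rfl⟩ := exists_cls y
      obtain ⟨g, rfl⟩ := exists_cls z
      exact cls_eq.2 (Mil.add_assoc e f g))
    (fun x => by
      obtain ⟨e, rfl⟩ := exists_cls x
      exact cls_eq.2 (Mil.add_idem e))

instance : Mul (Cls α) :=
  ⟨Quotient.map₂ (sa := milSetoid α) (sb := milSetoid α) (sc := milSetoid α)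
    (fun e f => e * f) fun _ _ h _ _ h' => Mil.mul_congr h h'⟩

theorem cls_add (e f : RegularExpression α) : cls (e + f) = cls e ⊔ cls f := rfl

theorem cls_mul (e f : RegularExpression α) : cls (e * f) = cls e * cls f := rfl

instance : OrderBot (Cls α) where
  bot := cls 0
  bot_le x := by
    obtain ⟨e, rfl⟩ := exists_cls x
    exact sup_eq_right.1 (cls_eq.2 ((Mil.add_comm 0 e).trans (Mil.add_zero e)))

instance : Monoid (Cls α) where
  one := cls 1
  mul_assoc x y z := by
    obtain ⟨e, rfl⟩ := exists_cls x
    obtain ⟨f, rfl⟩ := exists_cls y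
    obtain ⟨g, rfl⟩ := exists_cls z
    exact cls_eq.2 (Mil.mul_assoc e f g)
  one_mul x := by
    obtain ⟨e, rfl⟩ := exists_cls x
    exact cls_eq.2 (Mil.one_mul e)
  mul_one x := by
    obtain ⟨e, rfl⟩ := exists_cls x
    exact cls_eq.2 (Mil.mul_one e)

theorem cls_zero : cls (0 : RegularExpression α) = ⊥ := rfl

theorem cls_one : cls (1 : RegularExpression α) = 1 := rfl

theorem sup_mul (x y z : Cls α) : (x ⊔ y) * z = x * z ⊔ y * z := by
  obtain ⟨e, rfl⟩ := exists_cls x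
  obtain ⟨f, rfl⟩ := exists_cls y
  obtain ⟨g, rfl⟩ := exists_cls z
  exact cls_eq.2 (Mil.right_distrib e f g)

theorem bot_mul (x : Cls α) : ⊥ * x = ⊥ := by
  obtain ⟨e, rfl⟩ := exists_cls x
  exact cls_eq.2 (Mil.zero_mul e)

theorem cls_star_congr {e f : RegularExpression α} (h : cls e = cls f) :
    cls e.star = cls f.star := cls_eq.2 (Mil.star_congr (cls_eq.1 h))

theorem cls_star (e : RegularExpression α) : cls e.star = 1 ⊔ cls e * cls e.star :=
  (cls_eq.2 (Mil.star_unfold e)).symm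

theorem cls_star_one_add (e : RegularExpression α) : cls (1 + e).star = cls e.star :=
  cls_eq.2 (Mil.star_one e)

theorem eq_star_mul {m : RegularExpression α} (hm : ¬ Term m) {x t : Cls α}
    (h : x = cls m * x ⊔ t) : x = cls m.star * t := by
  obtain ⟨e, rfl⟩ := exists_cls x
  obtain ⟨g, rfl⟩ := exists_cls t
  exact cls_eq.2 (Mil.fixpoint (cls_eq.1 h) hm)

theorem star_mul_eq (m : RegularExpression α) (t : Cls α) :
    cls m.star * t = cls m * (cls m.star * t) ⊔ t := by
  conv_lhs => rw [cls_star, sup_mul, one_mul, mul_assoc, sup_comm]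

/-- Guarded equations have at most one solution. -/
theorem guarded_unique {m : RegularExpression α} (hm : ¬ Term m) {x y t : Cls α}
    (hx : x = cls m * x ⊔ t) (hy : y = cls m * y ⊔ t) : x = y :=
  (eq_star_mul hm hx).trans (eq_star_mul hm hy).symm

/-- The class of a letter. -/
def lt (a : α) : Cls α := cls (char a)

/-- `y` is the join of `x`, if `b` holds, and of all `lt a * s i` with `E a i`. -/
def Lin {ι : Type*} (b : Prop) (x : Cls α) (E : α → ι → Prop) (s : ι → Cls α) (y : Cls α) :
    Prop :=
  ∀ z, y ≤ z ↔ (b → x ≤ z) ∧ ∀ a i, E a i → lt a * s i ≤ z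

theorem Lin.unique {ι : Type*} {b : Prop} {x : Cls α} {E : α → ι → Prop} {s : ι → Cls α}
    {y y' : Cls α} (h : Lin b x E s y) (h' : Lin b x E s y') : y = y' :=
  eq_of_forall_ge_iff fun z => (h z).trans (h' z).symm

theorem exists_guarded_sum {T : Set (α × RegularExpression α)} (hT : T.Finite) :
    ∃ m, ¬ Term m ∧ (∀ a m', Step m a m' ↔ ∃ k, (a, k) ∈ T ∧ m' = 1 * k) ∧
      (∀ n, (∀ p ∈ T, sh p.2 ≤ n) → sh m ≤ n) ∧
      ∀ x : Cls α, Lin False ⊥ (fun a k => (a, k) ∈ T) (fun k => cls k * x) (cls m * x) := by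
  induction T, hT using Set.Finite.induction_on with
  | empty =>
    refine ⟨0, not_term_zero, ?_, fun n _ => Nat.zero_le n, fun x z => ?_⟩
    · simp [not_step_zero]
    · simp [cls_zero, bot_mul]
  | @insert p T hp hT ih =>
    obtain ⟨m, h₁, h₂, h₃, h₄⟩ := ih
    obtain ⟨a, k⟩ := p
    refine ⟨char a * k + m, ?_, fun b m' => ?_, fun n hn => ?_, fun x z => ?_⟩
    · simp [term_add, term_mul, not_term_char, h₁]
    · simp only [step_add, step_mul, step_char, not_term_char, false_and, or_false, h₂,
        Set.mem_insert_iff, Prod.mk.injEq, or_and_right, exists_or]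
      refine or_congr ⟨?_, ?_⟩ Iff.rfl
      · rintro ⟨_, ⟨rfl, rfl⟩, rfl⟩; exact ⟨k, ⟨rfl, rfl⟩, rfl⟩
      · rintro ⟨_, ⟨rfl, rfl⟩, rfl⟩; exact ⟨1, ⟨rfl, rfl⟩, rfl⟩
    · rw [sh_add, sh_mul, sh_char]
      have := hn _ (Set.mem_insert _ _)
      have := h₃ n fun p hp => hn p (Set.mem_insert_of_mem _ hp)
      simp_all
    · rw [cls_add, sup_mul, sup_le_iff, h₄ x z, cls_mul, mul_assoc]
      simp only [Set.mem_insert_iff, Prod.mk.injEq, or_imp, forall_and, false_imp_iff, true_and]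
      refine and_congr ⟨?_, fun h => h a k ⟨rfl, rfl⟩⟩ Iff.rfl
      rintro h _ _ ⟨rfl, rfl⟩; exact h

theorem Lin.exists {ι : Type*} (b : Prop) (x : Cls α) {E : α → ι → Prop}
    (hE : {p : α × ι | E p.1 p.2}.Finite) (s : ι → Cls α) : ∃ y, Lin b x E s y := by
  classical
  choose r hr using exists_cls (α := α)
  obtain ⟨m, -, -, -, hm⟩ := exists_guarded_sum (hE.image fun p => (p.1, r (s p.2)))
  refine ⟨(if b then x else ⊥) ⊔ cls m * 1, fun z => ?_⟩
  rw [sup_le_iff, hm 1 z]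
  refine and_congr (by split_ifs <;> simp [*]) ⟨fun h a i hi => ?_, ?_⟩
  · have := h.2 a (r (s i)) ⟨(a, i), hi, rfl⟩
    simpa only [mul_one, hr] using this
  · refine fun h => ⟨False.elim, ?_⟩
    rintro _ _ ⟨⟨a, i⟩, hi, ⟨⟩⟩
    simpa only [mul_one, hr] using h a i hi

/-- The fundamental theorem: an expression is provably the sum of its derivatives. -/
theorem fundamental (e : RegularExpression α) (x : Cls α) :
    Lin (Term e) x (Step e) (fun e' => cls e' * x) (cls e * x) := by
  induction e generalizing x with
  | zero => intro z; simp [zero_def, cls_zero, bot_mul, not_term_zero, not_step_zero]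
  | epsilon => intro z; simp [one_def, cls_one, Term.one, not_step_one]
  | char b =>
    intro z
    simp only [not_term_char, false_imp_iff, true_and, step_char]
    constructor
    · rintro h _ _ ⟨rfl, rfl⟩; rwa [cls_one, one_mul]
    · intro h
      have := h b 1 ⟨rfl, rfl⟩
      rwa [cls_one, one_mul] at this
  | plus e f he hf =>
    intro z
    simp only [plus_def, cls_add, sup_mul, sup_le_iff, he x z, hf x z, term_add, step_add, or_imp,
      forall_and]
    tauto
  | comp e f he hf =>
    intro z
    simp only [comp_def, cls_mul, mul_assoc]
    rw [he _ z, hf x z]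
    simp only [term_mul, step_mul]
    constructor
    · rintro ⟨h₁, h₂⟩
      refine ⟨fun h => (h₁ h.1).1 h.2, ?_⟩
      rintro a _ (⟨e', h, rfl⟩ | ⟨h, h'⟩)
      · rw [cls_mul, mul_assoc]; exact h₂ a e' h
      · exact (h₁ h).2 a _ h'
    · rintro ⟨h₁, h₂⟩
      refine ⟨fun h => ⟨fun h' => h₁ ⟨h, h'⟩, fun a f' h' => h₂ a f' (Or.inr ⟨h, h'⟩)⟩,
        fun a e' h => ?_⟩
      have := h₂ a _ (Or.inl ⟨e', h, rfl⟩)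
      rwa [cls_mul, mul_assoc] at this
  | star e he =>
    obtain ⟨m, -, -, -, hm⟩ := exists_guarded_sum (finite_step e)
    have key : cls e.star = cls m.star := by
      by_cases h : Term e
      · rw [← cls_star_one_add m]
        refine cls_star_congr (eq_of_forall_ge_iff fun z => ?_)
        rw [← mul_one (cls e), he 1 z, cls_add, sup_le_iff, cls_one, ← mul_one (cls m), hm 1 z]
        simp [h]
      · refine cls_star_congr (eq_of_forall_ge_iff fun z => ?_)
        rw [← mul_one (cls e), he 1 z, ← mul_one (cls m), hm 1 z]
        simp [h]
    intro z
    conv_lhs => rw [key, star_mul_eq, sup_le_iff, hm _ z, ← key]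
    simp only [false_imp_iff, true_and, Term.star, forall_const, Set.mem_ofPred_eq, step_star]
    rw [and_comm]
    refine and_congr Iff.rfl ⟨?_, fun h a e' h' => ?_⟩
    · rintro h a _ ⟨e', h', rfl⟩
      rw [cls_mul, mul_assoc]; exact h a e' h'
    · have := h a _ ⟨e', h', rfl⟩
      rwa [cls_mul, mul_assoc] at this

theorem exists_sum (b : Prop) {T : Set (α × RegularExpression α)} (hT : T.Finite) :
    ∃ m, (Term m ↔ b) ∧ (∀ a m', Step m a m' ↔ ∃ k, (a, k) ∈ T ∧ m' = 1 * k) ∧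
      ∀ n, (∀ p ∈ T, sh p.2 ≤ n) → sh m ≤ n := by
  obtain ⟨m, h₁, h₂, h₃, -⟩ := exists_guarded_sum hT
  by_cases hb : b
  · refine ⟨1 + m, by simp [term_add, Term.one, hb], fun a m' => ?_, fun n hn => ?_⟩
    · simp [step_add, not_step_one, h₂]
    · rw [sh_add, sh_one]; simpa using h₃ n hn
  · exact ⟨m, by simp [h₁, hb], h₂, h₃⟩

theorem exists_tr (b : Prop) {T : Set (α × Proc α)} (hT : T.Finite) :
    ∃ m : RegularExpression α, (Term m ↔ b) ∧ ∀ a d, Tr (mk m) a d ↔ (a, d) ∈ T := by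
  obtain ⟨m, h₁, h₂, -⟩ := exists_sum b (hT.image fun p => (p.1, p.2.rep))
  refine ⟨m, h₁, fun a d => ?_⟩
  simp only [tr_mk, h₂]
  constructor
  · rintro ⟨_, ⟨_, ⟨⟨a, d⟩, h, ⟨⟩⟩, rfl⟩, rfl⟩
    rwa [mk_mul, mk_one, one_mul, mk_rep]
  · intro h
    exact ⟨_, ⟨d.rep, ⟨(a, d), h, rfl⟩, rfl⟩, by rw [mk_mul, mk_one, one_mul, mk_rep]⟩

end Provable

section Filter

/-- `Der e g`: `g` is reachable from `e` by at least one transition. -/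
def Der : RegularExpression α → RegularExpression α → Prop :=
  Relation.TransGen fun e g => ∃ a, Step e a g

theorem Der.single {e g : RegularExpression α} {a : α} (h : Step e a g) : Der e g :=
  Relation.TransGen.single ⟨a, h⟩

theorem Der.tail {e g g' : RegularExpression α} {a : α} (h : Der e g) (h' : Step g a g') :
    Der e g' :=
  Relation.TransGen.tail h ⟨a, h'⟩

@[elab_as_elim]
theorem Der.induct {e : RegularExpression α} {motive : RegularExpression α → Prop}
    (single : ∀ a g, Step e a g → motive g)
    (tail : ∀ a g g', motive g → Step g a g' → motive g') {g : RegularExpression α}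
    (h : Der e g) : motive g := by
  induction h with
  | single h => obtain ⟨a, h⟩ := h; exact single a _ h
  | tail _ h ih => obtain ⟨a, h⟩ := h; exact tail a _ _ ih h

theorem der_char {b : α} {g : RegularExpression α} (h : Der (char b) g) : g = 1 := by
  refine h.induct (fun a g h => (step_char.1 h).2) fun a g g' h h' => ?_
  subst h; exact (not_step_one h').elim

theorem not_der_zero {g : RegularExpression α} : ¬ Der 0 g :=
  fun h => h.induct (fun _ _ h => not_step_zero h) fun _ _ _ h _ => h

theorem not_der_one {g : RegularExpression α} : ¬ Der 1 g :=
  fun h => h.induct (fun _ _ h => not_step_one h) fun _ _ _ h _ => h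

theorem der_add {e f g : RegularExpression α} (h : Der (e + f) g) : Der e g ∨ Der f g := by
  refine h.induct (fun a g h => ?_) fun a g g' h h' => ?_
  · exact (step_add.1 h).imp Der.single Der.single
  · exact h.imp (fun h => h.tail h') fun h => h.tail h'

theorem der_mul {e f g : RegularExpression α} (h : Der (e * f) g) :
    (∃ k, Der e k ∧ g = k * f) ∨ Der f g := by
  refine h.induct (fun a g h => ?_) fun a g g' h h' => ?_
  · rcases step_mul.1 h with ⟨k, h₁, rfl⟩ | ⟨-, h⟩
    · exact Or.inl ⟨k, Der.single h₁, rfl⟩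
    · exact Or.inr (Der.single h)
  · rcases h with ⟨k, h, rfl⟩ | h
    · rcases step_mul.1 h' with ⟨k', h₁, rfl⟩ | ⟨-, h₁⟩
      · exact Or.inl ⟨k', h.tail h₁, rfl⟩
      · exact Or.inr (Der.single h₁)
    · exact Or.inr (h.tail h')

theorem der_star {e g : RegularExpression α} (h : Der e.star g) :
    ∃ k, Der e k ∧ g = k * e.star := by
  refine h.induct (fun a g h => ?_) fun a g g' h h' => ?_
  · obtain ⟨k, h₁, rfl⟩ := step_star.1 h
    exact ⟨k, Der.single h₁, rfl⟩
  · obtain ⟨k, h, rfl⟩ := h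
    rcases step_mul.1 h' with ⟨k', h₁, rfl⟩ | ⟨-, h₁⟩
    · exact ⟨k', h.tail h₁, rfl⟩
    · obtain ⟨k', h₂, rfl⟩ := step_star.1 h₁
      exact ⟨k', Der.single h₂, rfl⟩

theorem sh_step {e e' : RegularExpression α} {a : α} (h : Step e a e') : sh e' ≤ sh e := by
  induction h with
  | char => simp [sh_one]
  | add_left _ h => rw [sh_add]; omega
  | add_right _ h => rw [sh_add]; omega
  | mul_left _ h => rw [sh_mul, sh_mul]; omega
  | mul_right _ _ h => rw [sh_mul]; omega
  | star _ h => rw [sh_mul, sh_star]; omega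

theorem sh_der {e g : RegularExpression α} (h : Der e g) : sh g ≤ sh e :=
  h.induct (fun _ _ h => sh_step h) fun _ _ _ h h' => (sh_step h').trans h

/-- The transitions of `g` that survive the filter `φ`, which only applies at terminating
expressions. -/
def Kept (φ : α → RegularExpression α → Prop) (g : RegularExpression α) (a : α)
    (g' : RegularExpression α) : Prop :=
  Step g a g' ∧ (Term g → φ a g')

/-- `B` behaves like `g` with its transitions filtered by `φ`. -/
def FRep (φ : α → RegularExpression α → Prop) (B : Proc α) (g : RegularExpression α) : Prop :=
  ∃ R : Proc α → RegularExpression α → Prop, R B g ∧ ∀ B g, R B g → (Tm B ↔ Term g) ∧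
    (∀ a B', Tr B a B' → ∃ g', Kept φ g a g' ∧ R B' g') ∧
    ∀ a g', Kept φ g a g' → ∃ B', Tr B a B' ∧ R B' g'

theorem FRep.out {φ : α → RegularExpression α → Prop} {B : Proc α} {g : RegularExpression α}
    (h : FRep φ B g) : (Tm B ↔ Term g) ∧
      (∀ a B', Tr B a B' → ∃ g', Kept φ g a g' ∧ FRep φ B' g') ∧
      ∀ a g', Kept φ g a g' → ∃ B', Tr B a B' ∧ FRep φ B' g' := by
  obtain ⟨R, h, hR⟩ := h
  obtain ⟨h₁, h₂, h₃⟩ := hR _ _ h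
  refine ⟨h₁, fun a B' hB => ?_, fun a g' hg => ?_⟩
  · obtain ⟨g', h, h'⟩ := h₂ a B' hB
    exact ⟨g', h, R, h', hR⟩
  · obtain ⟨B', h, h'⟩ := h₃ a g' hg
    exact ⟨B', h, R, h', hR⟩

theorem FRep.coind {φ : α → RegularExpression α → Prop} (R : Proc α → RegularExpression α → Prop)
    (hR : ∀ B g, R B g → (Tm B ↔ Term g) ∧
      (∀ a B', Tr B a B' → ∃ g', Kept φ g a g' ∧ (FRep φ B' g' ∨ R B' g')) ∧
      ∀ a g', Kept φ g a g' → ∃ B', Tr B a B' ∧ (FRep φ B' g' ∨ R B' g'))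
    {B : Proc α} {g : RegularExpression α} (h : R B g) : FRep φ B g := by
  refine ⟨fun B g => FRep φ B g ∨ R B g, Or.inr h, ?_⟩
  rintro B g (h | h)
  · obtain ⟨h₁, h₂, h₃⟩ := h.out
    refine ⟨h₁, fun a B' hB => ?_, fun a g' hg => ?_⟩
    · obtain ⟨g', h, h'⟩ := h₂ a B' hB
      exact ⟨g', h, Or.inl h'⟩
    · obtain ⟨B', h, h'⟩ := h₃ a g' hg
      exact ⟨B', h, Or.inl h'⟩
  · exact hR _ _ h

variable [Fintype α]

/-- `u` solves the system of equations of the filtered transitions on `Ω`, with value `t` for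
termination. -/
def IsSol (φ : α → RegularExpression α → Prop) (Ω : RegularExpression α → Prop) (t : Cls α)
    (u : RegularExpression α → Cls α) : Prop :=
  ∀ g, Ω g → (∀ a g', Kept φ g a g' → Ω g') ∧ Lin (Term g) t (Kept φ g) u (u g)

/-- `B` is an expression of star height at most `n` for the filtered behaviour of `g`, and it
provably gives the values of solutions at `g`. -/
def Filters (φ : α → RegularExpression α → Prop) (n : ℕ) (g B : RegularExpression α) : Prop :=
  sh B ≤ n ∧ FRep φ (mk B) g ∧ ∀ Ω t u, IsSol φ Ω t u → Ω g → u g = cls B * t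

theorem exists_filters_of_step {φ : α → RegularExpression α → Prop} {n : ℕ}
    {g : RegularExpression α} (h : ∀ a g', Kept φ g a g' → ∃ B, Filters φ n g' B) :
    ∃ B, Filters φ n g B ∧ ∀ Ω t u, IsSol φ Ω t u → (∀ a g', Kept φ g a g' → Ω g') →
      Lin (Term g) t (Kept φ g) u (cls B * t) := by
  classical
  let β : RegularExpression α → RegularExpression α := fun g' =>
    if h : ∃ B, Filters φ n g' B then h.choose else 0
  have hβ : ∀ a g', Kept φ g a g' → Filters φ n g' (β g') := fun a g' hg => by
    have := h a g' hg
    simp only [β, dif_pos this]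
    exact this.choose_spec
  have hfin : {p : α × RegularExpression α | Kept φ g p.1 p.2}.Finite :=
    (finite_step g).subset fun p hp => hp.1
  obtain ⟨B, h₁, h₂, h₃⟩ := exists_sum (Term g) (hfin.image fun p => (p.1, β p.2))
  have hsol : ∀ Ω t u, IsSol φ Ω t u → (∀ a g', Kept φ g a g' → Ω g') →
      Lin (Term g) t (Kept φ g) u (cls B * t) := by
    intro Ω t u hu hΩ z
    rw [fundamental B t z, h₁]
    refine and_congr Iff.rfl ⟨fun h a g' hg => ?_, fun h a m hm => ?_⟩
    · have := h a _ ((h₂ a _).2 ⟨β g', ⟨(a, g'), hg, rfl⟩, rfl⟩)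
      rwa [(hβ a g' hg).2.2 Ω t u hu (hΩ a g' hg), ← one_mul (cls (β g'))]
    · obtain ⟨k, ⟨⟨a, g'⟩, hg, ⟨⟩⟩, rfl⟩ := (h₂ a m).1 hm
      change lt a * (cls (1 * β g') * t) ≤ z
      rw [cls_mul, cls_one, one_mul, ← (hβ _ g' hg).2.2 Ω t u hu (hΩ _ g' hg)]
      exact h _ g' hg
  refine ⟨B, ⟨h₃ n ?_, FRep.coind (fun C g' => C = mk B ∧ g' = g) ?_ ⟨rfl, rfl⟩,
    fun Ω t u hu hg => (hu g hg).2.unique (hsol Ω t u hu (hu g hg).1)⟩, hsol⟩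
  · rintro _ ⟨⟨a, g'⟩, hg, rfl⟩
    exact (hβ a g' hg).1
  · rintro _ _ ⟨rfl, rfl⟩
    refine ⟨by rw [tm_mk, h₁], fun a C hC => ?_, fun a g' hg => ?_⟩
    · obtain ⟨m, hm, rfl⟩ := tr_mk.1 hC
      obtain ⟨k, ⟨⟨a, g'⟩, hg, ⟨⟩⟩, rfl⟩ := (h₂ a m).1 hm
      refine ⟨g', hg, Or.inl ?_⟩
      rw [mk_mul, mk_one, one_mul]
      exact (hβ _ g' hg).2.1
    · refine ⟨mk (1 * β g'), tr_mk.2 ⟨_, (h₂ a _).2 ⟨β g', ⟨(a, g'), hg, rfl⟩, rfl⟩, rfl⟩,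
        Or.inl ?_⟩
      rw [mk_mul, mk_one, one_mul]
      exact (hβ _ g' hg).2.1

theorem exists_filters_mul {φ : α → RegularExpression α → Prop} {n : ℕ}
    {k f B C : RegularExpression α}
    (hB : Filters (fun a k' => Term f → φ a (k' * f)) n k B) (hC : Filters φ n f C)
    (hC' : ∀ Ω t u, IsSol φ Ω t u → (∀ a g', Kept φ f a g' → Ω g') →
      Lin (Term f) t (Kept φ f) u (cls C * t)) :
    Filters φ n (k * f) (B * C) := by
  refine ⟨?_, ?_, fun Ω t u hu hΩ => ?_⟩
  · rw [sh_mul]; exact max_le hB.1 hC.1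
  · refine FRep.coind (fun D g => ∃ B k, D = B * mk C ∧ g = k * f ∧
      FRep (fun a k' => Term f → φ a (k' * f)) B k) ?_ ⟨mk B, k, rfl, rfl, hB.2.1⟩
    rintro _ _ ⟨B, k, rfl, rfl, hB⟩
    obtain ⟨h₁, h₂, h₃⟩ := hB.out
    obtain ⟨k₁, k₂, k₃⟩ := hC.2.1.out
    refine ⟨by rw [tm_mul, term_mul, h₁, k₁], fun a D hD => ?_, fun a g hg => ?_⟩
    · rcases tr_mul.1 hD with ⟨B', hB', rfl⟩ | ⟨hT, hD⟩
      · obtain ⟨k', ⟨h, h'⟩, hk⟩ := h₂ a B' hB'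
        refine ⟨k' * f, ⟨h.mul_left, fun ht => ?_⟩, Or.inr ⟨B', k', rfl, rfl, hk⟩⟩
        rw [term_mul] at ht
        exact h' ht.1 ht.2
      · obtain ⟨g', ⟨h, h'⟩, hg⟩ := k₂ a D hD
        exact ⟨g', ⟨Step.mul_right (h₁.1 hT) h, fun ht => h' (term_mul.1 ht).2⟩, Or.inl hg⟩
    · obtain ⟨h, h'⟩ := hg
      rcases step_mul.1 h with ⟨k', hk, rfl⟩ | ⟨hT, hf⟩
      · obtain ⟨B', hB', r⟩ := h₃ a k' ⟨hk, fun ht ht' => h' (Term.mul ht ht')⟩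
        exact ⟨_, tr_mul.2 (Or.inl ⟨B', hB', rfl⟩), Or.inr ⟨B', k', rfl, rfl, r⟩⟩
      · obtain ⟨C', hC', r⟩ := k₃ a g ⟨hf, fun ht => h' (Term.mul hT ht)⟩
        exact ⟨C', tr_mul.2 (Or.inr ⟨h₁.2 hT, hC'⟩), Or.inl r⟩
  · rw [cls_mul, mul_assoc]
    refine hB.2.2 (fun k => Ω (k * f)) (cls C * t) (fun k => u (k * f)) (fun k hk => ?_) hΩ
    have h₁ := hu _ hk
    refine ⟨fun a k' hk' => h₁.1 a _ ⟨hk'.1.mul_left, fun ht => ?_⟩, fun z => ?_⟩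
    · rw [term_mul] at ht
      exact hk'.2 ht.1 ht.2
    · have h₂ : Term k → ∀ a g', Kept φ f a g' → Kept φ (k * f) a g' := fun hT a g' hg =>
        ⟨Step.mul_right hT hg.1, fun ht => hg.2 (term_mul.1 ht).2⟩
      have h₃ : Term k → _ := fun hT => hC' Ω t u hu fun a g' hg => h₁.1 a g' (h₂ hT a g' hg)
      rw [h₁.2 z]
      constructor
      · rintro ⟨p, q⟩
        refine ⟨fun hT => (h₃ hT z).2 ⟨fun hf => p (Term.mul hT hf),
          fun a g' hg => q a g' (h₂ hT a g' hg)⟩, fun a k' hk' => q a _ ⟨hk'.1.mul_left,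
          fun ht => hk'.2 (term_mul.1 ht).1 (term_mul.1 ht).2⟩⟩
      · rintro ⟨p, q⟩
        refine ⟨fun hT => ?_, fun a g hg => ?_⟩
        · rw [term_mul] at hT
          exact ((h₃ hT.1 z).1 (p hT.1)).1 hT.2
        · obtain ⟨h, h'⟩ := hg
          rcases step_mul.1 h with ⟨k', hk', rfl⟩ | ⟨hT, hf⟩
          · exact q a k' ⟨hk', fun ht ht' => h' (Term.mul ht ht')⟩
          · exact ((h₃ hT z).1 (p hT)).2 a g ⟨hf, fun ht => h' (Term.mul hT ht)⟩

theorem exists_filters_star {φ : α → RegularExpression α → Prop} {n : ℕ}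
    {k e B : RegularExpression α}
    (he : ∀ a e', Step e a e' → ∃ C, Filters (fun a k' => φ a (k' * e.star)) n e' C)
    (hB : Filters (fun a k' => φ a (k' * e.star)) n k B) :
    ∃ m : RegularExpression α, Filters φ (n + 1) (k * e.star) (B * m.star) := by
  classical
  set ψ : α → RegularExpression α → Prop := fun a k' => φ a (k' * e.star) with hψ
  let β : RegularExpression α → RegularExpression α := fun g' =>
    if h : ∃ B, Filters ψ n g' B then h.choose else 0
  have hβ : ∀ a e', Step e a e' → Filters ψ n e' (β e') := fun a e' h => by
    have := he a e' h
    simp only [β, dif_pos this]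
    exact this.choose_spec
  have hfin : {p : α × RegularExpression α | Step e p.1 p.2 ∧ ψ p.1 p.2}.Finite :=
    (finite_step e).subset fun p hp => hp.1
  obtain ⟨m, h₁, h₂, h₃⟩ := exists_sum False (hfin.image fun p => (p.1, β p.2))
  have hm : ¬ Term m := fun h => h₁.1 h
  refine ⟨m, ?_, ?_, fun Ω t u hu hΩ => ?_⟩
  · rw [sh_mul, sh_star]
    refine max_le (hB.1.trans (Nat.le_succ n)) (Nat.succ_le_succ (h₃ n ?_))
    rintro _ ⟨⟨a, g'⟩, hg, rfl⟩
    exact (hβ a g' hg.1).1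
  · refine FRep.coind (fun D g => ∃ B k, D = B * mk m.star ∧ g = k * e.star ∧ FRep ψ B k) ?_
      ⟨mk B, k, rfl, rfl, hB.2.1⟩
    rintro _ _ ⟨B, k, rfl, rfl, hB⟩
    obtain ⟨k₁, k₂, k₃⟩ := hB.out
    refine ⟨by simp [tm_mul, term_mul, k₁, tm_star, Term.star], fun a D hD => ?_,
      fun a g hg => ?_⟩
    · rcases tr_mul.1 hD with ⟨B', hB', rfl⟩ | ⟨hT, hD⟩
      · obtain ⟨k', ⟨h, h'⟩, hk⟩ := k₂ a B' hB'
        exact ⟨_, ⟨h.mul_left, fun ht => h' (term_mul.1 ht).1⟩, Or.inr ⟨B', k', rfl, rfl, hk⟩⟩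
      · obtain ⟨C, hC, rfl⟩ := tr_star.1 hD
        obtain ⟨m', hm', rfl⟩ := tr_mk.1 hC
        obtain ⟨k', ⟨⟨a, e'⟩, hg, ⟨⟩⟩, rfl⟩ := (h₂ a m').1 hm'
        refine ⟨e' * e.star, ⟨Step.mul_right (k₁.1 hT) hg.1.star, fun _ => hg.2⟩,
          Or.inr ⟨_, e', rfl, rfl, ?_⟩⟩
        rw [mk_mul, mk_one, one_mul]
        exact (hβ _ e' hg.1).2.1
    · obtain ⟨h, h'⟩ := hg
      rcases step_mul.1 h with ⟨k', hk, rfl⟩ | ⟨hT, hf⟩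
      · obtain ⟨B', hB', r⟩ := k₃ a k' ⟨hk, fun ht => h' (Term.mul ht (Term.star _))⟩
        exact ⟨_, tr_mul.2 (Or.inl ⟨B', hB', rfl⟩), Or.inr ⟨B', k', rfl, rfl, r⟩⟩
      · obtain ⟨e', he', rfl⟩ := step_star.1 hf
        refine ⟨mk (1 * β e') * mk m.star, tr_mul.2 (Or.inr ⟨k₁.2 hT, tr_star.2 ⟨_, tr_mk.2
          ⟨_, (h₂ a _).2 ⟨β e', ⟨(a, e'), ⟨he', h' (Term.mul hT (Term.star _))⟩, rfl⟩, rfl⟩, rfl⟩,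
          rfl⟩⟩), Or.inr ⟨_, e', rfl, rfl, ?_⟩⟩
        rw [mk_mul, mk_one, one_mul]
        exact (hβ _ e' he').2.1
  · rw [cls_mul, mul_assoc]
    obtain ⟨y, hy⟩ := Lin.exists True t (E := fun a e' => Step e a e' ∧ ψ a e') hfin
      fun e' => u (e' * e.star)
    have hkept : ∀ k a k', Kept ψ k a k' → Kept φ (k * e.star) a (k' * e.star) :=
      fun k a k' hk => ⟨hk.1.mul_left, fun ht => hk.2 (term_mul.1 ht).1⟩
    have hloop : ∀ k a e', Term k → Step e a e' → ψ a e' →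
        Kept φ (k * e.star) a (e' * e.star) := fun k a e' hT he' h =>
      ⟨Step.mul_right hT he'.star, fun _ => h⟩
    have hsol : IsSol ψ (fun k => Ω (k * e.star)) y fun k => u (k * e.star) := by
      intro k hk
      have h₁ := hu _ hk
      refine ⟨fun a k' hk' => h₁.1 a _ (hkept k a k' hk'), fun z => ?_⟩
      rw [h₁.2 z]
      constructor
      · rintro ⟨p, q⟩
        exact ⟨fun hT => (hy z).2 ⟨fun _ => p (Term.mul hT (Term.star e)),
          fun a e' he' => q a _ (hloop k a e' hT he'.1 he'.2)⟩,
          fun a k' hk' => q a _ (hkept k a k' hk')⟩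
      · rintro ⟨p, q⟩
        refine ⟨fun hT => ((hy z).1 (p (term_mul.1 hT).1)).1 trivial, fun a g hg => ?_⟩
        obtain ⟨h, h'⟩ := hg
        rcases step_mul.1 h with ⟨k', hk', rfl⟩ | ⟨hT, hf⟩
        · exact q a k' ⟨hk', fun ht => h' (Term.mul ht (Term.star e))⟩
        · obtain ⟨e', he', rfl⟩ := step_star.1 hf
          exact ((hy z).1 (p hT)).2 a e' ⟨he', h' (Term.mul hT (Term.star e))⟩
    by_cases hT : ∃ k, Ω (k * e.star) ∧ Term k
    · obtain ⟨k₀, hk₀, hT⟩ := hT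
      rw [← eq_star_mul hm (x := y) (t := t)]
      · exact hB.2.2 _ _ _ hsol hΩ
      · refine eq_of_forall_ge_iff fun z => ?_
        rw [hy z, sup_le_iff, fundamental m y z, and_comm, forall_prop_of_true trivial]
        refine and_congr ⟨fun h => ⟨fun h => (hm h).elim, fun a m' hm' => ?_⟩,
          fun h a e' he' => ?_⟩ Iff.rfl
        · obtain ⟨k, ⟨⟨a, e'⟩, hg, ⟨⟩⟩, rfl⟩ := (h₂ a m').1 hm'
          have := (hβ _ e' hg.1).2.2 _ _ _ hsol ((hu _ hk₀).1 _ _ (hloop _ _ _ hT hg.1 hg.2))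
          change lt a * (cls (1 * β e') * y) ≤ z
          rw [cls_mul, cls_one, one_mul, ← this]
          exact h _ e' hg
        · have := (hβ _ e' he'.1).2.2 _ _ _ hsol ((hu _ hk₀).1 _ _ (hloop _ _ _ hT he'.1 he'.2))
          have h₃ := h.2 a _ ((h₂ a _).2 ⟨β e', ⟨(a, e'), he', rfl⟩, rfl⟩)
          change lt a * (cls (1 * β e') * y) ≤ z at h₃
          rwa [cls_mul, cls_one, one_mul, ← this] at h₃
    · refine hB.2.2 _ (cls m.star * t) (fun k => u (k * e.star))
        (fun k hk => ⟨(hsol k hk).1, fun z => ?_⟩) hΩ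
      rw [(hsol k hk).2 z]
      exact and_congr ⟨fun _ h => (hT ⟨k, hk, h⟩).elim, fun _ h => (hT ⟨k, hk, h⟩).elim⟩ Iff.rfl

theorem Filters.mono {φ : α → RegularExpression α → Prop} {n n' : ℕ} {g B : RegularExpression α}
    (h : Filters φ n g B) (hn : n ≤ n') : Filters φ n' g B :=
  ⟨h.1.trans hn, h.2⟩

theorem exists_filters_der {e g : RegularExpression α} (φ : α → RegularExpression α → Prop)
    (h : Der e g) : ∃ B, Filters φ (sh e) g B := by
  induction e generalizing φ g with
  | zero => exact (not_der_zero h).elim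
  | epsilon => exact (not_der_one h).elim
  | char b =>
    obtain rfl := der_char h
    obtain ⟨B, hB, -⟩ := exists_filters_of_step (φ := φ) (n := sh (char b)) (g := 1)
      fun a g' hg => (not_step_one hg.1).elim
    exact ⟨B, hB⟩
  | plus e f he hf =>
    rcases der_add h with h | h
    · obtain ⟨B, hB⟩ := he φ h
      exact ⟨B, hB.mono (le_max_left _ _)⟩
    · obtain ⟨B, hB⟩ := hf φ h
      exact ⟨B, hB.mono (le_max_right _ _)⟩
  | comp e f he hf =>
    rcases der_mul h with ⟨k, hk, rfl⟩ | h
    · obtain ⟨B, hB⟩ := he (fun a k' => Term f → φ a (k' * f)) hk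
      obtain ⟨C, hC, hC'⟩ := exists_filters_of_step (φ := φ) (n := sh f) (g := f)
        fun a g' hg => hf φ (Der.single hg.1)
      exact ⟨B * C, exists_filters_mul (hB.mono (le_max_left _ _)) (hC.mono (le_max_right _ _))
        hC'⟩
    · obtain ⟨B, hB⟩ := hf φ h
      exact ⟨B, hB.mono (le_max_right _ _)⟩
  | star e he =>
    obtain ⟨k, hk, rfl⟩ := der_star h
    obtain ⟨B, hB⟩ := he (fun a k' => φ a (k' * e.star)) hk
    obtain ⟨m, hm⟩ := exists_filters_star (fun a e' h => he _ (Der.single h)) hB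
    exact ⟨_, hm⟩

/-- Filtered behaviours are expressible, without increasing the star height. -/
theorem exists_filters (φ : α → RegularExpression α → Prop) (g : RegularExpression α) :
    ∃ B, Filters φ (sh g) g B := by
  obtain ⟨B, hB, -⟩ := exists_filters_of_step (φ := φ) (n := sh g) (g := g)
    fun a g' hg => exists_filters_der φ (Der.single hg.1)
  exact ⟨B, hB⟩

/-- Systems of equations given by derivatives have unique solutions. -/
theorem IsSol.eq_cls_mul {Ω : RegularExpression α → Prop} {t : Cls α}
    {u : RegularExpression α → Cls α} (hu : IsSol (fun _ _ => True) Ω t u)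
    {g : RegularExpression α} (hg : Ω g) : u g = cls g * t := by
  obtain ⟨B, -, -, hB⟩ := exists_filters (fun _ _ => True) g
  rw [hB Ω t u hu hg]
  congr 1
  rw [← mul_one (cls B)]
  refine (hB (fun _ => True) 1 cls (fun g _ => ⟨fun _ _ _ => trivial, fun z => ?_⟩) trivial).symm
  have := fundamental g 1 z
  simpa [Kept] using this

end Filter

section Good

/-- Reachability of processes. -/
def Reach : Proc α → Proc α → Prop := Relation.ReflTransGen fun c d => ∃ a, Tr c a d

theorem reach_cases {c d : Proc α} (h : Reach c d) : c = d ∨ ∃ a c', Tr c a c' ∧ Reach c' d := by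
  rcases Relation.ReflTransGen.cases_head h with h | ⟨c', ⟨a, h⟩, h'⟩
  · exact Or.inl h
  · exact Or.inr ⟨a, c', h, h'⟩

theorem Reach.head {c c' d : Proc α} {a : α} (h : Tr c a c') (h' : Reach c' d) : Reach c d :=
  Relation.ReflTransGen.head ⟨a, h⟩ h'

variable [Fintype α]

/-- All expressions denoting `c` are provably equal. -/
def Good (c : Proc α) : Prop := ∀ e e' : RegularExpression α, mk e = c → mk e' = c → cls e = cls e'

/-- All processes reachable from `c` are good. -/
def HG (c : Proc α) : Prop := ∀ d, Reach c d → Good d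

theorem HG.good {c : Proc α} (h : HG c) : Good c := h c Relation.ReflTransGen.refl

theorem HG.cls_eq {e e' : RegularExpression α} (h : HG (mk e)) (he : mk e' = mk e) :
    cls e' = cls e :=
  h.good _ _ he rfl

theorem HG.succ {c d : Proc α} {a : α} (h : HG c) (h' : Tr c a d) : HG d :=
  fun _ hb => h _ (Reach.head h' hb)

theorem lin_mk {b : Prop} {x y : Cls α} {e : RegularExpression α} {s : Proc α → Cls α} :
    Lin b x (Tr (mk e)) s y ↔ Lin b x (Step e) (fun e' => s (mk e')) y := by
  refine forall_congr' fun z => ?_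
  have : (∀ a d, Tr (mk e) a d → lt a * s d ≤ z) ↔ ∀ a e', Step e a e' → lt a * s (mk e') ≤ z := by
    simp only [tr_mk]
    constructor
    · exact fun h a e' he => h a _ ⟨e', he, rfl⟩
    · rintro h a _ ⟨e', he, rfl⟩; exact h a e' he
  rw [this]

/-- Processes on which the behavioural equations have a provable solution are good. -/
theorem hg_of_solution (S : Proc α → Prop) (s : Proc α → Cls α)
    (hS : ∀ c, S c → ∀ a d, Tr c a d → S d)
    (hs : ∀ c, S c → Lin (Tm c) 1 (Tr c) s (s c)) {c : Proc α} (hc : S c) : HG c := by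
  have key : ∀ e, S (mk e) → s (mk e) = cls e := fun e he => by
    have : IsSol (fun _ _ => True) (fun g => S (mk g)) 1 fun g => s (mk g) := by
      refine fun g hg => ⟨fun a g' h => hS _ hg a _ (tr_mk.2 ⟨g', h.1, rfl⟩), fun z => ?_⟩
      have := lin_mk.1 (hs _ hg) z
      simpa only [Kept, implies_true, and_true, tm_mk] using this
    rw [this.eq_cls_mul he, mul_one]
  intro d hd
  have hd' : S d := by
    induction hd with
    | refl => exact hc
    | tail _ h ih => obtain ⟨a, h⟩ := h; exact hS _ ih a _ h
  rintro e e' rfl he'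
  rw [← key e hd', ← key e' (he' ▸ hd'), he']

theorem hg_of_succ {c : Proc α} (h : ∀ a d, Tr c a d → HG d) : HG c := by
  intro d hd
  rcases reach_cases hd with rfl | ⟨a, c', hc, hd⟩
  · rintro e e' rfl he'
    have h₁ := fundamental e 1
    have h₂ := fundamental e' 1
    rw [mul_one] at h₁ h₂
    refine eq_of_forall_ge_iff fun z => ?_
    rw [h₁ z, h₂ z, ← tm_mk, ← tm_mk, he']
    refine and_congr Iff.rfl ⟨fun h' a f hf => ?_, fun h' a f hf => ?_⟩
    · obtain ⟨f', hf', r⟩ := tr_mk.1 (he' ▸ tr_mk.2 ⟨f, hf, rfl⟩ : Tr (mk e) a (mk f))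
      have := h' a f' hf'
      have h₃ := h a _ (tr_mk.2 ⟨f', hf', rfl⟩)
      simp only [mul_one] at this ⊢
      rwa [h₃.cls_eq r.symm]
    · obtain ⟨f', hf', r⟩ := tr_mk.1 (he' ▸ tr_mk.2 ⟨f, hf, rfl⟩ : Tr (mk e') a (mk f))
      have := h' a f' hf'
      have h₃ := h a _ (tr_mk.2 ⟨f, hf, rfl⟩)
      simp only [mul_one] at this ⊢
      rwa [← h₃.cls_eq r]
  · exact h a c' hc d hd

/-- Prefixing with the iteration of `f` preserves hereditary goodness. -/
def StarProp (f : RegularExpression α) : Prop := ∀ p, HG p → HG (mk f.star * p)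

theorem hg_mul {n : ℕ} (hn : ∀ g : RegularExpression α, sh g + 1 ≤ n → StarProp g)
    {e : RegularExpression α} (he : sh e ≤ n) {p : Proc α} (hp : HG p) : HG (mk e * p) := by
  induction e generalizing p with
  | zero => exact hg_of_succ fun a d h => (by
      rw [zero_def, Proc.zero_mul] at h; exact (not_tr_zero h).elim)
  | epsilon => rwa [one_def, mk_one, one_mul]
  | char b =>
    refine hg_of_succ fun a d h => ?_
    rcases tr_mul.1 h with ⟨c', h₁, rfl⟩ | ⟨-, h⟩
    · rw [(tr_char.1 h₁).2, mk_one, one_mul]; exact hp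
    · exact hp.succ h
  | plus e f ihe ihf =>
    rw [plus_def, sh_add, max_le_iff] at he
    refine hg_of_succ fun a d h => ?_
    rw [plus_def] at h
    have : Tr (mk e * p) a d ∨ Tr (mk f * p) a d := by
      simp only [tr_mul, tr_add, tm_add, or_and_right, exists_or] at h ⊢
      rwa [or_or_or_comm]
    exact this.elim (ihe he.1 hp).succ (ihf he.2 hp).succ
  | comp e f ihe ihf =>
    rw [comp_def, sh_mul, max_le_iff] at he
    rw [comp_def, mk_mul, mul_assoc]
    exact ihe he.1 (ihf he.2 hp)
  | star e => exact hn e he p hp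

theorem hg_one : HG (1 : Proc α) := hg_of_succ fun _ _ h => (not_tr_one h).elim

theorem hg_zero : HG (mk (0 : RegularExpression α)) := hg_of_succ fun _ _ h => (not_tr_zero h).elim

end Good

section Relative

/-- `c` has all the capabilities of `X`. -/
def Ext (X c : Proc α) : Prop := (Tm X → Tm c) ∧ ∀ a d, Tr X a d → Tr c a d

theorem Ext.refl (X : Proc α) : Ext X X := ⟨id, fun _ _ => id⟩

/-- The transitions of `c` that are not inherited from `X`. -/
def Rx (X c : Proc α) (a : α) (d : Proc α) : Prop := Tr c a d ∧ (Ext X c → ¬ Tr X a d)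

/-- `c` behaves like `B` followed by `X`, where `B` moreover performs no transition of `X` just
before passing control to `X`. -/
def Rep (X B c : Proc α) : Prop :=
  ∃ R : Proc α → Proc α → Prop, R B c ∧ ∀ B c, R B c → (Tm B ↔ Ext X c) ∧
    (Tm c ↔ Ext X c ∧ Tm X) ∧ (∀ a B', Tr B a B' → ∃ d, Rx X c a d ∧ R B' d) ∧
    ∀ a d, Rx X c a d → ∃ B', Tr B a B' ∧ R B' d

variable {X : Proc α}

theorem Rep.out {B c : Proc α} (h : Rep X B c) : (Tm B ↔ Ext X c) ∧
    (Tm c ↔ Ext X c ∧ Tm X) ∧ (∀ a B', Tr B a B' → ∃ d, Rx X c a d ∧ Rep X B' d) ∧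
    ∀ a d, Rx X c a d → ∃ B', Tr B a B' ∧ Rep X B' d := by
  obtain ⟨R, h, hR⟩ := h
  obtain ⟨h₁, h₂, h₃, h₄⟩ := hR _ _ h
  refine ⟨h₁, h₂, fun a B' hB => ?_, fun a d hd => ?_⟩
  · obtain ⟨d, h, h'⟩ := h₃ a B' hB
    exact ⟨d, h, R, h', hR⟩
  · obtain ⟨B', h, h'⟩ := h₄ a d hd
    exact ⟨B', h, R, h', hR⟩

theorem Rep.coind (R : Proc α → Proc α → Prop) (hR : ∀ B c, R B c → (Tm B ↔ Ext X c) ∧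
      (Tm c ↔ Ext X c ∧ Tm X) ∧ (∀ a B', Tr B a B' → ∃ d, Rx X c a d ∧ (Rep X B' d ∨ R B' d)) ∧
      ∀ a d, Rx X c a d → ∃ B', Tr B a B' ∧ (Rep X B' d ∨ R B' d))
    {B c : Proc α} (h : R B c) : Rep X B c := by
  refine ⟨fun B c => Rep X B c ∨ R B c, Or.inr h, ?_⟩
  rintro B c (h | h)
  · obtain ⟨h₁, h₂, h₃, h₄⟩ := h.out
    refine ⟨h₁, h₂, fun a B' hB => ?_, fun a d hd => ?_⟩
    · obtain ⟨d, h, h'⟩ := h₃ a B' hB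
      exact ⟨d, h, Or.inl h'⟩
    · obtain ⟨B', h, h'⟩ := h₄ a d hd
      exact ⟨B', h, Or.inl h'⟩
  · exact hR _ _ h

theorem Rep.unique {B B' c : Proc α} (h : Rep X B c) (h' : Rep X B' c) : B = B' := by
  refine Proc.coind (fun B B' => ∃ c, Rep X B c ∧ Rep X B' c) ?_ ⟨c, h, h'⟩
  rintro B B' ⟨c, h, h'⟩
  obtain ⟨h₁, -, h₃, h₄⟩ := h.out
  obtain ⟨k₁, -, k₃, k₄⟩ := h'.out
  refine ⟨h₁.trans k₁.symm, fun a C hC => ?_, fun a C hC => ?_⟩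
  · obtain ⟨d, hd, r⟩ := h₃ a C hC
    obtain ⟨C', hC', r'⟩ := k₄ a d hd
    exact ⟨C', hC', Or.inr ⟨d, r, r'⟩⟩
  · obtain ⟨d, hd, r⟩ := k₃ a C hC
    obtain ⟨C', hC', r'⟩ := h₄ a d hd
    exact ⟨C', hC', Or.inr ⟨d, r', r⟩⟩

theorem Rep.of_frep {v V B : Proc α} {Γ : RegularExpression α → Prop}
    (hV : Tm V) (hV₁ : ∀ a V', Tr V a V' → ∃ d, Tr v a d ∧ ¬ Tr X a d ∧ Rep X V' d)
    (hV₂ : ∀ a d, Tr v a d → ¬ Tr X a d → ∃ V', Tr V a V' ∧ Rep X V' d)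
    (hΓ : ∀ g a g', Γ g → Step g a g' → Γ g')
    (hΓ' : ∀ g, Γ g → (Ext X (mk g * v) ↔ Term g) ∧ (Tm (mk g * v) ↔ Term g ∧ Tm X))
    {g : RegularExpression α} (hB : FRep (fun a g' => ¬ Tr X a (mk g' * v)) B g) (hg : Γ g) :
    Rep X (B * V) (mk g * v) := by
  refine Rep.coind (fun C c => ∃ B g, C = B * V ∧ c = mk g * v ∧ Γ g ∧
    FRep (fun a g' => ¬ Tr X a (mk g' * v)) B g) ?_ ⟨B, g, rfl, rfl, hg, hB⟩
  rintro _ _ ⟨B, g, rfl, rfl, hg, hB⟩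
  obtain ⟨h₁, h₂, h₃⟩ := hB.out
  obtain ⟨k₁, k₂⟩ := hΓ' g hg
  refine ⟨by simp [tm_mul, h₁, hV, k₁], by rw [k₂, k₁], fun a C hC => ?_, fun a d hd => ?_⟩
  · rcases tr_mul.1 hC with ⟨B', hB', rfl⟩ | ⟨hT, hC'⟩
    · obtain ⟨g', ⟨hs, hk⟩, r⟩ := h₂ a B' hB'
      exact ⟨mk g' * v, ⟨tr_mul.2 (Or.inl ⟨_, tr_mk.2 ⟨g', hs, rfl⟩, rfl⟩),
        fun h => hk (k₁.1 h)⟩, Or.inr ⟨B', g', rfl, rfl, hΓ _ _ _ hg hs, r⟩⟩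
    · obtain ⟨d, hd, hd', r⟩ := hV₁ a C hC'
      exact ⟨d, ⟨tr_mul.2 (Or.inr ⟨tm_mk.2 (h₁.1 hT), hd⟩), fun _ => hd'⟩, Or.inl r⟩
  · obtain ⟨hd, hd'⟩ := hd
    rcases tr_mul.1 hd with ⟨c', hc, rfl⟩ | ⟨hT, hd₁⟩
    · obtain ⟨g', hs, rfl⟩ := tr_mk.1 hc
      obtain ⟨B', hB', r⟩ := h₃ a g' ⟨hs, fun h => hd' (k₁.2 h)⟩
      exact ⟨_, tr_mul.2 (Or.inl ⟨B', hB', rfl⟩), Or.inr ⟨B', g', rfl, rfl, hΓ _ _ _ hg hs, r⟩⟩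
    · rw [tm_mk] at hT
      obtain ⟨V', hV', r⟩ := hV₂ a d hd₁ (hd' (k₁.2 hT))
      exact ⟨V', tr_mul.2 (Or.inr ⟨h₁.2 hT, hV'⟩), Or.inl r⟩

theorem Rep.mul {v B : Proc α} (hB : Rep X B v) (hv : ¬ Ext X v)
    {Γ : RegularExpression α → Prop} (hΓ : ∀ g a g', Γ g → Step g a g' → Γ g')
    (hΓ' : ∀ g, Γ g → ¬ Ext X (mk g * v)) {g : RegularExpression α} (hg : Γ g) :
    Rep X (mk g * B) (mk g * v) := by
  refine Rep.coind (fun C c => ∃ g, C = mk g * B ∧ c = mk g * v ∧ Γ g) ?_ ⟨g, rfl, rfl, hg⟩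
  rintro _ _ ⟨g, rfl, rfl, hg⟩
  obtain ⟨h₁, h₂, h₃, h₄⟩ := hB.out
  have k := hΓ' g hg
  refine ⟨by simp [tm_mul, h₁, hv, k], by simp [tm_mul, h₂, hv, k], fun a C hC => ?_,
    fun a d hd => ?_⟩
  · rcases tr_mul.1 hC with ⟨c', hc, rfl⟩ | ⟨hT, hC'⟩
    · obtain ⟨g', hs, rfl⟩ := tr_mk.1 hc
      exact ⟨mk g' * v, ⟨tr_mul.2 (Or.inl ⟨_, hc, rfl⟩), fun h => (k h).elim⟩,
        Or.inr ⟨g', rfl, rfl, hΓ _ _ _ hg hs⟩⟩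
    · obtain ⟨d, hd, r⟩ := h₃ a C hC'
      exact ⟨d, ⟨tr_mul.2 (Or.inr ⟨hT, hd.1⟩), fun h => (k h).elim⟩, Or.inl r⟩
  · rcases tr_mul.1 hd.1 with ⟨c', hc, rfl⟩ | ⟨hT, hd₁⟩
    · obtain ⟨g', hs, rfl⟩ := tr_mk.1 hc
      exact ⟨_, tr_mul.2 (Or.inl ⟨_, hc, rfl⟩), Or.inr ⟨g', rfl, rfl, hΓ _ _ _ hg hs⟩⟩
    · obtain ⟨B', hB', r⟩ := h₄ a d ⟨hd₁, fun h => (hv h).elim⟩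
      exact ⟨B', tr_mul.2 (Or.inr ⟨hT, hB'⟩), Or.inl r⟩

variable [Fintype α]

/-- Processes represented relative to `X` by a hereditarily good process. -/
def Dec (X c : Proc α) : Prop := ∃ B, HG B ∧ Rep X B c

theorem Dec.of_rx {c : Proc α} (hc : Tm c ↔ Ext X c ∧ Tm X) (h : ∀ a d, Rx X c a d → Dec X d) :
    Dec X c := by
  classical
  let β : Proc α → Proc α := fun d => if h : Dec X d then h.choose else c
  have hβ : ∀ a d, Rx X c a d → HG (β d) ∧ Rep X (β d) d := fun a d hd => by
    have := h a d hd
    simp only [β, dif_pos this]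
    exact this.choose_spec
  have hfin : {p : α × Proc α | Rx X c p.1 p.2}.Finite :=
    (finite_tr c).subset fun p hp => hp.1
  obtain ⟨m, h₁, h₂⟩ := exists_tr (Ext X c) (hfin.image fun p => (p.1, β p.2))
  refine ⟨mk m, hg_of_succ fun a d hd => ?_,
    Rep.coind (fun C e => C = mk m ∧ e = c) ?_ ⟨rfl, rfl⟩⟩
  · obtain ⟨⟨a, d⟩, hd₁, ⟨⟩⟩ := (h₂ a d).1 hd
    exact (hβ _ d hd₁).1
  · rintro _ _ ⟨rfl, rfl⟩
    refine ⟨by rw [tm_mk, h₁], hc, fun a B' hB => ?_, fun a d hd => ?_⟩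
    · obtain ⟨⟨a, d⟩, hd, ⟨⟩⟩ := (h₂ a B').1 hB
      exact ⟨d, hd, Or.inl (hβ _ d hd).2⟩
    · exact ⟨β d, (h₂ a _).2 ⟨(a, d), hd, rfl⟩, Or.inl (hβ a d hd).2⟩

theorem Dec.rx {c d : Proc α} {a : α} (h : Dec X c) (hd : Rx X c a d) : Dec X d := by
  obtain ⟨B, hB, hr⟩ := h
  obtain ⟨B', hB', r⟩ := hr.out.2.2.2 a d hd
  exact ⟨B', hB.succ hB', r⟩

theorem Dec.tm {c : Proc α} (h : Dec X c) : Tm c ↔ Ext X c ∧ Tm X := by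
  obtain ⟨B, hB, hr⟩ := h
  exact hr.out.2.1

theorem dec_self (X : Proc α) : Dec X X :=
  Dec.of_rx (by simp [Ext.refl]) fun _ _ h => (h.2 (Ext.refl X) h.1).elim

theorem hg_of_ext {c : Proc α} (hc : HG c) (h : Ext X c) : HG X :=
  hg_of_succ fun a d hd => hc.succ (h.2 a d hd)

theorem Rep.mul_eq (hX : ¬ HG X) {B c : Proc α} (hc : HG c) (h : Rep X B c) (z : Proc α) :
    B * z = c := by
  refine Proc.coind (fun C c => ∃ B, C = B * z ∧ HG c ∧ Rep X B c) ?_ ⟨B, rfl, hc, h⟩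
  rintro _ c ⟨B, rfl, hc, h⟩
  obtain ⟨h₁, h₂, h₃, h₄⟩ := h.out
  have hext : ¬ Ext X c := fun h' => hX (hg_of_ext hc h')
  refine ⟨by simp [tm_mul, h₁, h₂, hext], fun a C hC => ?_, fun a d hd => ?_⟩
  · rcases tr_mul.1 hC with ⟨B', hB', rfl⟩ | ⟨hT, -⟩
    · obtain ⟨d, hd, r⟩ := h₃ a B' hB'
      exact ⟨d, hd.1, Or.inr ⟨B', rfl, hc.succ hd.1, r⟩⟩
    · exact (hext (h₁.1 hT)).elim
  · obtain ⟨B', hB', r⟩ := h₄ a d ⟨hd, fun h' => (hext h').elim⟩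
    exact ⟨_, tr_mul.2 (Or.inl ⟨B', hB', rfl⟩), Or.inr ⟨B', rfl, hc.succ hd, r⟩⟩

theorem exists_dec_expr (X : Proc α) : ∃ A : Proc α → RegularExpression α,
    ∀ c, Dec X c → HG (mk (A c)) ∧ Rep X (mk (A c)) c := by
  classical
  refine ⟨fun c => if h : Dec X c then h.choose.rep else 0, fun c h => ?_⟩
  simp only [dif_pos h, mk_rep]
  exact h.choose_spec

/-- Values given by representing expressions satisfy the behavioural equations. -/
theorem lin_of_dec {s : Proc α → Cls α} {x : Cls α} (hx : Lin (Tm X) 1 (Tr X) s x)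
    {A : Proc α → RegularExpression α}
    (hA : ∀ c, Dec X c → HG (mk (A c)) ∧ Rep X (mk (A c)) c)
    (hs : ∀ c, Dec X c → s c = cls (A c) * x) {c : Proc α} (hc : Dec X c) :
    Lin (Tm c) 1 (Tr c) s (s c) := by
  have hval : ∀ e d, HG (mk e) → Rep X (mk e) d → s d = cls e * x := fun e d he hr => by
    have hd : Dec X d := ⟨_, he, hr⟩
    rw [hs d hd, he.cls_eq ((hA d hd).2.unique hr)]
  obtain ⟨hg, hr⟩ := hA c hc
  obtain ⟨h₁, h₂, h₃, h₄⟩ := hr.out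
  rw [tm_mk] at h₁
  intro z
  rw [hs c hc, fundamental (A c) x z, h₁]
  have hrx : (∀ a i, Step (A c) a i → lt a * (cls i * x) ≤ z) ↔
      ∀ a d, Rx X c a d → lt a * s d ≤ z := by
    constructor
    · intro h a d hd
      obtain ⟨B', hB, r⟩ := h₄ a d hd
      obtain ⟨e', he, rfl⟩ := tr_mk.1 hB
      rw [hval e' d (hg.succ hB) r]
      exact h a e' he
    · intro h a e' he
      have hB : Tr (mk (A c)) a (mk e') := tr_mk.2 ⟨e', he, rfl⟩
      obtain ⟨d, hd, r⟩ := h₃ a _ hB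
      rw [← hval e' d (hg.succ hB) r]
      exact h a d hd
  change (_ ∧ ∀ a i, Step (A c) a i → lt a * (cls i * x) ≤ z) ↔ _
  rw [hrx, hx z]
  by_cases hY : Ext X c
  · have : Tm c ↔ Tm X := by simp [h₂, hY]
    rw [this]
    constructor
    · rintro ⟨h, h'⟩
      refine ⟨(h hY).1, fun a d hd => ?_⟩
      by_cases hXd : Tr X a d
      · exact (h hY).2 a d hXd
      · exact h' a d ⟨hd, fun _ => hXd⟩
    · rintro ⟨h, h'⟩
      exact ⟨fun _ => ⟨h, fun a d hd => h' a d (hY.2 a d hd)⟩, fun a d hd => h' a d hd.1⟩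
  · have : ¬ Tm c := fun h => hY (h₂.1 h).1
    simp only [hY, this, false_imp_iff, true_and, Rx, and_true]

theorem exists_proc_expr (b : Prop) {ι : Type} {E : α → ι → Prop}
    (hE : {p : α × ι | E p.1 p.2}.Finite) (r : ι → RegularExpression α) :
    ∃ m, (Term m ↔ b) ∧ ∀ t, Lin b t E (fun i => cls (r i) * t) (cls m * t) := by
  obtain ⟨m, h₁, h₂, -⟩ := exists_sum b (hE.image fun p => (p.1, r p.2))
  refine ⟨m, h₁, fun t z => ?_⟩
  rw [fundamental m t z, h₁]
  refine and_congr Iff.rfl ⟨fun h a i hi => ?_, fun h a m' hm' => ?_⟩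
  · have := h a _ ((h₂ a _).2 ⟨_, ⟨(a, i), hi, rfl⟩, rfl⟩)
    simpa only [cls_mul, cls_one, one_mul] using this
  · obtain ⟨k, ⟨⟨a, i⟩, hi, ⟨⟩⟩, rfl⟩ := (h₂ a m').1 hm'
    simpa only [cls_mul, cls_one, one_mul] using h _ i hi

theorem hg_of_dec_targets (h : ∀ a d, Tr X a d → Dec X d ∨ HG d) : HG X := by
  classical
  by_contra hX
  obtain ⟨A, hA⟩ := exists_dec_expr X
  obtain ⟨F, hF, hF'⟩ := exists_proc_expr False (E := fun a d => Tr X a d ∧ Dec X d)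
    ((finite_tr X).subset fun p hp => hp.1) A
  have hF : ¬ Term F := fun h => hF.1 h
  obtain ⟨p, hp⟩ := Lin.exists (Tm X) 1 (E := fun a d => Tr X a d ∧ ¬ Dec X d)
    ((finite_tr X).subset fun p hp => hp.1) fun d => cls d.rep
  set x : Cls α := cls F.star * p with hx
  set s : Proc α → Cls α := fun d => if Dec X d then cls (A d) * x else cls d.rep with hs
  have hsD : ∀ d, Dec X d → s d = cls (A d) * x := fun d hd => if_pos hd
  have hsN : ∀ d, HG d → s d = cls d.rep := fun d hd => by
    by_cases hD : Dec X d
    · obtain ⟨e, he⟩ := exists_cls x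
      have := (hA d hD).2.mul_eq hX hd (mk e)
      rw [hsD d hD, ← he, ← cls_mul]
      exact hd.good _ _ this (mk_rep d)
    · exact if_neg hD
  have hxl : Lin (Tm X) 1 (Tr X) s x := fun z => by
    conv_lhs => rw [hx, star_mul_eq, sup_le_iff, hF' _ z, hp z, ← hx]
    constructor
    · rintro ⟨⟨-, h₁⟩, h₂, h₃⟩
      refine ⟨h₂, fun a d hd => ?_⟩
      by_cases hD : Dec X d
      · rw [hsD d hD]; exact h₁ a d ⟨hd, hD⟩
      · rw [hsN d ((h a d hd).resolve_left hD)]; exact h₃ a d ⟨hd, hD⟩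
    · rintro ⟨h₁, h₂⟩
      refine ⟨⟨False.elim, fun a d hd => ?_⟩, h₁, fun a d hd => ?_⟩
      · have := h₂ a d hd.1
        rwa [hsD d hd.2] at this
      · have := h₂ a d hd.1
        rwa [hsN d ((h a d hd.1).resolve_left hd.2)] at this
  refine hX (hg_of_solution (fun c => Dec X c ∨ HG c) s ?_ ?_ (Or.inl (dec_self X)))
  · rintro c (hc | hc) a d hd
    · by_cases hr : Rx X c a d
      · exact Or.inl (hc.rx hr)
      · refine h a d ?_
        by_contra hXd
        exact hr ⟨hd, fun _ => hXd⟩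
    · exact Or.inr (hc.succ hd)
  · rintro c (hc | hc)
    · exact lin_of_dec hxl hA hsD hc
    · have h₁ := fundamental c.rep 1
      intro z
      rw [mul_one] at h₁
      rw [hsN c hc, h₁ z, ← tm_mk, mk_rep]
      refine and_congr Iff.rfl ⟨fun h' a d hd => ?_, fun h' a e' he => ?_⟩
      · obtain ⟨e', he, rfl⟩ := tr_mk.1 (show Tr (mk c.rep) a d by rwa [mk_rep])
        have := h' a e' he
        simp only [mul_one] at this
        rw [hsN _ (hc.succ hd)]
        rwa [(hc.succ hd).cls_eq (mk_rep _)]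
      · have hd : Tr c a (mk e') := by
          have : Tr (mk c.rep) a (mk e') := tr_mk.2 ⟨e', he, rfl⟩
          rwa [mk_rep] at this
        have := h' a _ hd
        simp only [mul_one]
        rw [hsN _ (hc.succ hd)] at this
        rwa [(hc.succ hd).cls_eq (mk_rep _)] at this

end Relative

section Loop

/-- A transition of `k * f.star` leads to `k' * f.star`. -/
def Nxt (f k : RegularExpression α) (a : α) (k' : RegularExpression α) : Prop :=
  Step k a k' ∨ Term k ∧ Step f a k'

theorem step_mul_star {f k g : RegularExpression α} {a : α} :
    Step (k * f.star) a g ↔ ∃ k', Nxt f k a k' ∧ g = k' * f.star := by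
  simp only [step_mul, step_star, Nxt, or_and_right, exists_or]
  exact or_congr Iff.rfl ⟨fun ⟨h, k', h₁, h₂⟩ => ⟨k', ⟨h, h₁⟩, h₂⟩,
    fun ⟨k', ⟨h, h₁⟩, h₂⟩ => ⟨h, k', h₁, h₂⟩⟩

theorem Nxt.sh_le {f k k' : RegularExpression α} {a : α} {n : ℕ} (h : Nxt f k a k')
    (hk : sh k ≤ n) (hf : sh f ≤ n) : sh k' ≤ n := by
  rcases h with h | ⟨-, h⟩
  · exact (sh_step h).trans hk
  · exact (sh_step h).trans hf

theorem tr_mul_star {f k : RegularExpression α} {v d : Proc α} {a : α} :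
    Tr (mk k * (mk f.star * v)) a d ↔
      (∃ k', Nxt f k a k' ∧ d = mk k' * (mk f.star * v)) ∨ Term k ∧ Tr v a d := by
  rw [← mul_assoc, ← mk_mul, tr_mul, tm_mk, term_mul]
  simp only [Term.star, and_true]
  refine or_congr ⟨?_, ?_⟩ Iff.rfl
  · rintro ⟨c, hc, rfl⟩
    obtain ⟨g, hg, rfl⟩ := tr_mk.1 hc
    obtain ⟨k', hk, rfl⟩ := step_mul_star.1 hg
    exact ⟨k', hk, by rw [mk_mul, mul_assoc]⟩
  · rintro ⟨k', hk, rfl⟩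
    exact ⟨mk (k' * f.star), tr_mk.2 ⟨_, step_mul_star.2 ⟨k', hk, rfl⟩, rfl⟩,
      by rw [mk_mul, mul_assoc]⟩

variable [Fintype α]

/-- `f.star * v` is not represented relative to `X`, although `v` is and iteration bodies up to
star height `h` cannot turn `f.star * v` into `X`. -/
structure Loop (h : ℕ) (X v : Proc α) (f : RegularExpression α) : Prop where
  intro ::
  not_hg : ¬ HG X
  not_tm : ¬ Tm X
  hg_mul : ∀ e, sh e ≤ h + 1 → ∀ p : Proc α, HG p → HG (mk e * p)
  sh_le : sh f ≤ h
  dec : Dec X v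
  not_dec : ¬ Dec X (mk f.star * v)
  ne_mul : ∀ m, ¬ Term m → sh m ≤ h → mk m * (mk f.star * v) ≠ X

namespace Loop

variable {h : ℕ} {X v : Proc α} {f : RegularExpression α}

theorem not_tm_dec (H : Loop h X v f) {c : Proc α} (hc : Dec X c) : ¬ Tm c :=
  fun h => H.not_tm (hc.tm.1 h).2

theorem not_tm_mul (H : Loop h X v f) (k : Proc α) : ¬ Tm (k * v) :=
  fun h => H.not_tm_dec H.dec (tm_mul.1 h).2

theorem exists_tr_ne (H : Loop h X v f) {m : RegularExpression α} (hm : sh m ≤ h) :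
    ∃ a d, Tr X a d ∧
      ∀ k', sh k' ≤ h → Nxt f m a k' → d ≠ mk k' * (mk f.star * v) := by
  by_contra! hc
  have hfin : {p : α × RegularExpression α | Step (m * f.star) p.1 (p.2 * f.star) ∧
      Tr X p.1 (mk p.2 * (mk f.star * v))}.Finite := by
    refine ((finite_step (m * f.star)).preimage
      (f := fun p : α × RegularExpression α => (p.1, p.2 * f.star)) ?_).subset fun p hp => hp.1
    rintro ⟨a, k⟩ - ⟨b, l⟩ - hkl
    simp only [Prod.mk.injEq] at hkl
    obtain ⟨rfl, hkl⟩ := hkl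
    injection hkl with h₁
    rw [h₁]
  obtain ⟨n, h₁, h₂, h₃⟩ := exists_sum False hfin
  have h₁ : ¬ Term n := fun h => h₁.1 h
  have key : ∀ a k', Step (m * f.star) a (k' * f.star) → Nxt f m a k' := fun a k' hk => by
    obtain ⟨l, hl, e⟩ := step_mul_star.1 hk
    injection e with e
    rwa [e]
  refine H.ne_mul n h₁ (h₃ h fun p hp => (key _ _ hp.1).sh_le hm H.sh_le) (ext' ?_ fun a d => ?_)
  · simp [tm_mul, tm_mk, h₁, H.not_tm]
  · rw [tr_mul, tm_mk]
    simp only [h₁, false_and, or_false]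
    constructor
    · rintro ⟨c, hc', rfl⟩
      obtain ⟨n', hn, rfl⟩ := tr_mk.1 hc'
      obtain ⟨k, hk, rfl⟩ := (h₂ a n').1 hn
      rw [mk_mul, mk_one, one_mul]
      exact hk.2
    · intro hd
      obtain ⟨k', hk, hn, rfl⟩ := hc a d hd
      exact ⟨mk (1 * k'), tr_mk.2 ⟨_, (h₂ a _).2 ⟨k', ⟨step_mul_star.2 ⟨k', hn, rfl⟩, hd⟩, rfl⟩,
        rfl⟩, by rw [mk_mul, mk_one, one_mul]⟩

theorem term (H : Loop h X v f) {k : RegularExpression α} (hk : sh k ≤ h)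
    (hX : Ext X (mk k * (mk f.star * v))) : Term k := by
  by_contra hk'
  obtain ⟨a, d, hd, hn⟩ := H.exists_tr_ne hk
  rcases tr_mul_star.1 (hX.2 a d hd) with ⟨k', hk₁, rfl⟩ | ⟨h', -⟩
  · exact hn k' (hk₁.sh_le hk H.sh_le) hk₁ rfl
  · exact hk' h'

theorem ext_mul (H : Loop h X v f) {k : RegularExpression α} (hk : Term k) {c : Proc α}
    (hc : Ext X c) : Ext X (mk k * c) :=
  ⟨fun h' => (H.not_tm h').elim, fun _ _ hd => tr_mul.2 (Or.inr ⟨tm_mk.2 hk, hc.2 _ _ hd⟩)⟩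

theorem not_ext (H : Loop h X v f) : ¬ Ext X (mk f.star * v) := by
  intro hX
  obtain ⟨A, hA⟩ := exists_dec_expr X
  have hdec : ∀ a d, Tr v a d → ¬ Tr X a d → Dec X d := fun a d hd hd' =>
    H.dec.rx ⟨hd, fun _ => hd'⟩
  have hfin : {p : α × Proc α | Tr v p.1 p.2 ∧ ¬ Tr X p.1 p.2}.Finite :=
    (finite_tr v).subset fun p hp => hp.1
  obtain ⟨V, hV, hV'⟩ := exists_tr True (hfin.image fun p => (p.1, mk (A p.2)))
  obtain ⟨B, hB₁, hB₂, -⟩ := exists_filters (fun a g' => ¬ Tr X a (mk g' * v)) (1 * f.star)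
  have hr := Rep.of_frep (X := X) (v := v) (V := mk V)
    (Γ := fun g => ∃ k, sh k ≤ h ∧ g = k * f.star) (tm_mk.2 (hV.2 trivial)) ?_ ?_ ?_ ?_ hB₂
    ⟨1, by simp [sh_one], rfl⟩
  · rw [mk_mul, mk_one, one_mul] at hr
    refine H.not_dec ⟨_, H.hg_mul B (hB₁.trans ?_) _ (hg_of_succ fun a d hd => ?_), hr⟩
    · rw [sh_mul, sh_star, sh_one]; have := H.sh_le; omega
    · obtain ⟨⟨a, d⟩, h₁, ⟨⟩⟩ := (hV' a d).1 hd
      exact (hA d (hdec _ d h₁.1 h₁.2)).1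
  · intro a V' h'
    obtain ⟨⟨a, d⟩, hd, ⟨⟩⟩ := (hV' a V').1 h'
    exact ⟨d, hd.1, hd.2, (hA d (hdec _ d hd.1 hd.2)).2⟩
  · intro a d hd hd'
    exact ⟨_, (hV' a _).2 ⟨(a, d), ⟨hd, hd'⟩, rfl⟩, (hA d (hdec _ d hd hd')).2⟩
  · rintro _ a _ ⟨k, hk, rfl⟩ hs
    obtain ⟨k', hk', rfl⟩ := step_mul_star.1 hs
    exact ⟨k', hk'.sh_le hk H.sh_le, rfl⟩
  · rintro _ ⟨k, hk, rfl⟩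
    simp only [H.not_tm_mul, H.not_tm, and_false, iff_self, and_true]
    rw [mk_mul, mul_assoc, term_mul]
    simp only [Term.star, and_true]
    exact ⟨H.term hk, fun h' => H.ext_mul h' hX⟩

theorem not_ext_base (H : Loop h X v f) : ¬ Ext X v := fun hv =>
  H.not_ext (H.ext_mul (Term.star f) hv)

theorem dec_of_tr (H : Loop h X v f) {a : α} {d : Proc α} (hd : Tr v a d) : Dec X d :=
  H.dec.rx ⟨hd, fun h' => (H.not_ext_base h').elim⟩

theorem exists_ext (H : Loop h X v f) : ∃ k, sh k ≤ h ∧ Ext X (mk k * (mk f.star * v)) := by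
  by_contra! hc
  obtain ⟨B, hB, hr⟩ := H.dec
  have := hr.mul H.not_ext_base (Γ := fun g => ∃ k, sh k ≤ h ∧ g = k * f.star) ?_ ?_
    ⟨1, by simp [sh_one], rfl⟩
  · refine H.not_dec ⟨_, H.hg_mul (1 * f.star) ?_ B hB, ?_⟩
    · rw [sh_mul, sh_star, sh_one]; have := H.sh_le; omega
    · rwa [mk_mul, mk_one, one_mul] at this ⊢
  · rintro _ a _ ⟨k, hk, rfl⟩ hs
    obtain ⟨k', hk', rfl⟩ := step_mul_star.1 hs
    exact ⟨k', hk'.sh_le hk H.sh_le, rfl⟩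
  · rintro _ ⟨k, hk, rfl⟩
    rw [mk_mul, mul_assoc]
    exact hc k hk

/-- If `v` has no transition to an iteration body, the iteration body reached is determined up to
bisimilarity. -/
theorem mk_mul_star_eq (H : Loop h X v f)
    (hv : ∀ a d k, Tr v a d → sh k ≤ h → d ≠ mk k * (mk f.star * v)) {k l : RegularExpression α}
    (hk : sh k ≤ h) (hl : sh l ≤ h)
    (e : mk k * (mk f.star * v) = mk l * (mk f.star * v)) : mk (k * f.star) = mk (l * f.star) := by
  obtain ⟨a₀, d₀, h₀⟩ : ∃ a d, Tr v a d := by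
    obtain ⟨k, hk, hX⟩ := H.exists_ext
    obtain ⟨a, d, hd, hn⟩ := H.exists_tr_ne hk
    rcases tr_mul_star.1 (hX.2 a d hd) with ⟨k', hk₁, rfl⟩ | ⟨-, h'⟩
    · exact (hn k' (hk₁.sh_le hk H.sh_le) hk₁ rfl).elim
    · exact ⟨a, d, h'⟩
  have hterm : ∀ {k l : RegularExpression α}, sh l ≤ h →
      mk k * (mk f.star * v) = mk l * (mk f.star * v) → Term k → Term l := fun {k l} hl e hk => by
    have : Tr (mk k * (mk f.star * v)) a₀ d₀ := tr_mul_star.2 (Or.inr ⟨hk, h₀⟩)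
    rw [e] at this
    rcases tr_mul_star.1 this with ⟨k', hk₁, hd⟩ | ⟨h', -⟩
    · exact (hv _ _ k' h₀ (hk₁.sh_le hl H.sh_le) hd).elim
    · exact h'
  have hnxt : ∀ {k l k' : RegularExpression α} {a}, sh k ≤ h →
      mk k * (mk f.star * v) = mk l * (mk f.star * v) → Nxt f k a k' →
      ∃ l', Nxt f l a l' ∧ mk k' * (mk f.star * v) = mk l' * (mk f.star * v) :=
    fun {k l k' a} hk e hn => by
      have : Tr (mk k * (mk f.star * v)) a _ := tr_mul_star.2 (Or.inl ⟨k', hn, rfl⟩)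
      rw [e] at this
      rcases tr_mul_star.1 this with ⟨l', hl', hd⟩ | ⟨-, h'⟩
      · exact ⟨l', hl', hd⟩
      · exact (hv _ _ k' h' (hn.sh_le hk H.sh_le) rfl).elim
  refine coind (fun c d => ∃ k l, sh k ≤ h ∧ sh l ≤ h ∧ c = mk (k * f.star) ∧ d = mk (l * f.star) ∧
    mk k * (mk f.star * v) = mk l * (mk f.star * v)) ?_ ⟨k, l, hk, hl, rfl, rfl, e⟩
  rintro _ _ ⟨k, l, hk, hl, rfl, rfl, e⟩
  refine ⟨?_, fun a c hc => ?_, fun a c hc => ?_⟩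
  · simp only [tm_mk, term_mul, Term.star, and_true]
    exact ⟨hterm hl e, hterm hk e.symm⟩
  · obtain ⟨g, hg, rfl⟩ := tr_mk.1 hc
    obtain ⟨k', hk', rfl⟩ := step_mul_star.1 hg
    obtain ⟨l', hl', e'⟩ := hnxt hk e hk'
    exact ⟨_, tr_mk.2 ⟨_, step_mul_star.2 ⟨l', hl', rfl⟩, rfl⟩,
      Or.inr ⟨k', l', hk'.sh_le hk H.sh_le, hl'.sh_le hl H.sh_le, rfl, rfl, e'⟩⟩
  · obtain ⟨g, hg, rfl⟩ := tr_mk.1 hc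
    obtain ⟨l', hl', rfl⟩ := step_mul_star.1 hg
    obtain ⟨k', hk', e'⟩ := hnxt hl e.symm hl'
    exact ⟨_, tr_mk.2 ⟨_, step_mul_star.2 ⟨k', hk', rfl⟩, rfl⟩,
      Or.inr ⟨k', l', hk'.sh_le hk H.sh_le, hl'.sh_le hl H.sh_le, rfl, rfl, e'.symm⟩⟩

theorem cls_mul_star_eq (H : Loop h X v f)
    (hv : ∀ a d k, Tr v a d → sh k ≤ h → d ≠ mk k * (mk f.star * v)) {k l : RegularExpression α}
    (hk : sh k ≤ h) (hl : sh l ≤ h)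
    (e : mk k * (mk f.star * v) = mk l * (mk f.star * v)) : cls (k * f.star) = cls (l * f.star) := by
  have hg : HG (mk (l * f.star)) := by
    rw [← mul_one (mk (l * f.star))]
    refine H.hg_mul _ ?_ _ hg_one
    rw [sh_mul, sh_star]; have := H.sh_le; omega
  exact hg.cls_eq (H.mk_mul_star_eq hv hk hl e)

theorem not_term (H : Loop h X v f) {k : RegularExpression α}
    (hd : Dec X (mk k * (mk f.star * v))) (hX : ¬ Ext X (mk k * (mk f.star * v))) : ¬ Term k := by
  refine fun hk => H.not_dec (Dec.of_rx ?_ fun a d h' => hd.rx (a := a) ⟨?_, fun h => (hX h).elim⟩)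
  · simp [H.not_tm, H.not_tm_mul]
  · exact tr_mul.2 (Or.inr ⟨tm_mk.2 hk, h'.1⟩)

theorem tr_cases (H : Loop h X v f) {a : α} {d : Proc α} (hd : Tr X a d) :
    (∃ k, sh k ≤ h ∧ d = mk k * (mk f.star * v)) ∨ Tr v a d := by
  obtain ⟨k, hk, hX⟩ := H.exists_ext
  rcases tr_mul_star.1 (hX.2 a d hd) with ⟨k', hk₁, hd⟩ | ⟨-, h'⟩
  · exact Or.inl ⟨k', hk₁.sh_le hk H.sh_le, hd⟩
  · exact Or.inr h'

theorem dec_nxt (H : Loop h X v f) {k k' : RegularExpression α} {a : α} (hk : sh k ≤ h)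
    (hd : Dec X (mk k * (mk f.star * v))) (hn : Nxt f k a k')
    (hX : Term k → ¬ Tr X a (mk k' * (mk f.star * v))) : Dec X (mk k' * (mk f.star * v)) :=
  hd.rx ⟨tr_mul_star.2 (Or.inl ⟨k', hn, rfl⟩), fun h' => hX (H.term hk h')⟩

theorem isSol_dec (H : Loop h X v f) {s : Proc α → Cls α} {x : Cls α}
    (hx : Lin (Tm X) 1 (Tr X) s x) (hs : ∀ c, Dec X c → Lin (Tm c) 1 (Tr c) s (s c)) :
    IsSol (fun a g => ¬ Tr X a (mk g * v))
      (fun g => ∃ k, sh k ≤ h ∧ g = k * f.star ∧ Dec X (mk k * (mk f.star * v)))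
      (x ⊔ s v) fun g => s (mk g * v) := by
  rintro _ ⟨k, hk, rfl, hd⟩
  constructor
  · rintro a _ ⟨hs, hX⟩
    obtain ⟨k', hk', rfl⟩ := step_mul_star.1 hs
    refine ⟨k', hk'.sh_le hk H.sh_le, rfl, H.dec_nxt hk hd hk' fun h' => ?_⟩
    rw [← mul_assoc, ← mk_mul]
    exact hX (term_mul.2 ⟨h', Term.star f⟩)
  · intro z
    have h₁ := hs _ hd z
    have h₂ := hx z
    have h₃ := hs v H.dec z
    simp only [mk_mul, mul_assoc, H.not_tm_dec hd, H.not_tm, H.not_tm_dec H.dec, false_imp_iff,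
      true_and] at h₁ h₂ h₃ ⊢
    simp only [term_mul, Term.star, and_true, sup_le_iff, h₁, h₂, h₃]
    constructor
    · intro hz
      refine ⟨fun hk' => ⟨fun a d h' => ?_, fun a d h' => ?_⟩, fun a g' hg => ?_⟩
      · by_cases hX : Ext X (mk k * (mk f.star * v))
        · exact hz a d (hX.2 a d h')
        · exact (H.not_term hd hX hk').elim
      · exact hz a d (tr_mul_star.2 (Or.inr ⟨hk', h'⟩))
      · obtain ⟨k', hk', rfl⟩ := step_mul_star.1 hg.1
        have := hz a _ (tr_mul_star.2 (Or.inl ⟨k', hk', rfl⟩))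
        rwa [mk_mul, mul_assoc]
    · rintro ⟨hz₁, hz₂⟩ a d h'
      rcases tr_mul_star.1 h' with ⟨k', hk', rfl⟩ | ⟨ht, h'⟩
      · by_cases hX : Term k ∧ Tr X a (mk k' * (mk f.star * v))
        · exact (hz₁ hX.1).1 a _ hX.2
        · have := hz₂ a (k' * f.star) ⟨step_mul_star.2 ⟨k', hk', rfl⟩, fun ht => ?_⟩
          · rwa [mk_mul, mul_assoc] at this
          · change ¬ Tr X a (mk (k' * f.star) * v)
            rw [mk_mul, mul_assoc]
            exact fun h' => hX ⟨(term_mul.1 ht).1, h'⟩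
      · exact (hz₁ ht).2 a d h'

theorem isSol_cls (H : Loop h X v f) {s : Proc α → Cls α}
    (hs : Lin (Tm v) 1 (Tr v) s (s v)) {y : Cls α} {t : Proc α → Cls α}
    (hy : Lin False 1 (Tr X) t y)
    (ht : ∀ k, sh k ≤ h → t (mk k * (mk f.star * v)) = cls (k * f.star) * s v)
    (ht' : ∀ a d, Tr v a d → t d = s d) :
    IsSol (fun a g => ¬ Tr X a (mk g * v))
      (fun g => ∃ k, sh k ≤ h ∧ g = k * f.star ∧ Dec X (mk k * (mk f.star * v)))
      (y ⊔ s v) fun g => cls g * s v := by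
  rintro _ ⟨k, hk, rfl, hd⟩
  constructor
  · rintro a _ ⟨hs, hX⟩
    obtain ⟨k', hk', rfl⟩ := step_mul_star.1 hs
    refine ⟨k', hk'.sh_le hk H.sh_le, rfl, H.dec_nxt hk hd hk' fun h' => ?_⟩
    rw [← mul_assoc, ← mk_mul]
    exact hX (term_mul.2 ⟨h', Term.star f⟩)
  · intro z
    have h₂ := hy z
    simp only [false_imp_iff, true_and] at h₂
    simp only [fundamental (k * f.star) (s v) z, sup_le_iff, term_mul, Term.star, and_true]
    constructor
    · rintro ⟨hz₁, hz₂⟩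
      refine ⟨fun hk' => ⟨h₂.2 fun a d h' => ?_, hz₁ hk'⟩, fun a g' hg => hz₂ a g' hg.1⟩
      by_cases hX : Ext X (mk k * (mk f.star * v))
      · rcases tr_mul_star.1 (hX.2 a d h') with ⟨l, hl, rfl⟩ | ⟨-, h'⟩
        · rw [ht l (hl.sh_le hk H.sh_le)]
          exact hz₂ a _ (step_mul_star.2 ⟨l, hl, rfl⟩)
        · rw [ht' a d h']
          exact ((hs z).1 (hz₁ hk')).2 a d h'
      · exact (H.not_term hd hX hk').elim
    · rintro ⟨hz₁, hz₂⟩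
      refine ⟨fun hk' => (hz₁ hk').2, fun a g' hg => ?_⟩
      obtain ⟨k', hk', rfl⟩ := step_mul_star.1 hg
      by_cases hX : Term k ∧ Tr X a (mk k' * (mk f.star * v))
      · have := h₂.1 (hz₁ hX.1).1 a _ hX.2
        rwa [ht k' (hk'.sh_le hk H.sh_le)] at this
      · refine hz₂ a _ ⟨hg, fun ht => ?_⟩
        change ¬ Tr X a (mk (k' * f.star) * v)
        rw [mk_mul, mul_assoc]
        exact fun h' => hX ⟨(term_mul.1 ht).1, h'⟩

theorem false_of_disjoint (H : Loop h X v f)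
    (hv : ∀ a d k, Tr v a d → sh k ≤ h → d ≠ mk k * (mk f.star * v)) : False := by
  classical
  obtain ⟨A, hA⟩ := exists_dec_expr X
  let L : Proc α → Prop := fun d => ∃ k, sh k ≤ h ∧ d = mk k * (mk f.star * v)
  let κ : Proc α → RegularExpression α := fun d => if hd : L d then hd.choose else 0
  have hκ : ∀ d, L d → sh (κ d) ≤ h ∧ d = mk (κ d) * (mk f.star * v) := fun d hd => by
    simp only [κ, dif_pos hd]
    exact hd.choose_spec
  let G : Proc α → RegularExpression α := fun d =>
    if Dec X d then A d else κ d * f.star * A v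
  have hGD : ∀ d, Dec X d → G d = A d := fun d hd => if_pos hd
  have hGN : ∀ d, ¬ Dec X d → G d = κ d * f.star * A v := fun d hd => if_neg hd
  clear_value κ G
  obtain ⟨F, hF, hF'⟩ := exists_proc_expr False (finite_tr X) G
  set x : Cls α := cls F.star * ⊥ with hxdef
  set s : Proc α → Cls α := fun d => cls (G d) * x with hsdef
  have hsD : ∀ d, Dec X d → s d = cls (A d) * x := fun d hd => by simp only [hsdef, hGD d hd]
  have hsN : ∀ d, ¬ Dec X d → s d = cls (κ d * f.star) * s v := fun d hd => by
    rw [hsD v H.dec]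
    simp only [hsdef, hGN d hd, cls_mul, mul_assoc]
  have hx : Lin (Tm X) 1 (Tr X) s x := fun z => by
    have h₁ := hF' x z
    have h₂ := star_mul_eq F (⊥ : Cls α)
    rw [← hxdef, sup_bot_eq] at h₂
    rw [← h₂] at h₁
    rw [h₁]
    simp only [false_imp_iff, H.not_tm, hsdef]
  clear_value s
  clear hxdef
  clear_value x
  have hlin : ∀ c, Dec X c → Lin (Tm c) 1 (Tr c) s (s c) := fun c hc => lin_of_dec hx hA hsD hc
  have hcls : ∀ {k l}, sh k ≤ h → sh l ≤ h →
      mk k * (mk f.star * v) = mk l * (mk f.star * v) → cls (k * f.star) = cls (l * f.star) :=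
    fun hk hl e => H.cls_mul_star_eq hv hk hl e
  have hκ' : ∀ k, sh k ≤ h →
      cls (κ (mk k * (mk f.star * v)) * f.star) = cls (k * f.star) := fun k hk => by
    have := hκ _ ((show L (mk k * (mk f.star * v)) from ⟨k, hk, rfl⟩))
    exact hcls this.1 hk this.2.symm
  have key : ∀ k, sh k ≤ h →
      s (mk k * (mk f.star * v)) = cls (k * f.star) * s v := by
    intro k hk
    by_cases hkD : Dec X (mk k * (mk f.star * v))
    swap
    · rw [hsN _ hkD, hκ' k hk]
    let t : Proc α → Cls α := fun d => if L d then cls (κ d * f.star) * s v else s d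
    have htL : ∀ d, L d → t d = cls (κ d * f.star) * s v := fun d hd => if_pos hd
    have htN : ∀ d, ¬ L d → t d = s d := fun d hd => if_neg hd
    clear_value t
    obtain ⟨y, hy⟩ := Lin.exists False 1 (finite_tr X) t
    have sol₁ := H.isSol_dec hx hlin
    have sol₂ := H.isSol_cls (hlin v H.dec) hy
      (fun k hk => by rw [htL _ ⟨k, hk, rfl⟩, hκ' k hk])
      fun a d hd => htN d fun ⟨k, hk, e⟩ => hv a d k hd hk e
    choose β hβ using exists_filters fun (a : α) g => ¬ Tr X a (mk g * v)
    have hβ₁ := fun g hg => (hβ g).2.2 _ _ _ sol₁ hg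
    have hβ₂ := fun g hg => (hβ g).2.2 _ _ _ sol₂ hg
    obtain ⟨M, hM, hM'⟩ := exists_proc_expr False (E := fun a d => Tr X a d ∧ L d ∧ Dec X d)
      ((finite_tr X).subset fun p hp => hp.1) fun d => β (κ d * f.star)
    have hM : ¬ Term M := fun h => hM.1 h
    obtain ⟨w, hw⟩ := Lin.exists True (s v) (E := fun a d => Tr X a d ∧ ¬ (L d ∧ Dec X d))
      ((finite_tr X).subset fun p hp => hp.1) t
    have hmem : ∀ d, L d → Dec X d → ∃ k, sh k ≤ h ∧ κ d * f.star = k * f.star ∧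
        Dec X (mk k * (mk f.star * v)) := fun d hd hd' =>
      ⟨κ d, (hκ d hd).1, rfl, by rwa [← (hκ d hd).2]⟩
    have e₁ : x ⊔ s v = cls M * (x ⊔ s v) ⊔ w := by
      refine eq_of_forall_ge_iff fun z => ?_
      have hM₁ := hM' (x ⊔ s v) z
      have hw₁ := hw z
      have hx₁ := hx z
      simp only [H.not_tm, false_imp_iff, true_imp_iff, true_and] at hM₁ hw₁ hx₁
      rw [sup_le_iff, sup_le_iff, hx₁, hM₁, hw₁]
      have hval : ∀ d, L d → Dec X d → cls (β (κ d * f.star)) * (x ⊔ s v) = s d :=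
        fun d hd hd' => by
          rw [← hβ₁ _ (hmem d hd hd')]
          rw [mk_mul, mul_assoc, ← (hκ d hd).2]
      have hval' : ∀ d, ¬ (L d ∧ Dec X d) → t d = s d := fun d hd => by
        by_cases hL : L d
        · rw [htL d hL, hsN d fun h' => hd ⟨hL, h'⟩]
        · exact htN d hL
      constructor
      · rintro ⟨h₁, h₂⟩
        refine ⟨fun a d hd => ?_, h₂, fun a d hd => ?_⟩
        · rw [hval d hd.2.1 hd.2.2]; exact h₁ a d hd.1
        · rw [hval' d hd.2]; exact h₁ a d hd.1
      · rintro ⟨h₁, h₂, h₃⟩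
        refine ⟨fun a d hd => ?_, h₂⟩
        by_cases hL : L d ∧ Dec X d
        · rw [← hval d hL.1 hL.2]; exact h₁ a d ⟨hd, hL⟩
        · rw [← hval' d hL]; exact h₃ a d ⟨hd, hL⟩
    have e₂ : y ⊔ s v = cls M * (y ⊔ s v) ⊔ w := by
      refine eq_of_forall_ge_iff fun z => ?_
      have hM₁ := hM' (y ⊔ s v) z
      have hw₁ := hw z
      have hy₁ := hy z
      simp only [false_imp_iff, true_imp_iff, true_and] at hM₁ hw₁ hy₁
      rw [sup_le_iff, sup_le_iff, hy₁, hM₁, hw₁]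
      have hval : ∀ d, L d → Dec X d → cls (β (κ d * f.star)) * (y ⊔ s v) = t d :=
        fun d hd hd' => by rw [← hβ₂ _ (hmem d hd hd'), htL d hd]
      constructor
      · rintro ⟨h₁, h₂⟩
        refine ⟨fun a d hd => ?_, h₂, fun a d hd => h₁ a d hd.1⟩
        rw [hval d hd.2.1 hd.2.2]; exact h₁ a d hd.1
      · rintro ⟨h₁, h₂, h₃⟩
        refine ⟨fun a d hd => ?_, h₂⟩
        by_cases hL : L d ∧ Dec X d
        · rw [← hval d hL.1 hL.2]; exact h₁ a d ⟨hd, hL⟩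
        · exact h₃ a d ⟨hd, hL⟩
    have hxy := guarded_unique hM e₁ e₂
    have r₁ := hβ₁ (k * f.star) ⟨k, hk, rfl, hkD⟩
    have r₂ := hβ₂ (k * f.star) ⟨k, hk, rfl, hkD⟩
    change s _ = _ at r₁
    change cls (k * f.star) * s v = _ at r₂
    rw [mk_mul, mul_assoc] at r₁
    rw [r₁, r₂, hxy]
  refine H.not_hg (hg_of_solution (fun c => Dec X c ∨ L c) s ?_ ?_ (Or.inl (dec_self X)))
  · rintro c (hc | hc) a d hd
    · by_cases hr : Rx X c a d
      · exact Or.inl (hc.rx hr)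
      · have : Tr X a d := by
          by_contra hXd
          exact hr ⟨hd, fun _ => hXd⟩
        exact (H.tr_cases this).symm.imp H.dec_of_tr id
    · rw [(hκ c hc).2] at hd
      rcases tr_mul_star.1 hd with ⟨k', hk', rfl⟩ | ⟨-, h'⟩
      · exact Or.inr ⟨k', hk'.sh_le (hκ c hc).1 H.sh_le, rfl⟩
      · exact Or.inl (H.dec_of_tr h')
  · intro c hc
    by_cases hcD : Dec X c
    · exact hlin c hcD
    obtain ⟨k, hk, rfl⟩ := hc.resolve_left hcD
    intro z
    have h₁ := hlin v H.dec z
    have h₂ := fundamental (k * f.star) (s v) z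
    simp only [H.not_tm_dec H.dec, H.not_tm_mul, ← mul_assoc (mk k), false_imp_iff, true_and,
      term_mul, Term.star, and_true] at h₁ h₂ ⊢
    rw [mul_assoc, key k hk, h₂, h₁]
    constructor
    · rintro ⟨hz₁, hz₂⟩ a d hd
      rcases tr_mul_star.1 hd with ⟨k', hk', rfl⟩ | ⟨ht, h'⟩
      · rw [key k' (hk'.sh_le hk H.sh_le)]
        exact hz₂ a _ (step_mul_star.2 ⟨k', hk', rfl⟩)
      · exact hz₁ ht a d h'
    · intro hz
      refine ⟨fun ht a d hd => hz a d (tr_mul_star.2 (Or.inr ⟨ht, hd⟩)), fun a g hg => ?_⟩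
      obtain ⟨k', hk', rfl⟩ := step_mul_star.1 hg
      have := hz a _ (tr_mul_star.2 (Or.inl ⟨k', hk', rfl⟩))
      rwa [key k' (hk'.sh_le hk H.sh_le)] at this

end Loop

end Loop

section Loop

theorem not_term_mul_ne {h n : ℕ} {X v : Proc α} {f : RegularExpression α}
    (hf : sh f ≤ h) (hn : n ≤ h) (hne : ∀ m, ¬ Term m → sh m ≤ h → mk m * v ≠ X) :
    ∀ m, ¬ Term m → sh m ≤ n → mk m * (mk f * v) ≠ X := fun m hm hm' => by
  rw [← mul_assoc, ← mk_mul]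
  refine hne _ (fun h => hm (term_mul.1 h).1) ?_
  rw [sh_mul]
  omega

variable [Fintype α]

namespace Loop

variable {h : ℕ} {X v : Proc α} {f : RegularExpression α}

/-- The transitions of `v` to iteration bodies can be moved into the iterated expression. -/
theorem exists_disjoint (H : Loop h X v f) : ∃ v' f', Loop h X v' f' ∧
    ∀ a d k, Tr v' a d → sh k ≤ h → d ≠ mk k * (mk f'.star * v') := by
  let L : Proc α → Prop := fun d => ∃ k, sh k ≤ h ∧ d = mk k * (mk f.star * v)
  obtain ⟨w, hw, hw'⟩ := exists_tr False (T := {p | Tr v p.1 p.2 ∧ ¬ L p.2})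
    ((finite_tr v).subset fun p hp => hp.1)
  have hw : ¬ Tm (mk w) := fun h => hw.1 (tm_mk.1 h)
  have hκ : ∀ d, ∃ k, sh k ≤ h ∧ (L d → d = mk k * (mk f.star * v)) := fun d => by
    by_cases hd : L d
    · obtain ⟨k, hk, hd⟩ := hd
      exact ⟨k, hk, fun _ => hd⟩
    · exact ⟨0, by simp [sh_zero], fun h => (hd h).elim⟩
  choose κ hκ₁ hκ₂ using hκ
  have hfin : {p : α × Proc α | Tr v p.1 p.2 ∧ L p.2}.Finite :=
    (finite_tr v).subset fun p hp => hp.1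
  obtain ⟨m, -, hm, hm'⟩ := exists_sum False (hfin.image fun p => (p.1, κ p.2))
  have hsm : sh (f + m) ≤ h := by
    rw [sh_add]
    refine max_le H.sh_le (hm' h ?_)
    rintro _ ⟨p, -, rfl⟩
    exact hκ₁ _
  have e : mk (f + m).star * mk w = mk f.star * v := by
    have := coind (fun c d => ∃ k : RegularExpression α,
      c = mk k * (mk (f + m).star * mk w) ∧ d = mk k * (mk f.star * v)) ?_
      ⟨1, rfl, rfl⟩
    · simpa only [mk_one, one_mul] using this
    rintro _ _ ⟨k, rfl, rfl⟩
    refine ⟨by simp [tm_mul, hw, H.not_tm_dec H.dec], fun a c hc => ?_, fun a d hd => ?_⟩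
    · rcases tr_mul_star.1 hc with ⟨k', hk | ⟨ht, hk⟩, rfl⟩ | ⟨ht, hc⟩
      · exact ⟨_, tr_mul_star.2 (Or.inl ⟨k', Or.inl hk, rfl⟩), Or.inr ⟨k', rfl, rfl⟩⟩
      · rcases step_add.1 hk with hk | hk
        · exact ⟨_, tr_mul_star.2 (Or.inl ⟨k', Or.inr ⟨ht, hk⟩, rfl⟩), Or.inr ⟨k', rfl, rfl⟩⟩
        · obtain ⟨_, ⟨⟨a, d⟩, hd, ⟨⟩⟩, rfl⟩ := (hm a k').1 hk
          refine ⟨d, tr_mul_star.2 (Or.inr ⟨ht, hd.1⟩), Or.inr ⟨κ d, ?_, hκ₂ d hd.2⟩⟩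
          rw [mk_mul, mk_one, one_mul]
      · exact ⟨c, tr_mul_star.2 (Or.inr ⟨ht, ((hw' a c).1 hc).1⟩), Or.inl rfl⟩
    · rcases tr_mul_star.1 hd with ⟨k', hk | ⟨ht, hk⟩, rfl⟩ | ⟨ht, hd⟩
      · exact ⟨_, tr_mul_star.2 (Or.inl ⟨k', Or.inl hk, rfl⟩), Or.inr ⟨k', rfl, rfl⟩⟩
      · exact ⟨_, tr_mul_star.2 (Or.inl ⟨k', Or.inr ⟨ht, step_add.2 (Or.inl hk)⟩, rfl⟩),
          Or.inr ⟨k', rfl, rfl⟩⟩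
      · by_cases hL : L d
        · refine ⟨_, tr_mul_star.2 (Or.inl ⟨1 * κ d, Or.inr ⟨ht, step_add.2 (Or.inr ((hm a _).2
            ⟨κ d, ⟨(a, d), ⟨hd, hL⟩, rfl⟩, rfl⟩))⟩, rfl⟩), Or.inr ⟨κ d, ?_, hκ₂ d hL⟩⟩
          rw [mk_mul, mk_one, one_mul]
        · exact ⟨d, tr_mul_star.2 (Or.inr ⟨ht, (hw' a d).2 ⟨hd, hL⟩⟩), Or.inl rfl⟩
  refine ⟨mk w, f + m, ⟨H.not_hg, H.not_tm, H.hg_mul, hsm, Dec.of_rx ?_ fun a d hd => ?_, ?_, ?_⟩,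
    fun a d k hd hk hdk => ?_⟩
  · simp [hw, H.not_tm]
  · exact H.dec_of_tr ((hw' a d).1 hd.1).1
  · rw [e]; exact H.not_dec
  · rw [e]; exact H.ne_mul
  · rw [e] at hdk
    exact ((hw' a d).1 hd).2 ⟨k, hk, hdk⟩

theorem false (H : Loop h X v f) : False := by
  obtain ⟨v', f', H', hd⟩ := H.exists_disjoint
  exact H'.false_of_disjoint hd

end Loop

theorem dec_star {N : ℕ} {X v : Proc α} {f : RegularExpression α} (hX : ¬ HG X) (hX' : ¬ Tm X)
    (hN : ∀ e, sh e ≤ N → ∀ p : Proc α, HG p → HG (mk e * p)) (hf : sh f + 1 ≤ N) (hv : Dec X v)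
    (hne : ∀ m, ¬ Term m → sh m ≤ sh f → mk m * (mk f.star * v) ≠ X)
    (ih : Dec X (mk f.star * v) → ∀ k, Der f k → Dec X (mk k * (mk f.star * v))) :
    Dec X (mk f.star * v) ∧ ∀ k, Der f.star k → Dec X (mk k * v) := by
  have h : Dec X (mk f.star * v) := by
    by_contra hd
    exact Loop.false ⟨hX, hX', fun e he => hN e (he.trans hf), le_rfl, hv, hd, hne⟩
  refine ⟨h, fun k hk => ?_⟩
  obtain ⟨k', hk', rfl⟩ := der_star hk
  rw [mk_mul, mul_assoc]
  exact ih h k' hk'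

theorem dec_of_der {X v : Proc α} {g : RegularExpression α} (hX : ¬ Tm X) (hv : Dec X v)
    (hg : ∀ k, Der g k → Dec X (mk k * v)) : Dec X (mk g * v) := by
  have hv' : ¬ Tm v := fun h => hX (hv.tm.1 h).2
  refine Dec.of_rx (by simp [tm_mul, hv', hX]) fun a d hd => ?_
  rcases tr_mul.1 hd.1 with ⟨c, hc, rfl⟩ | ⟨ht, h'⟩
  · obtain ⟨k, hk, rfl⟩ := tr_mk.1 hc
    exact hg k (Der.single hk)
  · exact hv.rx ⟨h', fun hext => hd.2 ⟨fun h => (hX h).elim,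
      fun b c hc => tr_mul.2 (Or.inr ⟨ht, hext.2 b c hc⟩)⟩⟩

/-- Products with a represented process `v` are represented, as long as `X` does not occur
guardedly above `v`. -/
theorem dec_mul {N h : ℕ} {X : Proc α} (hX : ¬ HG X) (hX' : ¬ Tm X)
    (hN : ∀ e, sh e ≤ N → ∀ p : Proc α, HG p → HG (mk e * p)) {g : RegularExpression α}
    (hg : sh g ≤ N) (hh : sh g ≤ h) {v : Proc α} (hv : Dec X v)
    (hne : ∀ m, ¬ Term m → sh m ≤ h → mk m * v ≠ X) :
    ∀ k, Der g k → Dec X (mk k * v) := by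
  induction g generalizing v with
  | zero => exact fun k hk => (not_der_zero hk).elim
  | epsilon => exact fun k hk => (not_der_one hk).elim
  | char b =>
    intro k hk
    rwa [der_char hk, mk_one, one_mul]
  | plus e f ihe ihf =>
    rw [plus_def, sh_add, max_le_iff] at hg hh
    exact fun k hk => (der_add hk).elim (ihe hg.1 hh.1 hv hne k) (ihf hg.2 hh.2 hv hne k)
  | comp e f ihe ihf =>
    rw [comp_def, sh_mul, max_le_iff] at hg hh
    have hf := ihf hg.2 hh.2 hv hne
    intro k hk
    rcases der_mul hk with ⟨k, h₁, rfl⟩ | hk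
    · rw [mk_mul, mul_assoc]
      exact ihe hg.1 hh.1 (dec_of_der hX' hv hf) (not_term_mul_ne hh.2 le_rfl hne) k h₁
    · exact hf k hk
  | star f ih =>
    rw [sh_star] at hg hh
    exact (dec_star hX hX' hN hg hv (not_term_mul_ne hh (by omega) hne) fun h' =>
      ih (by omega) (by omega) h' (not_term_mul_ne hh le_rfl hne)).2

end Loop

section Order

/-- The multiset of star heights of the outermost iterated subexpressions. -/
def ost : RegularExpression α → Multiset ℕ
  | .zero => 0
  | .epsilon => 0
  | .char _ => 0
  | .plus e f => ost e + ost f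
  | .comp e f => ost e + ost f
  | .star e => {sh e}

theorem ost_add (e f : RegularExpression α) : ost (e + f) = ost e + ost f := rfl
theorem ost_mul (e f : RegularExpression α) : ost (e * f) = ost e + ost f := rfl
theorem ost_star (e : RegularExpression α) : ost e.star = {sh e} := rfl

theorem lt_sh_of_mem_ost {e : RegularExpression α} {n : ℕ} (h : n ∈ ost e) : n < sh e := by
  induction e with
  | zero | epsilon | char => simp [ost] at h
  | plus e f ihe ihf =>
    rw [plus_def, ost_add, Multiset.mem_add] at h
    rw [plus_def, sh_add]
    exact h.elim (fun h => lt_max_of_lt_left (ihe h)) fun h => lt_max_of_lt_right (ihf h)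
  | comp e f ihe ihf =>
    rw [comp_def, ost_mul, Multiset.mem_add] at h
    rw [comp_def, sh_mul]
    exact h.elim (fun h => lt_max_of_lt_left (ihe h)) fun h => lt_max_of_lt_right (ihf h)
  | star e =>
    rw [ost_star, Multiset.mem_singleton] at h
    rw [sh_star]; omega

theorem exists_mem_ost {e : RegularExpression α} (h : sh e ≠ 0) :
    ∃ n ∈ ost e, n + 1 = sh e := by
  induction e with
  | zero | epsilon | char => exact (h rfl).elim
  | plus e f ihe ihf =>
    rw [plus_def, sh_add] at h ⊢
    simp only [ost_add, Multiset.mem_add]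
    rcases le_total (sh e) (sh f) with h' | h'
    · rw [max_eq_right h'] at h ⊢
      obtain ⟨n, hn, hn'⟩ := ihf h
      exact ⟨n, Or.inr hn, hn'⟩
    · rw [max_eq_left h'] at h ⊢
      obtain ⟨n, hn, hn'⟩ := ihe h
      exact ⟨n, Or.inl hn, hn'⟩
  | comp e f ihe ihf =>
    rw [comp_def, sh_mul] at h ⊢
    simp only [ost_mul, Multiset.mem_add]
    rcases le_total (sh e) (sh f) with h' | h'
    · rw [max_eq_right h'] at h ⊢
      obtain ⟨n, hn, hn'⟩ := ihf h
      exact ⟨n, Or.inr hn, hn'⟩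
    · rw [max_eq_left h'] at h ⊢
      obtain ⟨n, hn, hn'⟩ := ihe h
      exact ⟨n, Or.inl hn, hn'⟩
  | star e => exact ⟨sh e, by simp [ost_star], rfl⟩

theorem ost_lt_of_sh_lt {e f : RegularExpression α} (h : sh e < sh f) :
    (ost e).IsDershowitzMannaLT (ost f) := by
  obtain ⟨n, hn, hn'⟩ := exists_mem_ost (e := f) (by omega)
  refine ⟨0, ost e, ost f, fun h => ?_, by simp, by simp, fun y hy => ⟨n, hn, ?_⟩⟩
  · rw [h] at hn; simp at hn
  · have := lt_sh_of_mem_ost hy; omega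

theorem ost_add_mul_lt {g w m f : RegularExpression α} (h : ost g.star + ost w ≤ ost f)
    (hm : sh m ≤ sh g) : (ost (g + w * m)).IsDershowitzMannaLT (ost f) := by
  obtain ⟨r, hr⟩ := Multiset.le_iff_exists_add.1 h
  refine ⟨ost w, ost g + ost m, {sh g} + r, by simp, ?_, ?_, fun y hy => ⟨sh g, by simp, ?_⟩⟩
  · rw [ost_add, ost_mul, add_left_comm]
  · rw [hr, ost_star, add_comm {sh g}, add_assoc]
  · rcases Multiset.mem_add.1 hy with hy | hy
    · exact lt_sh_of_mem_ost hy
    · exact (lt_sh_of_mem_ost hy).trans_le hm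

end Order

section Main

theorem loop_eq {X : Proc α} {g w m : RegularExpression α} (hX : ¬ Tm X) (hm : ¬ Term m)
    (e : mk m * (mk g.star * (mk w * X)) = X) :
    mk g.star * (mk w * X) = mk (g + w * m).star * mk 0 := by
  have hw : ∀ a d, Tr (mk w * X) a d →
      ∃ c, Tr (mk (w * m)) a c ∧ d = c * (mk g.star * (mk w * X)) := fun a d hd => by
    rcases tr_mul.1 hd with ⟨c, hc, rfl⟩ | ⟨ht, hd⟩
    · refine ⟨c * mk m, ?_, by rw [mul_assoc, e]⟩
      rw [mk_mul]
      exact tr_mul.2 (Or.inl ⟨c, hc, rfl⟩)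
    · rw [← e] at hd
      rcases tr_mul.1 hd with ⟨c, hc, rfl⟩ | ⟨ht', -⟩
      · refine ⟨c, ?_, rfl⟩
        rw [mk_mul]
        exact tr_mul.2 (Or.inr ⟨ht, hc⟩)
      · exact (hm (tm_mk.1 ht')).elim
  have hw' : ∀ a c, Tr (mk (w * m)) a c →
      Tr (mk w * X) a (c * (mk g.star * (mk w * X))) := fun a c hc => by
    rw [mk_mul] at hc
    conv in mk w * X => rw [← e]
    rw [← mul_assoc]
    rcases tr_mul.1 hc with h | ⟨ht, h⟩
    · exact tr_mul.2 (Or.inl ⟨_, tr_mul.2 (Or.inl h), rfl⟩)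
    · exact tr_mul.2 (Or.inl ⟨_, tr_mul.2 (Or.inr ⟨ht, h⟩), rfl⟩)
  have := coind (fun c d => ∃ k, c = k * (mk g.star * (mk w * X)) ∧
    d = k * (mk (g + w * m).star * mk 0)) ?_ ⟨1, rfl, rfl⟩
  · simpa only [one_mul] using this
  rintro _ _ ⟨k, rfl, rfl⟩
  refine ⟨by simp [tm_mul, hX, not_tm_zero], fun a d hd => ?_, fun a d hd => ?_⟩
  · have : (∃ c, Tr k a c ∧ d = c * (mk g.star * (mk w * X))) ∨ Tm k ∧
        ∃ c, Tr (mk (g + w * m)) a c ∧ d = c * (mk g.star * (mk w * X)) := by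
      rcases tr_mul.1 hd with h | ⟨ht, h⟩
      · exact Or.inl h
      · refine Or.inr ⟨ht, ?_⟩
        rcases tr_mul.1 h with ⟨c, hc, rfl⟩ | ⟨-, h⟩
        · obtain ⟨b, hb, rfl⟩ := tr_star.1 hc
          exact ⟨b, tr_add.2 (Or.inl hb), mul_assoc _ _ _⟩
        · obtain ⟨c, hc, rfl⟩ := hw a d h
          exact ⟨c, tr_add.2 (Or.inr hc), rfl⟩
    rcases this with ⟨c, hc, rfl⟩ | ⟨ht, c, hc, rfl⟩
    · exact ⟨_, tr_mul.2 (Or.inl ⟨c, hc, rfl⟩), Or.inr ⟨c, rfl, rfl⟩⟩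
    · exact ⟨_, tr_mul.2 (Or.inr ⟨ht, tr_mul.2 (Or.inl ⟨_, tr_star.2 ⟨c, hc, rfl⟩, rfl⟩)⟩),
        Or.inr ⟨c, rfl, mul_assoc _ _ _⟩⟩
  · rcases tr_mul.1 hd with ⟨c, hc, rfl⟩ | ⟨ht, h⟩
    · exact ⟨_, tr_mul.2 (Or.inl ⟨c, hc, rfl⟩), Or.inr ⟨c, rfl, rfl⟩⟩
    · rcases tr_mul.1 h with ⟨c, hc, rfl⟩ | ⟨-, h⟩
      · obtain ⟨b, hb, rfl⟩ := tr_star.1 hc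
        refine ⟨b * (mk g.star * (mk w * X)), tr_mul.2 (Or.inr ⟨ht, ?_⟩),
          Or.inr ⟨b, rfl, mul_assoc _ _ _⟩⟩
        rcases tr_add.1 hb with hb | hb
        · exact tr_mul.2 (Or.inl ⟨_, tr_star.2 ⟨b, hb, rfl⟩, (mul_assoc _ _ _).symm⟩)
        · exact tr_mul.2 (Or.inr ⟨tm_star, hw' a b hb⟩)
      · exact (not_tr_zero h).elim

variable [Fintype α]

theorem dec_mul_self {f : RegularExpression α} {X : Proc α}
    (ih : ∀ g : RegularExpression α, (ost g).IsDershowitzMannaLT (ost f) → StarProp g)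
    (hX : ¬ HG X) (hX' : ¬ Tm X)
    (hN : ∀ e, sh e ≤ sh f → ∀ p : Proc α, HG p → HG (mk e * p)) {g w : RegularExpression α}
    (hg : sh g ≤ sh f) (hgw : ost g + ost w ≤ ost f) (hw : Dec X (mk w * X)) :
    ∀ k, Der g k → Dec X (mk k * (mk w * X)) := by
  induction g generalizing w with
  | zero => exact fun k hk => (not_der_zero hk).elim
  | epsilon => exact fun k hk => (not_der_one hk).elim
  | char b =>
    intro k hk
    rwa [der_char hk, mk_one, one_mul]
  | plus e f ihe ihf =>
    rw [plus_def, sh_add, max_le_iff] at hg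
    rw [plus_def, ost_add] at hgw
    exact fun k hk => (der_add hk).elim
      (ihe hg.1 ((add_le_add_left (Multiset.le_add_right _ _) _).trans hgw) hw k)
      (ihf hg.2 ((add_le_add_left (Multiset.le_add_left _ _) _).trans hgw) hw k)
  | comp e f ihe ihf =>
    rw [comp_def, sh_mul, max_le_iff] at hg
    rw [comp_def, ost_mul] at hgw
    have hf := ihf hg.2 ((add_le_add_left (Multiset.le_add_left _ _) _).trans hgw) hw
    intro k hk
    rcases der_mul hk with ⟨k, h₁, rfl⟩ | hk
    · rw [mk_mul, mul_assoc, ← mul_assoc (mk f), ← mk_mul]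
      refine ihe hg.1 ?_ ?_ k h₁
      · rwa [ost_mul, ← add_assoc]
      · rw [mk_mul, mul_assoc]
        exact dec_of_der hX' hw hf
    · exact hf k hk
  | star g =>
    rw [sh_star] at hg
    have hne : ∀ m, ¬ Term m → sh m ≤ sh g → mk m * (mk g.star * (mk w * X)) ≠ X := by
      intro m hm hm' e
      refine hX ?_
      rw [← e, loop_eq hX' hm e]
      exact hN m (by omega) _ (ih _ (ost_add_mul_lt hgw hm') _ hg_zero)
    exact (dec_star hX hX' hN hg hw hne fun h' =>
      dec_mul hX hX' hN (by omega) le_rfl h' hne).2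

theorem starProp (f : RegularExpression α) : StarProp f := by
  induction f using (InvImage.wf ost Multiset.wellFounded_isDershowitzMannaLT).induction with
  | _ f ih
  change ∀ g : RegularExpression α, (ost g).IsDershowitzMannaLT (ost f) → StarProp g at ih
  intro p hp
  have hN : ∀ e, sh e ≤ sh f → ∀ p : Proc α, HG p → HG (mk e * p) := fun e he p hp =>
    hg_mul (fun g hg => ih g (ost_lt_of_sh_lt hg)) he hp
  by_contra hX
  have htr : ∀ a d, Tr (mk f.star * p) a d →
      (∃ k, Der f k ∧ d = mk k * (mk f.star * p)) ∨ Tr p a d := fun a d hd => by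
    rw [← one_mul (mk f.star * p), ← mk_one] at hd
    rcases tr_mul_star.1 hd with ⟨k, hk | ⟨-, hk⟩, rfl⟩ | ⟨-, hd⟩
    · exact (not_step_one hk).elim
    · exact Or.inl ⟨k, Der.single hk, rfl⟩
    · exact Or.inr hd
  refine hX (hg_of_dec_targets fun a d hd => (htr a d hd).imp ?_ hp.succ)
  rintro ⟨k, hk, rfl⟩
  by_cases ht : Tm (mk f.star * p)
  · obtain ⟨B, hB₁, hB₂, -⟩ :=
      exists_filters (fun a g' => ¬ Tr (mk f.star * p) a (mk g' * (mk f.star * p))) k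
    refine ⟨mk B * 1, hN B (hB₁.trans (sh_der hk)) 1 hg_one,
      Rep.of_frep (Γ := fun _ => True) (tm_one) (fun _ _ h => (not_tr_one h).elim)
        (fun _ _ h h' => (h' h).elim) (fun _ _ _ _ _ => trivial) (fun g _ => ⟨⟨fun h => ?_,
          fun h => ⟨fun h' => tm_mul.2 ⟨tm_mk.2 h, h'⟩,
            fun _ _ hd => tr_mul.2 (Or.inr ⟨tm_mk.2 h, hd⟩)⟩⟩, by rw [tm_mul, tm_mk]⟩) hB₂ trivial⟩
    exact tm_mk.1 (tm_mul.1 (h.1 ht)).1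
  · have := dec_mul_self ih hX ht hN (g := f) (w := 1) le_rfl (by simp [ost])
      (by rw [mk_one, one_mul]; exact dec_self _) k hk
    rwa [mk_one, one_mul] at this

theorem mil_of_bisimilar {e f : RegularExpression α} (h : Bisimilar e f) : Mil e f := by
  have hg : HG (mk e) := by
    rw [← mul_one (mk e)]
    exact hg_mul (fun g _ => starProp g) le_rfl hg_one
  exact cls_eq.1 (hg.good e f rfl (mk_eq.2 h).symm)

end Main

end Milner

/-- **Statement 7** (Soundness and completeness of Milner's proof system `Mil`).
Two regular expressions over a finite alphabet are provably equal in `Mil` iff they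
are bisimilar w.r.t. the process (operational) semantics. -/
theorem mil_sound_complete (α : Type) [Fintype α] (e f : RegularExpression α) :
    Mil e f ↔ Bisimilar e f := by
  exact ⟨fun h => Milner.Proc.mk_eq.1 (Milner.sound h), Milner.mil_of_bisimilar⟩
end

section
/- Least solutions of rational systems over a Kleene algebra: let K be a Kleene algebra, Q a finite set, M : Q → Q → K and b : Q → K. Then the system of inequations b(q) + Σ_{q'∈Q} M(q,q')·s(q') ≤ s(q) (one for each q ∈ Q) has a least solution: there exists s : Q → K satisfying all the inequations such that for every s' : Q → K satisfying all the inequations and every q ∈ Q, s(q) ≤ s'(q). -/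
theorem IdemSemiring.sum_le_iff {K ι : Type*} [IdemSemiring K] {t : Finset ι} {f : ι → K} {c : K} :
    ∑ i ∈ t, f i ≤ c ↔ ∀ i ∈ t, f i ≤ c := by
  classical
  induction t using Finset.induction_on with
  | empty => simp
  | insert i t hi ih => rw [Finset.sum_insert hi, add_le_iff, ih, Finset.forall_mem_insert]

/-- Solutions of the affine system with matrix `M` and vector `b`, stated entrywise. -/
def affineSolutions {K Q : Type*} [IdemSemiring K] (M : Q → Q → K) (b : Q → K) : Set (Q → K) :=
  {s | ∀ q, b q ≤ s q ∧ ∀ q', M q q' * s q' ≤ s q}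

theorem mem_affineSolutions_iff_sum_le {K Q : Type*} [IdemSemiring K] [Fintype Q]
    {M : Q → Q → K} {b s : Q → K} :
    s ∈ affineSolutions M b ↔ ∀ q, b q + ∑ q', M q q' * s q' ≤ s q := by
  simp only [affineSolutions, Set.mem_ofPred_eq, add_le_iff, IdemSemiring.sum_le_iff,
    Finset.mem_univ, true_imp_iff]

/-- Gaussian elimination of the unknown `none`. -/
theorem exists_isLeast_affineSolutions_option {K Q : Type*} [KleeneAlgebra K] [Fintype Q]
    (h : ∀ (M : Q → Q → K) (b : Q → K), ∃ s, IsLeast (affineSolutions M b) s)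
    (M : Option Q → Option Q → K) (b : Option Q → K) :
    ∃ s, IsLeast (affineSolutions M b) s := by
  let a := KStar.kstar (M none none)
  obtain ⟨s, hs, hmin⟩ := h
    (fun i j => M (some i) (some j) + M (some i) none * (a * M none (some j)))
    (fun i => b (some i) + M (some i) none * (a * b none))
  let t := b none + ∑ j, M none (some j) * s j
  have ht : b none ≤ t ∧ ∀ j, M none (some j) * s j ≤ t := by
    simpa [IdemSemiring.sum_le_iff] using add_le_iff.1 (le_refl t)
  have hat : t ≤ a * t := by
    simpa using mul_le_mul_left (one_le_kstar (a := M none none)) t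
  refine ⟨fun o => o.elim (a * t) s, ?_, ?_⟩
  · rintro (_ | i)
    · refine ⟨ht.1.trans hat, ?_⟩
      rintro (_ | j)
      · change M none none * (a * t) ≤ a * t
        rw [← mul_assoc]
        exact mul_le_mul_left mul_kstar_le_kstar t
      · exact (ht.2 j).trans hat
    · obtain ⟨hb, hM⟩ := hs i
      simp only [add_mul, add_le_iff] at hb hM
      refine ⟨hb.1, ?_⟩
      rintro (_ | j)
      · change M (some i) none * (a * t) ≤ s i
        simp only [t, mul_add, Finset.mul_sum, add_le_iff, IdemSemiring.sum_le_iff]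
        exact ⟨hb.2, fun j _ => by simpa only [mul_assoc] using (hM j).2⟩
      · exact (hM j).1
  · intro s' hs'
    have ha {x : K} (hx : x ≤ s' none) : a * x ≤ s' none :=
      kstar_mul_le hx ((hs' none).2 none)
    have hMa {x : K} (i : Q) (hx : x ≤ s' none) : M (some i) none * (a * x) ≤ s' (some i) :=
      (mul_le_mul_right (ha hx) _).trans ((hs' (some i)).2 none)
    have hle : s ≤ fun i => s' (some i) := by
      refine hmin fun i => ⟨add_le (hs' (some i)).1 (hMa i (hs' none).1), fun j => ?_⟩
      rw [add_mul, mul_assoc, mul_assoc]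
      exact add_le ((hs' (some i)).2 (some j)) (hMa i ((hs' none).2 (some j)))
    rintro (_ | i)
    · exact ha (add_le (hs' none).1 (IdemSemiring.sum_le_iff.2 fun j _ =>
        (mul_le_mul_right (hle j) _).trans ((hs' none).2 (some j))))
    · exact hle i

theorem exists_isLeast_affineSolutions {K Q : Type*} [KleeneAlgebra K] [Finite Q]
    (M : Q → Q → K) (b : Q → K) : ∃ s, IsLeast (affineSolutions M b) s := by
  induction Q using Finite.induction_empty_option with
  | of_equiv e ih =>
    obtain ⟨s, hs, hmin⟩ := ih (fun i j => M (e i) (e j)) (fun i => b (e i))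
    refine ⟨s ∘ e.symm, fun q => ⟨?_, fun q' => ?_⟩, fun s' hs' q => ?_⟩
    · simpa using (hs (e.symm q)).1
    · simpa using (hs (e.symm q)).2 (e.symm q')
    · have hle : s ≤ s' ∘ e := hmin fun i => ⟨(hs' (e i)).1, fun j => (hs' (e i)).2 (e j)⟩
      simpa using hle (e.symm q)
  | h_empty => exact ⟨b, fun q => q.elim, fun _ _ q => q.elim⟩
  | h_option ih => exact exists_isLeast_affineSolutions_option ih M b


/-- **Statement 8** (Least solutions of rational systems over a Kleene algebra).
For any Kleene algebra `K`, finite set `Q`, matrix `M : Q → Q → K` and vector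
`b : Q → K`, the system of inequations `b q + ∑ q', M q q' * s q' ≤ s q` has a
least solution. -/
theorem kleene_rational_system_least_solution
    (K : Type) [KleeneAlgebra K] (Q : Type) [Fintype Q]
    (M : Q → Q → K) (b : Q → K) :
    ∃ s : Q → K,
      (∀ q : Q, b q + ∑ q' : Q, M q q' * s q' ≤ s q) ∧
      ∀ s' : Q → K, (∀ q : Q, b q + ∑ q' : Q, M q q' * s' q' ≤ s' q) →
        ∀ q : Q, s q ≤ s' q := by
  obtain ⟨s, hs, hmin⟩ := exists_isLeast_affineSolutions M b
  exact ⟨s, mem_affineSolutions_iff_sum_le.1 hs,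
    fun s' hs' => hmin (mem_affineSolutions_iff_sum_le.2 hs')⟩
end
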